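/- arXiv:1901.06271 — 9 statements merged into one kernel-verified Lean document; each statement's English description precedes it below -/
import Mathlib

section
/- Let f : (-1,1) → ℂ belong to the Legendre maximal domain D_max. Then lim_{x→1⁻} (1-x²)·f(x) = 0 and lim_{x→-1⁺} (1-x²)·f(x) = 0, and moreover the one-sided limits lim_{x→1⁻} (1-x²)·f'(x) and lim_{x→-1⁺} (1-x²)·f'(x) both exist (i.e. are finite complex numbers). -/
open MeasureTheory Set Filter Topology

/-- The Legendre differential expression `ℓ[f](x) = -((1-x²) f'(x))'`. -/
noncomputable def legendreL (f : ℝ → ℂ) : ℝ → ℂ := fun x =>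
  -deriv (fun y : ℝ => ((1 - y ^ 2 : ℝ) : ℂ) * deriv f y) x

/-- The Legendre maximal domain: twice continuously differentiable functions on `(-1,1)`
with `f ∈ L²(-1,1)` and `ℓ[f] ∈ L²(-1,1)`. -/
def LegendreMaxDom (f : ℝ → ℂ) : Prop :=
  ContDiffOn ℝ 2 f (Ioo (-1 : ℝ) 1) ∧
  IntegrableOn (fun x : ℝ => ‖f x‖ ^ 2) (Ioo (-1 : ℝ) 1) ∧
  IntegrableOn (fun x : ℝ => ‖legendreL f x‖ ^ 2) (Ioo (-1 : ℝ) 1)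

theorem legendre_aux (f d p : ℝ → ℂ) (hf : ∀ x ∈ Ico (0:ℝ) 1, HasDerivAt f (d x) x)
    (hg : ∀ x ∈ Ico (0:ℝ) 1, HasDerivAt (fun y : ℝ => ((1 - y ^ 2 : ℝ) : ℂ) * d y) (p x) x)
    (hp : IntegrableOn p (Ioo 0 1)) :
    Tendsto (fun x : ℝ => ((1 - x ^ 2 : ℝ) : ℂ) * f x) (𝓝[<] (1 : ℝ)) (𝓝 0) ∧
    ∃ L : ℂ, Tendsto (fun x : ℝ => ((1 - x ^ 2 : ℝ) : ℂ) * d x) (𝓝[<] (1 : ℝ)) (𝓝 L) := by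
  have hp' : IntegrableOn p (Icc 0 1) := by
    rwa [integrableOn_Icc_iff_integrableOn_Ioo]
  have hpu : IntegrableOn p (uIcc 0 1) := by
    rwa [uIcc_of_le zero_le_one]
  have hc : ContinuousOn (fun x => d 0 + ∫ t in (0:ℝ)..x, p t) (Icc 0 1) := by
    have := intervalIntegral.continuousOn_primitive_interval hpu
    rw [uIcc_of_le zero_le_one] at this
    exact continuousOn_const.add this
  have hgeq : ∀ x ∈ Ico (0:ℝ) 1,
      ((1 - x ^ 2 : ℝ) : ℂ) * d x = d 0 + ∫ t in (0:ℝ)..x, p t := by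
    intro x hx
    have := intervalIntegral.integral_eq_sub_of_hasDerivAt (a := 0) (b := x)
      (f := fun y : ℝ => ((1 - y ^ 2 : ℝ) : ℂ) * d y) (f' := p) (by
        intro y hy
        rw [uIcc_of_le hx.1] at hy
        exact hg y ⟨hy.1, hy.2.trans_lt hx.2⟩) (by
        rw [intervalIntegrable_iff_integrableOn_Icc_of_le hx.1]
        exact hp'.mono_set (Icc_subset_Icc le_rfl hx.2.le))
    rw [this]
    simp
  have hmem : ∀ᶠ x in 𝓝[<] (1:ℝ), x ∈ Ico (0:ℝ) 1 := by
    filter_upwards [Ioo_mem_nhdsLT (zero_lt_one (α := ℝ))] with x hx using ⟨hx.1.le, hx.2⟩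
  refine ⟨?_, d 0 + ∫ t in (0:ℝ)..1, p t, ?_⟩
  · obtain ⟨C, hC⟩ := isCompact_Icc.exists_bound_of_continuousOn hc
    have hC0 : 0 ≤ C := (norm_nonneg _).trans (hC 0 (by simp))
    have hd : ∀ x ∈ Ico (0:ℝ) 1, ‖d x‖ ≤ C / (1 - x) := by
      intro x hx
      have h1 := hC x ⟨hx.1, hx.2.le⟩
      have h2 := hgeq x hx
      rw [← h2, norm_mul, Complex.norm_real, Real.norm_eq_abs,
        abs_of_nonneg (by nlinarith [hx.1, hx.2])] at h1
      have h3 : 0 < 1 - x := by linarith [hx.2]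
      rw [le_div_iff₀ h3]
      have : ‖d x‖ * (1 - x) ≤ ‖d x‖ * (1 - x^2) :=
        mul_le_mul_of_nonneg_left (by nlinarith [hx.1, hx.2]) (norm_nonneg _)
      linarith
    have hB : ∀ x ∈ Ico (0:ℝ) 1, ‖f x‖ ≤ ‖f 0‖ - C * Real.log (1 - x) := by
      intro x hx
      have hder : ∀ y ∈ Icc (0:ℝ) x,
          HasDerivAt (fun y => ‖f 0‖ - C * Real.log (1 - y)) (C / (1 - y)) y := by
        intro y hy
        have h3 : 1 - y ≠ 0 := by linarith [hx.2, hy.2]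
        have := ((((hasDerivAt_id y).const_sub 1).log h3).const_mul C).const_sub ‖f 0‖
        refine this.congr_deriv ?_
        simp only [id]
        ring
      exact image_norm_le_of_norm_deriv_right_le_deriv_boundary' (a := 0) (b := x)
        (f := f) (f' := d) (B := fun y => ‖f 0‖ - C * Real.log (1 - y))
        (B' := fun y => C / (1 - y))
        (fun y hy => (hf y ⟨hy.1, hy.2.trans_lt hx.2⟩).continuousAt.continuousWithinAt)
        (fun y hy => (hf y ⟨hy.1, hy.2.trans hx.2⟩).hasDerivWithinAt)
        (by simp)
        (fun y hy => (hder y hy).continuousAt.continuousWithinAt)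
        (fun y hy => (hder y ⟨hy.1, hy.2.le⟩).hasDerivWithinAt)
        (fun y hy => hd y ⟨hy.1, hy.2.trans hx.2⟩) ⟨hx.1, le_rfl⟩
    have hlim : Tendsto (fun x : ℝ => (1 + x) * ((1 - x) * ‖f 0‖ -
        C * ((1 - x) * Real.log (1 - x)))) (𝓝[<] (1:ℝ)) (𝓝 0) := by
      have hcont : Continuous (fun x : ℝ => (1 + x) * ((1 - x) * ‖f 0‖ -
          C * ((1 - x) * Real.log (1 - x)))) := by
        have := Real.continuous_mul_log.comp (continuous_const.sub continuous_id : Continuous fun x : ℝ => 1 - x)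
        have h2 : Continuous (fun x : ℝ => (1 - x) * Real.log (1 - x)) := this
        fun_prop
      have := hcont.tendsto 1
      simp only [sub_self, zero_mul, mul_zero] at this
      exact this.mono_left nhdsWithin_le_nhds
    refine squeeze_zero_norm' ?_ hlim
    filter_upwards [hmem] with x hx
    have h0 : 0 ≤ 1 - x ^ 2 := by nlinarith [hx.1, hx.2]
    rw [norm_mul, Complex.norm_real, Real.norm_eq_abs, abs_of_nonneg h0]
    calc _ ≤ (1 - x ^ 2) * (‖f 0‖ - C * Real.log (1 - x)) :=
          mul_le_mul_of_nonneg_left (hB x hx) h0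
      _ = _ := by ring
  · have h1 := hc 1 (by simp)
    have h2 : Tendsto (fun x => d 0 + ∫ t in (0:ℝ)..x, p t) (𝓝[<] (1:ℝ))
        (𝓝 (d 0 + ∫ t in (0:ℝ)..1, p t)) := by
      refine h1.tendsto.mono_left ?_
      refine nhdsWithin_le_iff.2 ?_
      filter_upwards [hmem] with x hx using ⟨hx.1, hx.2.le⟩
    refine h2.congr' ?_
    filter_upwards [hmem] with x hx using (hgeq x hx).symm

/-- If `f` belongs to the Legendre maximal domain, then `(1-x²)f(x) → 0` at both
endpoints, and the one-sided limits of `(1-x²)f'(x)` exist at both endpoints. -/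
theorem legendre_maxdomain_endpoint_behavior (f : ℝ → ℂ) (hf : LegendreMaxDom f) :
    Tendsto (fun x : ℝ => ((1 - x ^ 2 : ℝ) : ℂ) * f x) (𝓝[<] (1 : ℝ)) (𝓝 0) ∧
    Tendsto (fun x : ℝ => ((1 - x ^ 2 : ℝ) : ℂ) * f x) (𝓝[>] (-1 : ℝ)) (𝓝 0) ∧
    (∃ L : ℂ, Tendsto (fun x : ℝ => ((1 - x ^ 2 : ℝ) : ℂ) * deriv f x) (𝓝[<] (1 : ℝ)) (𝓝 L)) ∧
    (∃ L : ℂ, Tendsto (fun x : ℝ => ((1 - x ^ 2 : ℝ) : ℂ) * deriv f x) (𝓝[>] (-1 : ℝ)) (𝓝 L)) := by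
  obtain ⟨hc, -, hl⟩ := hf
  set g : ℝ → ℂ := fun y : ℝ => ((1 - y ^ 2 : ℝ) : ℂ) * deriv f y with hgdef
  have hfd : ∀ x ∈ Ioo (-1:ℝ) 1, HasDerivAt f (deriv f x) x := fun x hx =>
    ((hc.differentiableOn (by norm_num)).differentiableAt (isOpen_Ioo.mem_nhds hx)).hasDerivAt
  have hgd : ∀ x ∈ Ioo (-1:ℝ) 1, HasDerivAt g (deriv g x) x := by
    intro x hx
    have h1 : ContDiffOn ℝ 1 (deriv f) (Ioo (-1:ℝ) 1) :=
      hc.deriv_of_isOpen isOpen_Ioo (by norm_num)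
    have h2 : DifferentiableAt ℝ (deriv f) x :=
      (h1.differentiableOn (by norm_num)).differentiableAt (isOpen_Ioo.mem_nhds hx)
    have h3 : DifferentiableAt ℝ (fun y : ℝ => ((1 - y ^ 2 : ℝ) : ℂ)) x := by
      have : DifferentiableAt ℝ (fun y : ℝ => (1 - y ^ 2 : ℝ)) x := by fun_prop
      exact this.hasDerivAt.ofReal_comp.differentiableAt
    exact (h3.mul h2).hasDerivAt
  have hint : IntegrableOn (deriv g) (Ioo (-1:ℝ) 1) := by
    have h1 : IntegrableOn (fun x => 1 + ‖legendreL f x‖ ^ 2) (Ioo (-1:ℝ) 1) :=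
      (integrableOn_const (by simp)).add hl
    refine Integrable.mono' h1 (stronglyMeasurable_deriv g).aestronglyMeasurable ?_
    refine Eventually.of_forall fun x => ?_
    have : ‖legendreL f x‖ = ‖deriv g x‖ := by
      simp only [legendreL, norm_neg, hgdef]
    simp only [this]
    nlinarith [sq_nonneg (‖deriv g x‖ - 1), norm_nonneg (deriv g x)]
  have hA := legendre_aux f (deriv f) (deriv g)
    (fun x hx => hfd x ⟨by linarith [hx.1], hx.2⟩)
    (fun x hx => hgd x ⟨by linarith [hx.1], hx.2⟩)
    (hint.mono_set (Ioo_subset_Ioo (by norm_num) le_rfl))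
  have hB := legendre_aux (fun x => f (-x)) (fun x => -deriv f (-x)) (fun x => deriv g (-x))
    (fun x hx => by
      have := (hfd (-x) ⟨by linarith [hx.2], by linarith [hx.1]⟩).scomp x (hasDerivAt_neg x)
      simpa [Function.comp_def] using this)
    (fun x hx => by
      have := ((hgd (-x) ⟨by linarith [hx.2], by linarith [hx.1]⟩).scomp x (hasDerivAt_neg x)).neg
      refine (this.congr_deriv (by simp)).congr_of_eventuallyEq
        (Eventually.of_forall fun y => ?_)
      simp [hgdef])
    (by
      have h := (hint.mono_set (Ioo_subset_Ioo le_rfl (by norm_num) : Ioo (-1:ℝ) 0 ⊆ Ioo (-1) 1))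
      have h2 := (Measure.measurePreserving_neg (volume : Measure ℝ)).integrableOn_comp_preimage
        (Homeomorph.neg ℝ).measurableEmbedding (f := deriv g) (s := Ioo (-1:ℝ) 0)
      have h3 := h2.2 h
      simpa [Function.comp_def] using h3)
  have hneg : Tendsto (fun x : ℝ => -x) (𝓝[>] (-1:ℝ)) (𝓝[<] (1:ℝ)) := by
    simpa using tendsto_neg_nhdsGT (a := (-1:ℝ))
  refine ⟨hA.1, ?_, hA.2, ?_⟩
  · simpa [Function.comp_def] using hB.1.comp hneg
  · obtain ⟨L, hL⟩ := hB.2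
    exact ⟨-L, by simpa [Function.comp_def, hgdef] using (hL.comp hneg).neg⟩
end

section
/- Let j ≥ 1 be an integer and let f : (-1,1) → ℂ belong to the Legendre maximal domain D_max. Then lim_{x→1⁻} (1-x²)·( f'(x)(1-x)^j + j·f(x)(1-x)^{j-1} ) = 0 and lim_{x→-1⁺} (1-x²)·( f'(x)(1+x)^j − j·f(x)(1+x)^{j-1} ) = 0; equivalently, the sesquilinear form [f,(1-x)^j] vanishes in the limit at the endpoint 1 and [f,(1+x)^j] vanishes in the limit at the endpoint -1 (so these power functions lie in the minimal domain of the Legendre expression). -/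
open MeasureTheory Set Filter Topology

theorem p_contDiffOn (f : ℝ → ℂ) (hf : LegendreMaxDom f) :
    ContDiffOn ℝ 1 (fun y : ℝ => ((1 - y ^ 2 : ℝ) : ℂ) * deriv f y) (Ioo (-1 : ℝ) 1) := by
  have h1 : ContDiffOn ℝ 1 (deriv f) (Ioo (-1 : ℝ) 1) :=
    hf.1.deriv_of_isOpen isOpen_Ioo (by norm_num)
  have h2 : ContDiff ℝ 1 (fun y : ℝ => ((1 - y ^ 2 : ℝ) : ℂ)) :=
    Complex.ofRealCLM.contDiff.comp
      (contDiff_const.sub (contDiff_id.pow 2) : ContDiff ℝ 1 (fun y : ℝ => 1 - y ^ 2))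
  exact h2.contDiffOn.mul h1

theorem p_bounded (f : ℝ → ℂ) (hf : LegendreMaxDom f) :
    ∃ C : ℝ, 0 ≤ C ∧ ∀ x ∈ Ico (0 : ℝ) 1, ‖((1 - x ^ 2 : ℝ) : ℂ) * deriv f x‖ ≤ C := by
  have hp := p_contDiffOn f hf
  have hL := hf.2.2
  unfold legendreL at hL
  simp only [norm_neg] at hL
  set p : ℝ → ℂ := fun y : ℝ => ((1 - y ^ 2 : ℝ) : ℂ) * deriv f y with hpdef
  have hc : ContinuousOn (deriv p) (Ioo (-1 : ℝ) 1) :=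
    hp.continuousOn_deriv_of_isOpen isOpen_Ioo le_rfl
  have hint : IntegrableOn (fun x => 1 + ‖deriv p x‖ ^ 2) (Ioo (-1 : ℝ) 1) :=
    (integrableOn_const (by simp)).add hL
  have hI0 : 0 ≤ ∫ x in Ioo (-1 : ℝ) 1, (1 + ‖deriv p x‖ ^ 2) :=
    integral_nonneg fun x => by positivity
  refine ⟨‖p 0‖ + ∫ x in Ioo (-1 : ℝ) 1, (1 + ‖deriv p x‖ ^ 2), by positivity, ?_⟩
  intro x hx
  have hsub : Icc 0 x ⊆ Ioo (-1 : ℝ) 1 := fun y hy => ⟨by linarith [hy.1], lt_of_le_of_lt hy.2 hx.2⟩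
  have hftc : ∫ y in (0 : ℝ)..x, deriv p y = p x - p 0 := by
    apply intervalIntegral.integral_eq_sub_of_hasDerivAt
    · intro y hy
      rw [uIcc_of_le hx.1] at hy
      exact ((hp.differentiableOn one_ne_zero).differentiableAt
        (isOpen_Ioo.mem_nhds (hsub hy))).hasDerivAt
    · apply ContinuousOn.intervalIntegrable
      rw [uIcc_of_le hx.1]
      exact hc.mono hsub
  have hb : ‖∫ y in (0 : ℝ)..x, deriv p y‖ ≤ ∫ x in Ioo (-1 : ℝ) 1, (1 + ‖deriv p x‖ ^ 2) := by
    rw [intervalIntegral.integral_of_le hx.1]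
    have hs2 : Ioc 0 x ⊆ Ioo (-1 : ℝ) 1 := Ioc_subset_Icc_self.trans hsub
    calc _ ≤ ∫ y in Ioc 0 x, (1 + ‖deriv p y‖ ^ 2) := by
          apply norm_integral_le_of_norm_le (hint.mono_set hs2)
          exact Eventually.of_forall fun y => by nlinarith [sq_nonneg (‖deriv p y‖ - 1), sq_nonneg ‖deriv p y‖]
      _ ≤ _ := setIntegral_mono_set hint (Eventually.of_forall fun y => by
          simp only [Pi.zero_apply]; positivity) hs2.eventuallyLE
  change ‖p x‖ ≤ _
  have : p x = p 0 + ∫ y in (0 : ℝ)..x, deriv p y := by rw [hftc]; ring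
  rw [this]
  exact (norm_add_le _ _).trans (by gcongr)

theorem f_log_bound (f : ℝ → ℂ) (hf : LegendreMaxDom f) (C : ℝ) (hC : 0 ≤ C)
    (hb : ∀ x ∈ Ico (0 : ℝ) 1, ‖((1 - x ^ 2 : ℝ) : ℂ) * deriv f x‖ ≤ C) :
    ∀ x ∈ Ico (0 : ℝ) 1, ‖f x‖ ≤ ‖f 0‖ - C * Real.log (1 - x) := by
  intro x hx
  have hsub : Icc 0 x ⊆ Ioo (-1 : ℝ) 1 := fun y hy => ⟨by linarith [hy.1], lt_of_le_of_lt hy.2 hx.2⟩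
  have hd : ∀ y ∈ Ioo (-1 : ℝ) 1, HasDerivAt f (deriv f y) y := fun y hy =>
    ((hf.1.differentiableOn two_ne_zero).differentiableAt (isOpen_Ioo.mem_nhds hy)).hasDerivAt
  have hB : ∀ y ∈ Ioo (-1 : ℝ) 1, HasDerivAt (fun y => ‖f 0‖ - C * Real.log (1 - y)) (C / (1 - y)) y := by
    intro y hy
    have h1 : HasDerivAt (fun y : ℝ => 1 - y) (-1) y := by
      simpa using (hasDerivAt_id y).const_sub 1
    have := ((h1.log (by linarith [hy.2])).const_mul C).const_sub ‖f 0‖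
    have e : C / (1 - y) = -(C * (-1 / (1 - y))) := by ring
    rw [e]
    exact this
  refine image_norm_le_of_norm_deriv_right_le_deriv_boundary' (a := 0) (b := x) (f := f) (f' := deriv f)
    (B := fun y => ‖f 0‖ - C * Real.log (1 - y)) (B' := fun y => C / (1 - y))
    (hf.1.continuousOn.mono hsub) (fun y hy => (hd y (hsub (Ico_subset_Icc_self hy))).hasDerivWithinAt)
    (by simp) (fun y hy => (hB y (hsub hy)).continuousAt.continuousWithinAt)
    (fun y hy => (hB y (hsub (Ico_subset_Icc_self hy))).hasDerivWithinAt) ?_ (right_mem_Icc.2 hx.1)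
  intro y hy
  have hy1 : y < 1 := hy.2.trans hx.2
  have := hb y ⟨hy.1, hy1⟩
  have h0 : 0 < 1 - y := by linarith
  rw [norm_mul, Complex.norm_real, Real.norm_eq_abs, abs_of_nonneg (by nlinarith [hy.1])] at this
  rw [le_div_iff₀ h0]
  nlinarith [norm_nonneg (deriv f y), mul_nonneg (mul_nonneg hy.1 h0.le) (norm_nonneg (deriv f y))]

theorem right_end (j : ℕ) (hj : 1 ≤ j) (f : ℝ → ℂ) (hf : LegendreMaxDom f) :
    Tendsto (fun x : ℝ => ((1 - x ^ 2 : ℝ) : ℂ) *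
        (deriv f x * (((1 - x) ^ j : ℝ) : ℂ) + (j : ℂ) * f x * (((1 - x) ^ (j - 1) : ℝ) : ℂ)))
      (𝓝[<] (1 : ℝ)) (𝓝 0) := by
  obtain ⟨C, hC, hb⟩ := p_bounded f hf
  have hl := f_log_bound f hf C hC hb
  have hlim : Tendsto (fun x : ℝ => C * (1 - x) +
      2 * j * (‖f 0‖ * (1 - x) - C * ((1 - x) * Real.log (1 - x)))) (𝓝[<] (1 : ℝ)) (𝓝 0) := by
    have hcont : Continuous (fun x : ℝ => C * (1 - x) +
      2 * j * (‖f 0‖ * (1 - x) - C * ((1 - x) * Real.log (1 - x)))) := by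
      have := Real.continuous_mul_log.comp (by fun_prop : Continuous fun x : ℝ => 1 - x)
      simp only [Function.comp_def] at this
      fun_prop
    have := (hcont.tendsto 1).mono_left (nhdsWithin_le_nhds (s := Iio 1))
    simpa using this
  apply squeeze_zero_norm' _ hlim
  filter_upwards [Ioo_mem_nhdsLT (show (0 : ℝ) < 1 by norm_num)] with x hx
  have h0 : 0 < 1 - x := by linarith [hx.2]
  have hle : 1 - x ≤ 1 := by linarith [hx.1]
  obtain ⟨k, rfl⟩ : ∃ k, j = k + 1 := ⟨j - 1, by omega⟩
  simp only [Nat.add_sub_cancel]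
  have hk1 : (1 - x) ^ k ≤ 1 := pow_le_one₀ h0.le hle
  have hk0 : 0 ≤ (1 - x) ^ k := by positivity
  have hp := hb x ⟨hx.1.le, hx.2⟩
  have hfx := hl x ⟨hx.1.le, hx.2⟩
  have e : ((1 - x ^ 2 : ℝ) : ℂ) * (deriv f x * (((1 - x) ^ (k + 1) : ℝ) : ℂ) +
      ((k + 1 : ℕ) : ℂ) * f x * (((1 - x) ^ k : ℝ) : ℂ)) =
      (((1 - x ^ 2 : ℝ) : ℂ) * deriv f x) * (((1 - x) ^ (k + 1) : ℝ) : ℂ) +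
      (((k + 1 : ℕ) * ((1 - x ^ 2) * (1 - x) ^ k) : ℝ) : ℂ) * f x := by
    push_cast; ring
  rw [e]
  refine (norm_add_le _ _).trans (add_le_add ?_ ?_)
  · rw [norm_mul, Complex.norm_real, Real.norm_eq_abs, abs_of_nonneg (by positivity)]
    gcongr
    rw [pow_succ]
    nlinarith
  · have h2 : 0 ≤ 1 - x ^ 2 := by nlinarith [hx.1]
    rw [norm_mul, Complex.norm_real, Real.norm_eq_abs, abs_of_nonneg (by positivity)]
    have h3 : (1 - x ^ 2) * (1 - x) ^ k ≤ 2 * (1 - x) := by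
      nlinarith [mul_le_mul_of_nonneg_left hk1 h2, hx.1, hx.2]
    calc _ ≤ ((k + 1 : ℕ) * (2 * (1 - x)) : ℝ) * (‖f 0‖ - C * Real.log (1 - x)) := by gcongr
      _ = _ := by ring

theorem reflect_dom (f : ℝ → ℂ) (hf : LegendreMaxDom f) : LegendreMaxDom (fun x => f (-x)) := by
  have hpre : (fun x : ℝ => -x) ⁻¹' Ioo (-1 : ℝ) 1 = Ioo (-1 : ℝ) 1 := by
    ext x; simp only [mem_preimage, mem_Ioo]; constructor <;> rintro ⟨a, b⟩ <;> constructor <;> linarith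
  have key : ∀ g : ℝ → ℝ, IntegrableOn g (Ioo (-1 : ℝ) 1) →
      IntegrableOn (fun x => g (-x)) (Ioo (-1 : ℝ) 1) := by
    intro g hg
    have := ((Measure.measurePreserving_neg (volume : Measure ℝ)).integrableOn_comp_preimage
      (MeasurableEquiv.neg ℝ).measurableEmbedding (f := g) (s := Ioo (-1 : ℝ) 1)).2 hg
    rw [show (Neg.neg : ℝ → ℝ) = fun x => -x from rfl, hpre] at this
    exact this
  refine ⟨?_, key _ hf.2.1, ?_⟩
  · exact hf.1.comp contDiff_neg.contDiffOn (fun x hx => by rw [← hpre] at hx; exact hx)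
  · have : legendreL (fun x => f (-x)) = fun x => legendreL f (-x) := by
      funext x
      unfold legendreL
      have e : (fun y : ℝ => ((1 - y ^ 2 : ℝ) : ℂ) * deriv (fun x => f (-x)) y) =
          fun y => -((fun z : ℝ => ((1 - z ^ 2 : ℝ) : ℂ) * deriv f z) (-y)) := by
        funext y
        simp [deriv_comp_neg]
      rw [e, deriv.fun_neg, deriv_comp_neg (fun z : ℝ => ((1 - z ^ 2 : ℝ) : ℂ) * deriv f z)]
      simp
    rw [this]
    exact key _ hf.2.2

/-- For `j ≥ 1` and `f` in the Legendre maximal domain, the sesquilinear form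
`[f,(1-x)^j] = (1-x²)(f'(x)(1-x)^j + j f(x)(1-x)^{j-1})` vanishes in the limit at `1`,
and `[f,(1+x)^j] = (1-x²)(f'(x)(1+x)^j − j f(x)(1+x)^{j-1})` vanishes in the limit at `-1`;
i.e. these power functions lie in the minimal domain of the Legendre expression. -/
theorem legendre_powers_in_minimal_domain (j : ℕ) (hj : 1 ≤ j)
    (f : ℝ → ℂ) (hf : LegendreMaxDom f) :
    Tendsto (fun x : ℝ => ((1 - x ^ 2 : ℝ) : ℂ) *
        (deriv f x * (((1 - x) ^ j : ℝ) : ℂ) + (j : ℂ) * f x * (((1 - x) ^ (j - 1) : ℝ) : ℂ)))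
      (𝓝[<] (1 : ℝ)) (𝓝 0) ∧
    Tendsto (fun x : ℝ => ((1 - x ^ 2 : ℝ) : ℂ) *
        (deriv f x * (((1 + x) ^ j : ℝ) : ℂ) - (j : ℂ) * f x * (((1 + x) ^ (j - 1) : ℝ) : ℂ)))
      (𝓝[>] (-1 : ℝ)) (𝓝 0) := by
  refine ⟨right_end j hj f hf, ?_⟩
  have h := right_end j hj _ (reflect_dom f hf)
  have hn : Tendsto (fun x : ℝ => -x) (𝓝[>] (-1 : ℝ)) (𝓝[<] (1 : ℝ)) := by
    simpa using tendsto_neg_nhdsGT (a := (-1 : ℝ))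
  have h2 := (h.comp hn).neg
  rw [neg_zero] at h2
  refine h2.congr fun x => ?_
  simp only [Function.comp_apply, deriv_comp_neg, neg_neg]
  push_cast
  ring
end

section
/- Let m ∈ ℕ₀ and let P_m denote the m-th Legendre polynomial. Then the following two subsets of the Legendre maximal domain D_max coincide: { f ∈ D_max : lim_{x→1⁻}(1-x²)f'(x) = 0 and lim_{x→-1⁺}(1-x²)f'(x) = 0 } and { f ∈ D_max : lim_{x→1⁻}(1-x²)(f'(x)P_m(x) − f(x)P_m'(x)) = 0 and lim_{x→-1⁺}(1-x²)(f'(x)P_m(x) − f(x)P_m'(x)) = 0 }. In other words, the self-adjoint boundary conditions [f,1](±1)=0 and [f,P_m](±1)=0 determine the same domain. -/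
open MeasureTheory Set Filter Topology

/-- The `m`-th Legendre polynomial
`P_m(x) = Σ_{j=0}^{m} (-1/2)^j C(m,j) C(m+j,j) (1-x)^j`. -/
noncomputable def legendreP (m : ℕ) (x : ℝ) : ℝ :=
  ∑ j ∈ Finset.range (m + 1),
    (-(1 : ℝ) / 2) ^ j * (m.choose j : ℝ) * ((m + j).choose j : ℝ) * (1 - x) ^ j

lemma legendreP_contDiff (m : ℕ) : ContDiff ℝ 2 (legendreP m) := by
  unfold legendreP
  fun_prop

lemma legendreP_one (m : ℕ) : legendreP m 1 = 1 := by
  unfold legendreP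
  rw [Finset.sum_eq_single 0]
  · simp
  · intro j _ hj
    simp [hj]
  · simp

lemma legendreP_neg_one (m : ℕ) : legendreP m (-1) ≠ 0 := by
  have key : ∀ x : ℤ, legendreP m (1 - 2 * x) = ((Polynomial.eval x (Polynomial.shiftedLegendre m) : ℤ) : ℝ) := by
    intro x
    unfold legendreP Polynomial.shiftedLegendre
    rw [Polynomial.eval_finsetSum]
    push_cast
    refine Finset.sum_congr rfl fun j _ => ?_
    have : (m + j).choose j = (m + j).choose m := by
      rw [Nat.choose_symm_add]
    rw [this]
    have h2 : (1 - (1 - 2 * (x:ℝ))) ^ j = 2 ^ j * (x:ℝ) ^ j := by rw [← mul_pow]; congr 1; ring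
    have h3 : (-(1 : ℝ) / 2) ^ j * 2 ^ j = (-1) ^ j := by rw [← mul_pow]; congr 1; ring
    rw [h2]
    simp only [Polynomial.eval_mul, Polynomial.eval_pow, Polynomial.eval_X, Polynomial.eval_C]
    push_cast
    rw [← h3]
    ring
  have h1 := key 1
  have h0 := key 0
  have hs := Polynomial.shiftedLegendre_eval_symm m (1 : ℤ)
  simp only [Polynomial.coe_aeval_eq_eval, sub_self] at hs
  rw [hs] at h1
  norm_num at h1 h0
  rw [legendreP_one] at h0
  rw [h1, ← h0]
  simp

lemma bounded_u (f : ℝ → ℂ) (hf : LegendreMaxDom f) :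
    ∃ C : ℝ, ∀ x ∈ Ioo (-1 : ℝ) 1, ‖((1 - x ^ 2 : ℝ) : ℂ) * deriv f x‖ ≤ C := by
  obtain ⟨h1, -, h3⟩ := hf
  set u : ℝ → ℂ := fun y : ℝ => ((1 - y ^ 2 : ℝ) : ℂ) * deriv f y with hu
  have hdu : ∀ x ∈ Ioo (-1 : ℝ) 1, HasDerivAt u (deriv u x) x := by
    intro x hx
    have hc : ContDiffAt ℝ 2 f x := h1.contDiffAt (isOpen_Ioo.mem_nhds hx)
    have hd : DifferentiableOn ℝ (deriv f) (Ioo (-1 : ℝ) 1) :=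
      ((contDiffOn_succ_iff_deriv_of_isOpen (n := 1) isOpen_Ioo).1 (by rw [one_add_one_eq_two]; exact h1)).2.2.differentiableOn
        (by simp)
    have hd' : DifferentiableAt ℝ (deriv f) x := hd.differentiableAt (isOpen_Ioo.mem_nhds hx)
    have : DifferentiableAt ℝ (fun y : ℝ => ((1 - y ^ 2 : ℝ) : ℂ)) x :=
      Complex.ofRealCLM.differentiableAt.comp x (by fun_prop : DifferentiableAt ℝ (fun y : ℝ => 1 - y ^ 2) x)
    exact (this.mul hd').hasDerivAt
  have hL : ∀ x, ‖legendreL f x‖ = ‖deriv u x‖ := fun x => by simp [legendreL, hu]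
  have hint : IntegrableOn (deriv u) (Ioo (-1 : ℝ) 1) := by
    have hg : IntegrableOn (fun x => 1 + ‖legendreL f x‖ ^ 2) (Ioo (-1 : ℝ) 1) :=
      (integrableOn_const (by simp)).add h3
    refine Integrable.mono' hg (measurable_deriv u).aestronglyMeasurable ?_
    refine Eventually.of_forall fun x => ?_
    rw [hL]
    nlinarith [sq_nonneg (‖deriv u x‖ - 1), norm_nonneg (deriv u x)]
  refine ⟨‖u 0‖ + ∫ x in Ioo (-1 : ℝ) 1, ‖deriv u x‖, fun x hx => ?_⟩
  have hsub : uIcc 0 x ⊆ Ioo (-1 : ℝ) 1 :=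
    (convex_Ioo (-1 : ℝ) 1).ordConnected.uIcc_subset (by simp) hx
  have hsub' : uIoc 0 x ⊆ Ioo (-1 : ℝ) 1 := uIoc_subset_uIcc.trans hsub
  have hii : IntervalIntegrable (deriv u) volume 0 x :=
    intervalIntegrable_iff.2 (hint.mono_set hsub')
  have h := intervalIntegral.integral_eq_sub_of_hasDerivAt (fun y hy => hdu y (hsub hy)) hii
  have h' : ‖u x - u 0‖ ≤ ∫ x in Ioo (-1 : ℝ) 1, ‖deriv u x‖ := by
    rw [← h]
    refine intervalIntegral.norm_integral_le_integral_norm_uIoc.trans ?_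
    exact setIntegral_mono_set hint.norm (Eventually.of_forall fun _ => norm_nonneg _)
      (LE.le.eventuallyLE hsub')
  have : u x = u 0 + (u x - u 0) := by ring
  calc ‖u x‖ = ‖u 0 + (u x - u 0)‖ := by rw [← this]
    _ ≤ _ := (norm_add_le _ _).trans (by gcongr)

lemma pf_tendsto (f : ℝ → ℂ) (hf : DifferentiableOn ℝ f (Ioo (-1 : ℝ) 1)) (C : ℝ)
    (hC : ∀ x ∈ Ioo (-1 : ℝ) 1, ‖((1 - x ^ 2 : ℝ) : ℂ) * deriv f x‖ ≤ C) :
    Tendsto (fun x : ℝ => ((1 - x ^ 2 : ℝ) : ℂ) * f x) (𝓝[<] (1 : ℝ)) (𝓝 0) := by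
  have hd : ∀ x ∈ Ioo (-1 : ℝ) 1, HasDerivAt f (deriv f x) x := fun x hx =>
    (hf.differentiableAt (isOpen_Ioo.mem_nhds hx)).hasDerivAt
  have hB : ∀ x < (1 : ℝ), HasDerivAt (fun x : ℝ => ‖f 0‖ - C * Real.log (1 - x)) (C / (1 - x)) x := by
    intro x hx
    have h1 : HasDerivAt (fun x : ℝ => 1 - x) (-1) x := by
      simpa using (hasDerivAt_id x).const_sub 1
    have := ((h1.log (by linarith)).const_mul C).const_sub ‖f 0‖
    exact this.congr_deriv (by ring)
  have bound : ∀ x ∈ Ico (0 : ℝ) 1, ‖f x‖ ≤ ‖f 0‖ - C * Real.log (1 - x) := by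
    intro x hx
    have hs : ∀ y ∈ Icc 0 x, y ∈ Ioo (-1 : ℝ) 1 := fun y hy =>
      ⟨by linarith [hy.1], by linarith [hy.2, hx.2]⟩
    refine image_norm_le_of_norm_deriv_right_le_deriv_boundary' (a := 0) (b := x) (f' := deriv f)
      (B := fun x : ℝ => ‖f 0‖ - C * Real.log (1 - x)) (B' := fun x => C / (1 - x))
      (fun y hy => (hd y (hs y hy)).continuousAt.continuousWithinAt)
      (fun y hy => (hd y (hs y (Ico_subset_Icc_self hy))).hasDerivWithinAt) (by simp)
      (fun y hy => (hB y (hs y hy).2).continuousAt.continuousWithinAt)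
      (fun y hy => (hB y (hs y (Ico_subset_Icc_self hy)).2).hasDerivWithinAt) ?_ ⟨hx.1, le_rfl⟩
    intro y hy
    have hy' := hs y (Ico_subset_Icc_self hy)
    have h1 := hC y hy'
    have h0 : 0 < 1 - y := by linarith [hy'.2]
    rw [norm_mul, Complex.norm_real, Real.norm_eq_abs, abs_of_pos (by nlinarith [hy.1])] at h1
    rw [le_div_iff₀ h0]
    refine le_trans ?_ h1
    rw [mul_comm]
    gcongr
    nlinarith [hy.1, hy'.2]
  have hlim : Tendsto (fun x : ℝ => (1 + x) * ((1 - x) * ‖f 0‖ - C * ((1 - x) * Real.log (1 - x))))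
      (𝓝[<] (1 : ℝ)) (𝓝 0) := by
    have hc : Continuous (fun x : ℝ => (1 + x) * ((1 - x) * ‖f 0‖ - C * ((1 - x) * Real.log (1 - x)))) := by
      have := Real.continuous_mul_log.comp (by fun_prop : Continuous fun x : ℝ => 1 - x)
      have h2 : Continuous fun x : ℝ => (1 - x) * Real.log (1 - x) := this
      fun_prop
    have := hc.tendsto 1
    simp only [sub_self, zero_mul, mul_zero] at this
    exact this.mono_left nhdsWithin_le_nhds
  refine squeeze_zero_norm' ?_ hlim
  have : Ioo (0 : ℝ) 1 ∈ 𝓝[<] (1 : ℝ) := Ioo_mem_nhdsLT (by norm_num)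
  filter_upwards [this] with x hx
  have h0 : 0 < 1 - x := by linarith [hx.2]
  have h1 : 0 < 1 + x := by linarith [hx.1]
  rw [norm_mul, Complex.norm_real, Real.norm_eq_abs, abs_of_pos (by nlinarith)]
  have := mul_le_mul_of_nonneg_left (bound x ⟨hx.1.le, hx.2⟩) (mul_pos h1 h0).le
  nlinarith

lemma pf_tendsto_left (f : ℝ → ℂ) (hf : DifferentiableOn ℝ f (Ioo (-1 : ℝ) 1)) (C : ℝ)
    (hC : ∀ x ∈ Ioo (-1 : ℝ) 1, ‖((1 - x ^ 2 : ℝ) : ℂ) * deriv f x‖ ≤ C) :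
    Tendsto (fun x : ℝ => ((1 - x ^ 2 : ℝ) : ℂ) * f x) (𝓝[>] (-1 : ℝ)) (𝓝 0) := by
  have hmem : ∀ x ∈ Ioo (-1 : ℝ) 1, -x ∈ Ioo (-1 : ℝ) 1 := fun x hx =>
    ⟨by linarith [hx.2], by linarith [hx.1]⟩
  have h := pf_tendsto (fun x => f (-x)) (hf.comp (by fun_prop) hmem) C (by
    intro x hx
    have := hC (-x) (hmem x hx)
    rw [deriv_comp_neg]
    simpa using this)
  have hn : Tendsto (fun x : ℝ => -x) (𝓝[>] (-1 : ℝ)) (𝓝[<] (1 : ℝ)) := by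
    simpa using tendsto_neg_nhdsGT (a := (-1 : ℝ))
  refine (h.comp hn).congr fun x => ?_
  simp

lemma tendsto_equiv (f : ℝ → ℂ) (l : Filter ℝ) (a : ℝ) (hl : l ≤ 𝓝 a) (Q : ℝ → ℝ)
    (hQ : ContDiff ℝ 2 Q) (ha : Q a ≠ 0)
    (h : Tendsto (fun x : ℝ => ((1 - x ^ 2 : ℝ) : ℂ) * f x) l (𝓝 0)) :
    Tendsto (fun x : ℝ => ((1 - x ^ 2 : ℝ) : ℂ) * deriv f x) l (𝓝 0) ↔
    Tendsto (fun x : ℝ => ((1 - x ^ 2 : ℝ) : ℂ) *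
            (deriv f x * ((Q x : ℝ) : ℂ) - f x * ((deriv Q x : ℝ) : ℂ))) l (𝓝 0) := by
  have hQc : Tendsto (fun x => ((Q x : ℝ) : ℂ)) l (𝓝 (Q a : ℂ)) :=
    ((Complex.continuous_ofReal.comp hQ.continuous).tendsto a).mono_left hl
  have hQd : Tendsto (fun x => ((deriv Q x : ℝ) : ℂ)) l (𝓝 ((deriv Q a : ℝ) : ℂ)) :=
    ((Complex.continuous_ofReal.comp (hQ.continuous_deriv (by norm_num))).tendsto a).mono_left hl
  have hr := h.mul hQd
  rw [zero_mul] at hr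
  have hne : (Q a : ℂ) ≠ 0 := by exact_mod_cast ha
  constructor
  · intro hu
    have := (hu.mul hQc).sub hr
    simp only [zero_mul, sub_zero] at this
    exact this.congr fun x => by ring
  · intro hu
    have := (hu.add hr).mul (hQc.inv₀ hne)
    simp only [zero_mul, add_zero] at this
    refine this.congr' ?_
    filter_upwards [hQc.eventually_ne hne] with x hx
    field_simp
    ring

/-- The boundary conditions `[f,1](±1) = 0` and `[f,P_m](±1) = 0` cut out the same
subset of the Legendre maximal domain. -/
theorem legendre_boundary_condition_any_polynomial (m : ℕ) :
    {f : ℝ → ℂ | LegendreMaxDom f ∧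
        Tendsto (fun x : ℝ => ((1 - x ^ 2 : ℝ) : ℂ) * deriv f x) (𝓝[<] (1 : ℝ)) (𝓝 0) ∧
        Tendsto (fun x : ℝ => ((1 - x ^ 2 : ℝ) : ℂ) * deriv f x) (𝓝[>] (-1 : ℝ)) (𝓝 0)} =
    {f : ℝ → ℂ | LegendreMaxDom f ∧
        Tendsto (fun x : ℝ => ((1 - x ^ 2 : ℝ) : ℂ) *
            (deriv f x * ((legendreP m x : ℝ) : ℂ) - f x * ((deriv (legendreP m) x : ℝ) : ℂ)))
          (𝓝[<] (1 : ℝ)) (𝓝 0) ∧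
        Tendsto (fun x : ℝ => ((1 - x ^ 2 : ℝ) : ℂ) *
            (deriv f x * ((legendreP m x : ℝ) : ℂ) - f x * ((deriv (legendreP m) x : ℝ) : ℂ)))
          (𝓝[>] (-1 : ℝ)) (𝓝 0)} := by
  ext f
  simp only [mem_ofPred_eq]
  refine and_congr_right fun hf => ?_
  obtain ⟨C, hC⟩ := bounded_u f hf
  have hd : DifferentiableOn ℝ f (Ioo (-1 : ℝ) 1) := hf.1.differentiableOn (by norm_num)
  exact and_congr
    (tendsto_equiv f _ 1 nhdsWithin_le_nhds _ (legendreP_contDiff m)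
      (by rw [legendreP_one]; norm_num) (pf_tendsto f hd C hC))
    (tendsto_equiv f _ (-1) nhdsWithin_le_nhds _ (legendreP_contDiff m)
      (legendreP_neg_one m) (pf_tendsto_left f hd C hC))
end

section
/- Fix 0 ≤ α, β < 1 and let f : (-1,1) → ℂ belong to the Jacobi maximal domain D_max^{(α,β)}. Then lim_{x→1⁻} (1-x)^{α+1}(1+x)^{β+1}·f(x) = 0 and lim_{x→-1⁺} (1-x)^{α+1}(1+x)^{β+1}·f(x) = 0, and the one-sided limits lim_{x→1⁻} (1-x)^{α+1}(1+x)^{β+1}·f'(x) and lim_{x→-1⁺} (1-x)^{α+1}(1+x)^{β+1}·f'(x) both exist (i.e. are finite complex numbers). -/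
open MeasureTheory Set Filter Topology

/-- Membership in the weighted space `L²_{α,β}(-1,1)`. -/
def MemL2ab (α β : ℝ) (f : ℝ → ℂ) : Prop :=
  IntegrableOn (fun x : ℝ => ‖f x‖ ^ 2 * (1 - x) ^ α * (1 + x) ^ β) (Ioo (-1 : ℝ) 1)

/-- The Jacobi differential expression
`ℓ_{α,β}[f](x) = -(1-x)^{-α}(1+x)^{-β}·[(1-x)^{α+1}(1+x)^{β+1} f'(x)]'`. -/
noncomputable def jacobiL (α β : ℝ) (f : ℝ → ℂ) : ℝ → ℂ := fun x =>
  -((((1 - x) ^ (-α) * (1 + x) ^ (-β) : ℝ) : ℂ) *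
    deriv (fun y : ℝ => (((1 - y) ^ (α + 1) * (1 + y) ^ (β + 1) : ℝ) : ℂ) * deriv f y) x)

/-- The Jacobi maximal domain `D_max^{(α,β)}`. -/
def JacobiMaxDom1 (α β : ℝ) (f : ℝ → ℂ) : Prop :=
  ContDiffOn ℝ 2 f (Ioo (-1 : ℝ) 1) ∧ MemL2ab α β f ∧ MemL2ab α β (jacobiL α β f)

lemma jac_diff (f : ℝ → ℂ) (hf : ContDiffOn ℝ 2 f (Ioo (-1 : ℝ) 1)) (x : ℝ)
    (hx : x ∈ Ioo (-1 : ℝ) 1) : DifferentiableAt ℝ f x ∧ DifferentiableAt ℝ (deriv f) x := by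
  have hn : Ioo (-1 : ℝ) 1 ∈ 𝓝 x := isOpen_Ioo.mem_nhds hx
  constructor
  · exact (hf.differentiableOn (by norm_num)).differentiableAt hn
  · have h2 : ContDiffOn ℝ (1 + 1) f (Ioo (-1 : ℝ) 1) := by
      convert hf using 1
      norm_num
    have h3 := ((contDiffOn_succ_iff_deriv_of_isOpen isOpen_Ioo).1 h2).2.2
    exact (h3.differentiableOn (by norm_num)).differentiableAt hn

/-- the quasi-derivative is differentiable -/
lemma jac_qdiff (α β : ℝ) (f : ℝ → ℂ) (hf : ContDiffOn ℝ 2 f (Ioo (-1 : ℝ) 1)) (x : ℝ)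
    (hx : x ∈ Ioo (-1 : ℝ) 1) : DifferentiableAt ℝ
      (fun y : ℝ => (((1 - y) ^ (α + 1) * (1 + y) ^ (β + 1) : ℝ) : ℂ) * deriv f y) x := by
  have h1 : DifferentiableAt ℝ (fun y : ℝ => (1 - y) ^ (α + 1) * (1 + y) ^ (β + 1)) x := by
    apply DifferentiableAt.mul
    · exact DifferentiableAt.rpow_const (by fun_prop) (Or.inl (by linarith [hx.2]))
    · exact DifferentiableAt.rpow_const (by fun_prop) (Or.inl (by linarith [hx.1]))
  exact (h1.hasDerivAt.ofReal_comp.differentiableAt).mul (jac_diff f hf x hx).2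

lemma jac_integrable (α β : ℝ) (hα0 : 0 ≤ α) (hα1 : α < 1)
    (hβ0 : 0 ≤ β) (hβ1 : β < 1) (f : ℝ → ℂ) (hf : JacobiMaxDom1 α β f) :
    IntegrableOn (deriv (fun y : ℝ => (((1 - y) ^ (α + 1) * (1 + y) ^ (β + 1) : ℝ) : ℂ) *
      deriv f y)) (Ioo (-1 : ℝ) 1) := by
  have h1 := hf.2.2
  unfold MemL2ab at h1
  have h2 : IntegrableOn (fun _ : ℝ => (4 : ℝ)) (Ioo (-1 : ℝ) 1) := by
    apply integrableOn_const
    · simp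
    · simp
  refine Integrable.mono' (h1.add h2) (measurable_deriv _).aestronglyMeasurable ?_
  filter_upwards [ae_restrict_mem measurableSet_Ioo] with x hx
  have ha : 0 < 1 - x := by linarith [hx.2]
  have hb : 0 < 1 + x := by linarith [hx.1]
  simp only [Pi.add_apply, jacobiL]
  set D := deriv (fun y : ℝ => (((1 - y) ^ (α + 1) * (1 + y) ^ (β + 1) : ℝ) : ℂ) *
      deriv f y) x
  have hA := Real.rpow_pos_of_pos ha α
  have hB := Real.rpow_pos_of_pos hb β
  have key : ∀ t s : ℝ, 0 < t → t < 2 → 0 ≤ s → s < 1 → t ^ s ≤ 2 := by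
    intro t s ht ht2 hs hs1
    calc t ^ s ≤ 2 ^ s := Real.rpow_le_rpow ht.le ht2.le hs
      _ ≤ 2 ^ (1:ℝ) := Real.rpow_le_rpow_of_exponent_le (by norm_num) hs1.le
      _ = 2 := by simp
  have hA2 := key (1 - x) α ha (by linarith [hx.1]) hα0 hα1
  have hB2 := key (1 + x) β hb (by linarith [hx.2]) hβ0 hβ1
  rw [norm_neg, norm_mul, Complex.norm_real, Real.rpow_neg ha.le, Real.rpow_neg hb.le]
  set A := (1 - x) ^ α
  set B := (1 + x) ^ β
  rw [Real.norm_of_nonneg (by positivity)]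
  have hn := norm_nonneg D
  set N := ‖D‖
  have hAB : A * B ≤ 4 := by nlinarith
  have h3 : (A⁻¹ * B⁻¹ * N) ^ 2 * A * B = N ^ 2 / (A * B) := by
    field_simp
  rw [h3]
  have h4 : N ^ 2 / (A * B) ≥ N ^ 2 / 4 := by
    apply div_le_div_of_nonneg_left (by positivity) (by positivity) hAB
  nlinarith [sq_nonneg (N - 2)]

lemma jac_right (α β : ℝ) (hα0 : 0 ≤ α) (hα1 : α < 1)
    (hβ0 : 0 ≤ β) (hβ1 : β < 1) (f : ℝ → ℂ) (hf : JacobiMaxDom1 α β f) :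
    ∃ L : ℂ, Tendsto (fun x : ℝ => (((1 - x) ^ (α + 1) * (1 + x) ^ (β + 1) : ℝ) : ℂ) * deriv f x)
      (𝓝[<] (1 : ℝ)) (𝓝 L) := by
  have hint := jac_integrable α β hα0 hα1 hβ0 hβ1 f hf
  have hd := jac_qdiff α β f hf.1
  set g := fun y : ℝ => (((1 - y) ^ (α + 1) * (1 + y) ^ (β + 1) : ℝ) : ℂ) * deriv f y with hg
  have hI : IntegrableOn (deriv g) (Icc 0 1) := by
    rw [integrableOn_Icc_iff_integrableOn_Ico, integrableOn_Ico_iff_integrableOn_Ioo]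
    exact hint.mono_set (Ioo_subset_Ioo (by norm_num) le_rfl)
  have hc : ContinuousOn (fun x => ∫ t in (0:ℝ)..x, deriv g t) (Icc 0 1) := by
    have := intervalIntegral.continuousOn_primitive_interval (f := deriv g) (μ := volume)
      (a := 0) (b := 1) (by rwa [uIcc_of_le zero_le_one])
    rwa [uIcc_of_le zero_le_one] at this
  have h1 : Tendsto (fun x => ∫ t in (0:ℝ)..x, deriv g t) (𝓝[<] (1:ℝ))
      (𝓝 (∫ t in (0:ℝ)..1, deriv g t)) := by
    have h := (hc 1 (by simp)).tendsto
    rw [← nhdsWithin_Ioo_eq_nhdsLT (zero_lt_one (α := ℝ))]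
    exact h.mono_left (nhdsWithin_mono _ Ioo_subset_Icc_self)
  refine ⟨g 0 + ∫ t in (0:ℝ)..1, deriv g t, (h1.const_add (g 0)).congr' ?_⟩
  filter_upwards [Ioo_mem_nhdsLT (zero_lt_one (α := ℝ))] with x hx
  rw [intervalIntegral.integral_eq_sub_of_hasDerivAt]
  · ring
  · intro y hy
    rw [uIcc_of_le hx.1.le] at hy
    exact (hd y ⟨by linarith [hy.1], by linarith [hy.2, hx.2]⟩).hasDerivAt
  · rw [intervalIntegrable_iff_integrableOn_Icc_of_le hx.1.le]
    exact hI.mono_set (Icc_subset_Icc le_rfl hx.2.le)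

lemma jac_right_zero (α β : ℝ) (hα0 : 0 ≤ α) (hα1 : α < 1)
    (hβ0 : 0 ≤ β) (hβ1 : β < 1) (f : ℝ → ℂ) (hf : JacobiMaxDom1 α β f) :
    Tendsto (fun x : ℝ => (((1 - x) ^ (α + 1) * (1 + x) ^ (β + 1) : ℝ) : ℂ) * f x)
      (𝓝[<] (1 : ℝ)) (𝓝 0) := by
  obtain ⟨L, hL⟩ := jac_right α β hα0 hα1 hβ0 hβ1 f hf
  have hbd : ∀ᶠ x in 𝓝[<] (1:ℝ),
      ‖(((1 - x) ^ (α + 1) * (1 + x) ^ (β + 1) : ℝ) : ℂ) * deriv f x‖ < ‖L‖ + 1 :=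
    hL.norm.eventually_lt_const (by linarith)
  obtain ⟨a₀, ha₀, hsub⟩ := (mem_nhdsLT_iff_exists_Ioo_subset).1 hbd
  have ha₀' : a₀ < 1 := ha₀
  obtain ⟨a, ha, ha1⟩ := exists_between (max_lt ha₀' (zero_lt_one (α := ℝ)))
  have haa : a₀ < a := lt_of_le_of_lt (le_max_left _ _) ha
  have ha0 : 0 < a := lt_of_le_of_lt (le_max_right _ _) ha
  set M := ‖L‖ + 1 with hM
  have hMpos : 0 < M := by positivity
  have hder : ∀ x ∈ Ico a 1, ‖deriv f x‖ ≤ M * (1 - x) ^ (-(α + 1/2) - 1) := by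
    intro x hx
    have hxa : 0 < 1 - x := by linarith [hx.2]
    have hxb : 0 < 1 + x := by linarith [hx.1]
    have h := hsub (show x ∈ Ioo a₀ 1 from ⟨by linarith [hx.1], hx.2⟩)
    simp only [mem_ofPred_eq] at h
    have hA := Real.rpow_pos_of_pos hxa (α + 1)
    have hB : 1 ≤ (1 + x) ^ (β + 1) := Real.one_le_rpow (by linarith [hx.1]) (by linarith)
    rw [norm_mul, Complex.norm_real, Real.norm_of_nonneg (by positivity)] at h
    have h1 : (1 - x) ^ (α + 1) * ‖deriv f x‖ ≤ M := by
      refine le_trans ?_ h.le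
      apply mul_le_mul_of_nonneg_right _ (norm_nonneg _)
      exact le_mul_of_one_le_right hA.le hB
    have h2 : ‖deriv f x‖ ≤ M * (1 - x) ^ (-(α + 1)) := by
      rw [Real.rpow_neg hxa.le, ← div_eq_mul_inv, le_div_iff₀ hA]
      linarith
    refine h2.trans (mul_le_mul_of_nonneg_left ?_ hMpos.le)
    exact Real.rpow_le_rpow_of_exponent_ge hxa (by linarith [hx.1]) (by linarith)
  have hfb : ∀ x ∈ Ioo a 1, ‖f x‖ ≤ ‖f a‖ + M / (α + 1/2) * (1 - x) ^ (-(α + 1/2)) := by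
    intro x hx
    have hBd : ∀ y < (1:ℝ), HasDerivAt (fun y : ℝ => ‖f a‖ + M / (α + 1/2) * (1 - y) ^ (-(α + 1/2)))
        (M * (1 - y) ^ (-(α + 1/2) - 1)) y := by
      intro y hy
      have h1 : HasDerivAt (fun y : ℝ => 1 - y) (-1) y := by
        simpa using (hasDerivAt_id y).const_sub 1
      have h2 := ((h1.rpow_const (p := -(α + 1/2)) (Or.inl (by linarith))).const_mul
        (M / (α + 1/2))).const_add ‖f a‖
      refine h2.congr_deriv ?_
      have hne : α + 1/2 ≠ 0 := by positivity
      generalize (1 - y) ^ (-(α + 1/2) - 1) = r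
      generalize α + 1/2 = p at hne
      have hmp : M / p * p = M := div_mul_cancel₀ M hne
      linear_combination r * hmp
    refine image_norm_le_of_norm_deriv_right_le_deriv_boundary' (a := a) (b := x)
      (f := f) (f' := deriv f)
      (B := fun y : ℝ => ‖f a‖ + M / (α + 1/2) * (1 - y) ^ (-(α + 1/2)))
      (B' := fun y => M * (1 - y) ^ (-(α + 1/2) - 1))
      ?_ ?_ ?_ ?_ ?_ ?_ (right_mem_Icc.2 hx.1.le)
    · intro y hy
      exact (jac_diff f hf.1 y ⟨by linarith [hy.1], by linarith [hy.2, hx.2]⟩).1.continuousAt.continuousWithinAt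
    · intro y hy
      exact (jac_diff f hf.1 y ⟨by linarith [hy.1], by linarith [hy.2, hx.2]⟩).1.hasDerivAt.hasDerivWithinAt
    · have := Real.rpow_pos_of_pos (sub_pos.2 ha1) (-(α + 1/2))
      have h3 : 0 ≤ M / (α + 1/2) * (1 - a) ^ (-(α + 1/2)) := by positivity
      linarith
    · intro y hy
      exact (hBd y (by linarith [hy.2, hx.2])).continuousAt.continuousWithinAt
    · intro y hy
      exact (hBd y (by linarith [hy.2, hx.2])).hasDerivWithinAt
    · intro y hy
      exact hder y ⟨hy.1, by linarith [hy.2, hx.2]⟩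
  have hlim : Tendsto (fun x : ℝ => (1 + x) ^ (β + 1) * ((1 - x) ^ (α + 1) * ‖f a‖ +
      M / (α + 1/2) * (1 - x) ^ (1/2 : ℝ))) (𝓝[<] (1:ℝ)) (𝓝 0) := by
    have hcont : ContinuousAt (fun x : ℝ => (1 + x) ^ (β + 1) * ((1 - x) ^ (α + 1) * ‖f a‖ +
      M / (α + 1/2) * (1 - x) ^ (1/2 : ℝ))) 1 := by
      have c1 : ContinuousAt (fun x : ℝ => (1 + x) ^ (β + 1)) 1 :=
        ContinuousAt.rpow_const (by fun_prop) (Or.inr (by linarith))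
      have c2 : ContinuousAt (fun x : ℝ => (1 - x) ^ (α + 1)) 1 :=
        ContinuousAt.rpow_const (by fun_prop) (Or.inr (by linarith))
      have c3 : ContinuousAt (fun x : ℝ => (1 - x) ^ (1/2 : ℝ)) 1 :=
        ContinuousAt.rpow_const (by fun_prop) (Or.inr (by norm_num))
      exact c1.mul ((c2.mul continuousAt_const).add (continuousAt_const.mul c3))
    have h := hcont.tendsto.mono_left (nhdsWithin_le_nhds (s := Iio 1))
    have e : (1 - 1 : ℝ) ^ (α + 1) = 0 := by
      rw [sub_self, Real.zero_rpow (by linarith)]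
    have e2 : (1 - 1 : ℝ) ^ (1/2 : ℝ) = 0 := by
      rw [sub_self, Real.zero_rpow (by norm_num)]
    rw [e, e2] at h
    simpa using h
  refine squeeze_zero_norm' ?_ hlim
  filter_upwards [Ioo_mem_nhdsLT ha1] with x hx
  have hxa : 0 < 1 - x := by linarith [hx.2]
  have hxb : 0 < 1 + x := by linarith [hx.1]
  have hA := Real.rpow_pos_of_pos hxa (α + 1)
  have hB := Real.rpow_pos_of_pos hxb (β + 1)
  rw [norm_mul, Complex.norm_real, Real.norm_of_nonneg (by positivity)]
  have e : (1 - x) ^ (1/2 : ℝ) = (1 - x) ^ (α + 1) * (1 - x) ^ (-(α + 1/2)) := by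
    rw [← Real.rpow_add hxa]
    congr 1
    ring
  rw [e]
  calc _ ≤ (1 - x) ^ (α + 1) * (1 + x) ^ (β + 1) *
        (‖f a‖ + M / (α + 1/2) * (1 - x) ^ (-(α + 1/2))) :=
        mul_le_mul_of_nonneg_left (hfb x hx) (by positivity)
    _ = _ := by ring

/-- reflection symmetry of the memL2 condition -/
lemma jac_mem_neg (α β : ℝ) (f : ℝ → ℂ) (hf : MemL2ab α β f) :
    MemL2ab β α (fun x => f (-x)) := by
  unfold MemL2ab at *
  have h := (Measure.measurePreserving_neg (volume : Measure ℝ)).integrableOn_comp_preimage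
    (Homeomorph.neg ℝ).measurableEmbedding (f := fun x : ℝ => ‖f x‖ ^ 2 * (1 - x) ^ α * (1 + x) ^ β)
    (s := Ioo (-1 : ℝ) 1)
  have h2 := h.2 hf
  have hs : Neg.neg ⁻¹' Ioo (-1 : ℝ) 1 = Ioo (-1 : ℝ) 1 := by
    simp
  rw [hs] at h2
  refine h2.congr_fun ?_ measurableSet_Ioo
  intro x _
  simp only [Function.comp, sub_neg_eq_add, ← sub_eq_add_neg]
  ring

lemma jac_dom_neg (α β : ℝ) (f : ℝ → ℂ) (hf : JacobiMaxDom1 α β f) :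
    JacobiMaxDom1 β α (fun x => f (-x)) := by
  refine ⟨?_, jac_mem_neg α β f hf.2.1, ?_⟩
  · refine hf.1.comp contDiff_neg.contDiffOn ?_
    intro x hx
    exact ⟨by linarith [hx.2], by linarith [hx.1]⟩
  · have h := jac_mem_neg α β _ hf.2.2
    convert h using 1
    funext x
    simp only [jacobiL, sub_neg_eq_add, ← sub_eq_add_neg]
    have e : (fun y : ℝ => (((1 - y) ^ (β + 1) * (1 + y) ^ (α + 1) : ℝ) : ℂ) *
        deriv (fun x => f (-x)) y) = fun y => -((fun z : ℝ =>
          (((1 - z) ^ (α + 1) * (1 + z) ^ (β + 1) : ℝ) : ℂ) * deriv f z) (-y)) := by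
      funext y
      simp only [deriv_comp_neg, sub_neg_eq_add, ← sub_eq_add_neg]
      push_cast
      ring
    rw [e, deriv.fun_neg, deriv_comp_neg (fun z : ℝ =>
          (((1 - z) ^ (α + 1) * (1 + z) ^ (β + 1) : ℝ) : ℂ) * deriv f z) x, neg_neg,
      mul_comm ((1 - x) ^ (-β))]

theorem jacobi_maxdomain_endpoint_behavior (α β : ℝ) (hα0 : 0 ≤ α) (hα1 : α < 1)
    (hβ0 : 0 ≤ β) (hβ1 : β < 1) (f : ℝ → ℂ) (hf : JacobiMaxDom1 α β f) :
    Tendsto (fun x : ℝ => (((1 - x) ^ (α + 1) * (1 + x) ^ (β + 1) : ℝ) : ℂ) * f x)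
      (𝓝[<] (1 : ℝ)) (𝓝 0) ∧
    Tendsto (fun x : ℝ => (((1 - x) ^ (α + 1) * (1 + x) ^ (β + 1) : ℝ) : ℂ) * f x)
      (𝓝[>] (-1 : ℝ)) (𝓝 0) ∧
    (∃ L : ℂ, Tendsto (fun x : ℝ => (((1 - x) ^ (α + 1) * (1 + x) ^ (β + 1) : ℝ) : ℂ) * deriv f x)
      (𝓝[<] (1 : ℝ)) (𝓝 L)) ∧
    (∃ L : ℂ, Tendsto (fun x : ℝ => (((1 - x) ^ (α + 1) * (1 + x) ^ (β + 1) : ℝ) : ℂ) * deriv f x)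
      (𝓝[>] (-1 : ℝ)) (𝓝 L)) := by
  have hg := jac_dom_neg α β f hf
  have hneg : Tendsto (fun x : ℝ => -x) (𝓝[>] (-1 : ℝ)) (𝓝[<] (1 : ℝ)) := by
    have := tendsto_neg_nhdsGT (a := (-1 : ℝ))
    simpa using this
  refine ⟨jac_right_zero α β hα0 hα1 hβ0 hβ1 f hf, ?_, jac_right α β hα0 hα1 hβ0 hβ1 f hf, ?_⟩
  · have h := (jac_right_zero β α hβ0 hβ1 hα0 hα1 _ hg).comp hneg
    refine h.congr ?_
    intro x
    simp only [Function.comp, sub_neg_eq_add, ← sub_eq_add_neg, neg_neg]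
    push_cast
    ring
  · obtain ⟨L, hL⟩ := jac_right β α hβ0 hβ1 hα0 hα1 _ hg
    refine ⟨-L, ((hL.comp hneg).neg).congr ?_⟩
    intro x
    simp only [Function.comp, deriv_comp_neg, sub_neg_eq_add, ← sub_eq_add_neg, neg_neg]
    push_cast
    ring
end

section
/- Fix 0 ≤ α, β < 1, let j ≥ 1 be an integer, and let f : (-1,1) → ℂ belong to the Jacobi maximal domain D_max^{(α,β)}. Then lim_{x→1⁻} (1-x)^{α+1}(1+x)^{β+1}·( f'(x)(1-x)^j + j·f(x)(1-x)^{j-1} ) = 0 and lim_{x→-1⁺} (1-x)^{α+1}(1+x)^{β+1}·( f'(x)(1+x)^j − j·f(x)(1+x)^{j-1} ) = 0; that is, the sesquilinear form [f,(1-x)^j]_1 vanishes in the limit at 1 and [f,(1+x)^j]_1 vanishes in the limit at -1, so these power functions belong to the minimal domain of the Jacobi expression. -/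
open MeasureTheory Set Filter Topology

theorem jac_aux_limit (α β : ℝ) (hα0 : 0 ≤ α) (hβ0 : 0 ≤ β) (hβ1 : β < 1) (j : ℕ) (hj : 1 ≤ j)
    (f : ℝ → ℂ) (hf : DifferentiableOn ℝ f (Ioo (-1 : ℝ) 1)) (C : ℝ)
    (hC : ∀ x ∈ Ioo (-1 : ℝ) 1,
      ‖(((1 - x) ^ (α + 1) * (1 + x) ^ (β + 1) : ℝ) : ℂ) * deriv f x‖ ≤ C) :
    Tendsto (fun x : ℝ => (((1 - x) ^ (α + 1) * (1 + x) ^ (β + 1) : ℝ) : ℂ) *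
        (deriv f x * (((1 - x) ^ j : ℝ) : ℂ) + (j : ℂ) * f x * (((1 - x) ^ (j - 1) : ℝ) : ℂ)))
      (𝓝[<] (1 : ℝ)) (𝓝 0) := by
  have hC0 : 0 ≤ C := (norm_nonneg _).trans (hC 0 (by constructor <;> norm_num))
  have hda : ∀ x ∈ Ioo (-1 : ℝ) 1, HasDerivAt f (deriv f x) x := fun x hx =>
    (hf.differentiableAt (Ioo_mem_nhds hx.1 hx.2)).hasDerivAt
  set a : ℝ := α + 1 / 2 with ha
  have hapos : 0 < a := by positivity
  -- derivative bound
  have hder : ∀ x ∈ Ico (0 : ℝ) 1, ‖deriv f x‖ ≤ C * (1 - x) ^ (-a - 1) := by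
    intro x hx
    have hu : 0 < 1 - x := by linarith [hx.2]
    have hu1 : 1 - x ≤ 1 := by linarith [hx.1]
    have h1 := hC x ⟨by linarith [hx.1], hx.2⟩
    have h2 : 1 ≤ (1 + x) ^ (β + 1) := Real.one_le_rpow (by linarith [hx.1]) (by linarith)
    have hp : 0 < (1 - x) ^ (α + 1) := Real.rpow_pos_of_pos hu _
    rw [norm_mul, Complex.norm_real, Real.norm_of_nonneg (by positivity)] at h1
    have h3 : (1 - x) ^ (α + 1) * ‖deriv f x‖ ≤ C := by
      refine le_trans ?_ h1
      have := mul_nonneg hp.le (norm_nonneg (deriv f x))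
      nlinarith
    have h4 : (1 - x) ^ (-(α + 1)) ≤ (1 - x) ^ (-a - 1) :=
      Real.rpow_le_rpow_of_exponent_ge hu hu1 (by rw [ha]; linarith)
    refine le_trans ?_ (mul_le_mul_of_nonneg_left h4 hC0)
    rw [Real.rpow_neg hu.le, ← div_eq_mul_inv, le_div_iff₀ hp]
    linarith
  have hfb : ∀ x ∈ Ico (0 : ℝ) 1, ‖f x‖ ≤ ‖f 0‖ + C / a * (1 - x) ^ (-a) := by
    intro x hx
    have hsub : ∀ y ∈ Icc 0 x, y ∈ Ioo (-1 : ℝ) 1 := fun y hy =>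
      ⟨by linarith [hy.1], by linarith [hy.2, hx.2]⟩
    have hB : ∀ y ∈ Icc 0 x, HasDerivAt (fun y => ‖f 0‖ + C / a * (1 - y) ^ (-a))
        (C * (1 - y) ^ (-a - 1)) y := by
      intro y hy
      have hu : (1 - y) ≠ 0 := by linarith [(hsub y hy).2]
      have h := ((((hasDerivAt_id y).const_sub 1).rpow_const (p := -a)
        (Or.inl hu)).const_mul (C / a)).const_add ‖f 0‖
      have e : C / a * (-1 * -a * (1 - id y) ^ (-a - 1)) = C * (1 - y) ^ (-a - 1) := by
        simp only [id]
        field_simp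
      rw [e] at h
      exact h
    refine image_norm_le_of_norm_deriv_right_le_deriv_boundary'
      (f := f) (f' := deriv f) (a := 0) (b := x)
      (B := fun y => ‖f 0‖ + C / a * (1 - y) ^ (-a)) (B' := fun y => C * (1 - y) ^ (-a - 1))
      (fun y hy => (hda y (hsub y hy)).continuousAt.continuousWithinAt)
      (fun y hy => (hda y (hsub y ⟨hy.1, hy.2.le⟩)).hasDerivWithinAt) ?_
      (fun y hy => (hB y hy).continuousAt.continuousWithinAt)
      (fun y hy => (hB y ⟨hy.1, hy.2.le⟩).hasDerivWithinAt)
      (fun y hy => hder y ⟨hy.1, by linarith [hy.2, hx.2]⟩) ⟨hx.1, le_refl x⟩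
    simp only [sub_zero, Real.one_rpow, mul_one]
    have : 0 ≤ C / a := by positivity
    linarith
  have hlim : Tendsto (fun x : ℝ => C * (1 - x) +
      (j : ℝ) * (4 * (‖f 0‖ * (1 - x) ^ (α + 1) + C / a * (1 - x) ^ (1 / 2 : ℝ))))
      (𝓝[<] (1 : ℝ)) (𝓝 0) := by
    have hcont : Continuous (fun x : ℝ => C * (1 - x) +
      (j : ℝ) * (4 * (‖f 0‖ * (1 - x) ^ (α + 1) + C / a * (1 - x) ^ (1 / 2 : ℝ)))) := by
      have h1 : Continuous (fun x : ℝ => (1 - x) ^ (α + 1)) :=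
        (continuous_const.sub continuous_id).rpow_const (fun x => Or.inr (by linarith))
      have h2 : Continuous (fun x : ℝ => (1 - x) ^ (1 / 2 : ℝ)) :=
        (continuous_const.sub continuous_id).rpow_const (fun x => Or.inr (by norm_num))
      fun_prop
    have h := (hcont.tendsto 1).mono_left (nhdsWithin_le_nhds (s := Iio 1))
    have e : (0 : ℝ) ^ (α + 1) = 0 := Real.zero_rpow (by linarith)
    have e2 : (0 : ℝ) ^ (1 / 2 : ℝ) = 0 := Real.zero_rpow (by norm_num)
    simpa only [sub_self, e, e2, mul_zero, add_zero] using h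
  refine squeeze_zero_norm' ?_ hlim
  have hmem : Ioo (0 : ℝ) 1 ∈ 𝓝[<] (1 : ℝ) := Ioo_mem_nhdsLT (by norm_num)
  filter_upwards [hmem] with x hx
  have hu : 0 < 1 - x := by linarith [hx.2]
  have hu1 : 1 - x ≤ 1 := by linarith [hx.1]
  have hv : 0 < 1 + x := by linarith [hx.1]
  have hF := hC x ⟨by linarith [hx.1], hx.2⟩
  have hfx := hfb x ⟨hx.1.le, hx.2⟩
  have hp : 0 < (1 - x) ^ (α + 1) := Real.rpow_pos_of_pos hu _
  have hq : 0 < (1 + x) ^ (β + 1) := Real.rpow_pos_of_pos hv _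
  have hq4 : (1 + x) ^ (β + 1) ≤ 4 := by
    calc (1 + x) ^ (β + 1) ≤ (2 : ℝ) ^ (β + 1) :=
          Real.rpow_le_rpow hv.le (by linarith [hx.2]) (by linarith)
      _ ≤ (2 : ℝ) ^ (2 : ℝ) := Real.rpow_le_rpow_of_exponent_le (by norm_num) (by linarith)
      _ = 4 := by norm_num
  have hj1 : (1 - x) ^ j ≤ 1 - x := by
    simpa using pow_le_pow_of_le_one hu.le hu1 hj
  have hj2 : (1 - x) ^ (j - 1) ≤ 1 := pow_le_one₀ hu.le hu1
  have hhalf : (1 - x) ^ (α + 1) * (1 - x) ^ (-a) = (1 - x) ^ (1 / 2 : ℝ) := by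
    rw [← Real.rpow_add hu]; congr 1; rw [ha]; ring
  rw [mul_add]
  refine (norm_add_le _ _).trans (add_le_add ?_ ?_)
  · rw [← mul_assoc, norm_mul, Complex.norm_real, Real.norm_of_nonneg (by positivity)]
    exact mul_le_mul hF hj1 (by positivity) hC0
  · rw [norm_mul, norm_mul, norm_mul, Complex.norm_real, Complex.norm_real,
      Real.norm_of_nonneg (by positivity), Real.norm_of_nonneg (by positivity),
      Complex.norm_natCast]
    calc (1 - x) ^ (α + 1) * (1 + x) ^ (β + 1) * (j * ‖f x‖ * (1 - x) ^ (j - 1))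
        ≤ (1 - x) ^ (α + 1) * 4 * (j * (‖f 0‖ + C / a * (1 - x) ^ (-a)) * 1) := by gcongr
      _ = _ := by rw [← hhalf]; ring

theorem jac_aux_bound (α β : ℝ) (hα0 : 0 ≤ α) (hα1 : α < 1)
    (hβ0 : 0 ≤ β) (hβ1 : β < 1) (f : ℝ → ℂ) (hf : JacobiMaxDom1 α β f) :
    ∃ C : ℝ, ∀ x ∈ Ioo (-1 : ℝ) 1,
      ‖(((1 - x) ^ (α + 1) * (1 + x) ^ (β + 1) : ℝ) : ℂ) * deriv f x‖ ≤ C := by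
  obtain ⟨hc, -, hl⟩ := hf
  set F : ℝ → ℂ := fun y : ℝ =>
    (((1 - y) ^ (α + 1) * (1 + y) ^ (β + 1) : ℝ) : ℂ) * deriv f y with hFdef
  have hFc : ContDiffOn ℝ 1 F (Ioo (-1 : ℝ) 1) := by
    have h1 : ContDiffOn ℝ 1 (deriv f) (Ioo (-1 : ℝ) 1) :=
      ((contDiffOn_succ_iff_deriv_of_isOpen (n := 1) isOpen_Ioo).1 (by rw [one_add_one_eq_two]; exact hc)).2.2
    have h2 : ContDiffOn ℝ 1 (fun y : ℝ => (1 - y) ^ (α + 1) * (1 + y) ^ (β + 1))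
        (Ioo (-1 : ℝ) 1) := by
      refine ContDiffOn.mul ?_ ?_
      · exact ContDiffOn.rpow_const_of_ne (by fun_prop) (fun x hx => by linarith [hx.2])
      · exact ContDiffOn.rpow_const_of_ne (by fun_prop) (fun x hx => by linarith [hx.1])
    exact (Complex.ofRealCLM.contDiff.comp_contDiffOn h2).mul h1
  have hFd : ∀ x ∈ Ioo (-1 : ℝ) 1, HasDerivAt F (deriv F x) x := fun x hx =>
    ((hFc.differentiableOn (by norm_num)).differentiableAt
      (Ioo_mem_nhds hx.1 hx.2)).hasDerivAt
  have hF'c : ContinuousOn (deriv F) (Ioo (-1 : ℝ) 1) :=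
    hFc.continuousOn_deriv_of_isOpen isOpen_Ioo (le_refl _)
  set G : ℝ → ℝ := fun x =>
    4 + ‖jacobiL α β f x‖ ^ 2 * (1 - x) ^ α * (1 + x) ^ β with hG
  have hGi : IntegrableOn G (Ioo (-1 : ℝ) 1) := by
    refine Integrable.add ?_ hl
    exact integrableOn_const (by simp)
  have hle : ∀ x ∈ Ioo (-1 : ℝ) 1, ‖deriv F x‖ ≤ G x := by
    intro x hx
    have hu : 0 < 1 - x := by linarith [hx.2]
    have hv : 0 < 1 + x := by linarith [hx.1]
    have hp : 0 < (1 - x) ^ α := Real.rpow_pos_of_pos hu _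
    have hq : 0 < (1 + x) ^ β := Real.rpow_pos_of_pos hv _
    have b2 : ∀ (t s : ℝ), 0 < t → t ≤ 2 → 0 ≤ s → s < 1 → t ^ s ≤ 2 := by
      intro t s ht ht2 hs hs1
      calc t ^ s ≤ (2 : ℝ) ^ s := Real.rpow_le_rpow ht.le ht2 hs
        _ ≤ (2 : ℝ) ^ (1 : ℝ) := Real.rpow_le_rpow_of_exponent_le (by norm_num) hs1.le
        _ = 2 := by norm_num
    have hp2 := b2 (1 - x) α hu (by linarith [hx.1]) hα0 hα1
    have hq2 := b2 (1 + x) β hv (by linarith [hx.2]) hβ0 hβ1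
    have hn : ‖jacobiL α β f x‖ = ((1 - x) ^ α)⁻¹ * ((1 + x) ^ β)⁻¹ * ‖deriv F x‖ := by
      unfold jacobiL
      rw [norm_neg, norm_mul, Complex.norm_real, Real.norm_of_nonneg (by positivity),
        Real.rpow_neg hu.le, Real.rpow_neg hv.le]
    have hn2 : ‖deriv F x‖ = (1 - x) ^ α * (1 + x) ^ β * ‖jacobiL α β f x‖ := by
      rw [hn]; field_simp
    rw [hn2, hG]
    set N := ‖jacobiL α β f x‖
    have hw : (1 - x) ^ α * (1 + x) ^ β ≤ 4 := by nlinarith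
    have hw0 : 0 < (1 - x) ^ α * (1 + x) ^ β := by positivity
    have : N ≤ 1 + N ^ 2 := by nlinarith [sq_nonneg (N - 1)]
    have := mul_le_mul_of_nonneg_left this hw0.le
    simp only
    nlinarith
  refine ⟨‖F 0‖ + ∫ x in Ioo (-1 : ℝ) 1, G x, fun x hx => ?_⟩
  have hsub : uIcc 0 x ⊆ Ioo (-1 : ℝ) 1 :=
    (ordConnected_Ioo).uIcc_subset (by constructor <;> norm_num) hx
  have hint := intervalIntegral.integral_eq_sub_of_hasDerivAt
    (fun y hy => hFd y (hsub hy)) ((hF'c.mono hsub).intervalIntegrable)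
  have hb : ‖∫ y in (0 : ℝ)..x, deriv F y‖ ≤ ∫ x in Ioo (-1 : ℝ) 1, G x := by
    refine intervalIntegral.norm_integral_le_integral_norm_uIoc.trans ?_
    have hs2 : uIoc 0 x ⊆ Ioo (-1 : ℝ) 1 := uIoc_subset_uIcc.trans hsub
    refine (setIntegral_mono_on ?_ (hGi.mono_set hs2) measurableSet_uIoc
      (fun y hy => hle y (hs2 hy))).trans ?_
    · exact (((hF'c.mono hsub).norm).integrableOn_compact isCompact_uIcc).mono_set
        uIoc_subset_uIcc
    · refine setIntegral_mono_set hGi ?_ hs2.eventuallyLE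
      filter_upwards [ae_restrict_mem measurableSet_Ioo] with y hy
      exact (norm_nonneg _).trans (hle y hy)
  rw [hint] at hb
  have : F x = F 0 + (F x - F 0) := by ring
  change ‖F x‖ ≤ _
  rw [this]
  exact (norm_add_le _ _).trans (by linarith)

/-- For `j ≥ 1` and `f` in the Jacobi maximal domain, the sesquilinear form
`[f,(1-x)^j]_1 = (1-x)^{α+1}(1+x)^{β+1}(f'(x)(1-x)^j + j f(x)(1-x)^{j-1})` vanishes in the
limit at `1`, and `[f,(1+x)^j]_1` vanishes in the limit at `-1`; i.e. these power
functions lie in the minimal domain of the Jacobi expression. -/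
theorem jacobi_powers_in_minimal_domain (α β : ℝ) (hα0 : 0 ≤ α) (hα1 : α < 1)
    (hβ0 : 0 ≤ β) (hβ1 : β < 1) (j : ℕ) (hj : 1 ≤ j)
    (f : ℝ → ℂ) (hf : JacobiMaxDom1 α β f) :
    Tendsto (fun x : ℝ => (((1 - x) ^ (α + 1) * (1 + x) ^ (β + 1) : ℝ) : ℂ) *
        (deriv f x * (((1 - x) ^ j : ℝ) : ℂ) + (j : ℂ) * f x * (((1 - x) ^ (j - 1) : ℝ) : ℂ)))
      (𝓝[<] (1 : ℝ)) (𝓝 0) ∧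
    Tendsto (fun x : ℝ => (((1 - x) ^ (α + 1) * (1 + x) ^ (β + 1) : ℝ) : ℂ) *
        (deriv f x * (((1 + x) ^ j : ℝ) : ℂ) - (j : ℂ) * f x * (((1 + x) ^ (j - 1) : ℝ) : ℂ)))
      (𝓝[>] (-1 : ℝ)) (𝓝 0) := by
  obtain ⟨C, hC⟩ := jac_aux_bound α β hα0 hα1 hβ0 hβ1 f hf
  have hd : DifferentiableOn ℝ f (Ioo (-1 : ℝ) 1) := hf.1.differentiableOn (by norm_num)
  refine ⟨jac_aux_limit α β hα0 hβ0 hβ1 j hj f hd C hC, ?_⟩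
  have hg : DifferentiableOn ℝ (fun x => f (-x)) (Ioo (-1 : ℝ) 1) :=
    hd.comp (by fun_prop) (fun x hx => ⟨by linarith [hx.2], by linarith [hx.1]⟩)
  have h := jac_aux_limit β α hβ0 hα0 hα1 j hj (fun x => f (-x)) hg C (by
    intro x hx
    have h := hC (-x) ⟨by linarith [hx.2], by linarith [hx.1]⟩
    rw [deriv_comp_neg, mul_neg, norm_neg]
    rw [sub_neg_eq_add, ← sub_eq_add_neg] at h
    rwa [mul_comm ((1 - x) ^ (β + 1))])
  have hneg : Tendsto (fun x : ℝ => -x) (𝓝[>] (-1 : ℝ)) (𝓝[<] (1 : ℝ)) := by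
    simpa using tendsto_neg_nhdsGT (a := (-1 : ℝ))
  have h2 := (h.comp hneg).neg
  rw [neg_zero] at h2
  refine h2.congr (fun x => ?_)
  simp only [Function.comp, deriv_comp_neg, neg_neg, sub_neg_eq_add, ← sub_eq_add_neg]
  rw [mul_comm ((1 + x) ^ (β + 1))]
  ring
end

section
/- Fix 0 ≤ α, β < 1 and m ∈ ℕ₀, and let P_m^{(α,β)} denote the m-th Jacobi polynomial. Then the following two subsets of the Jacobi maximal domain coincide: { f ∈ D_max^{(α,β)} : lim_{x→1⁻}(1-x)^{α+1}(1+x)^{β+1}f'(x) = 0 and lim_{x→-1⁺}(1-x)^{α+1}(1+x)^{β+1}f'(x) = 0 } and { f ∈ D_max^{(α,β)} : lim_{x→1⁻}[f,P_m^{(α,β)}]_1(x) = 0 and lim_{x→-1⁺}[f,P_m^{(α,β)}]_1(x) = 0 }. In other words, the boundary conditions [f,1]_1(±1)=0 and [f,P_m^{(α,β)}]_1(±1)=0 determine the same self-adjoint domain. -/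
open MeasureTheory Set Filter Topology

/-- The rising Pochhammer symbol `(a)_r = a(a+1)⋯(a+r-1)`. -/
noncomputable def poch (a : ℝ) (r : ℕ) : ℝ := ∏ i ∈ Finset.range r, (a + i)

/-- The `m`-th Jacobi polynomial
`P_m^{(α,β)}(x) = Σ_{j=0}^{m} (-1/2)^j ((m+α+β+1)_j (α+j+1)_{m-j}) / (j!(m-j)!) (1-x)^j`. -/
noncomputable def jacobiP (α β : ℝ) (m : ℕ) (x : ℝ) : ℝ :=
  ∑ j ∈ Finset.range (m + 1),
    (-(1 : ℝ) / 2) ^ j *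
      (poch ((m : ℝ) + α + β + 1) j * poch (α + (j : ℝ) + 1) (m - j)) /
      ((j.factorial : ℝ) * ((m - j).factorial : ℝ)) * (1 - x) ^ j


lemma poch_succ (a : ℝ) (n : ℕ) : poch a (n+1) = poch a n * (a + n) := by
  simp [poch, Finset.prod_range_succ]

lemma poch_succ' (a : ℝ) (n : ℕ) : poch a (n+1) = a * poch (a+1) n := by
  simp only [poch, Finset.prod_range_succ', Nat.cast_zero, add_zero]
  rw [mul_comm]
  congr 1
  refine Finset.prod_congr rfl fun i _ => ?_
  push_cast; ring

lemma poch_pos {a : ℝ} (ha : 0 < a) (n : ℕ) : 0 < poch a n :=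
  Finset.prod_pos fun i _ => by positivity

lemma chu_vandermonde (m : ℕ) : ∀ a c : ℝ,
    ∑ j ∈ Finset.range (m + 1), (m.choose j : ℝ) * ((-1) ^ j * poch a j * poch (c + j) (m - j))
      = poch (c - a) m := by
  induction m with
  | zero => intro a c; simp [poch]
  | succ m ih =>
    intro a c
    rw [Finset.sum_range_succ']
    have h1 : ∑ j ∈ Finset.range (m + 1), (m.choose j : ℝ) *
        ((-1) ^ (j+1) * poch a (j+1) * poch (c + (j+1 : ℕ)) (m - j)) = -a * poch (c - a) m := by
      have := ih (a+1) (c+1)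
      rw [show c + 1 - (a+1) = c - a by ring] at this
      rw [← this, Finset.mul_sum]
      refine Finset.sum_congr rfl fun j _ => ?_
      rw [poch_succ', show c + ((j+1 : ℕ) : ℝ) = c + 1 + j by push_cast; ring]
      ring
    have h2 : ∑ j ∈ Finset.range (m + 1), (m.choose (j+1) : ℝ) *
        ((-1) ^ (j+1) * poch a (j+1) * poch (c + (j+1 : ℕ)) (m - j)) + poch c (m+1)
          = (c + m) * poch (c - a) m := by
      rw [← ih a c, Finset.mul_sum, Finset.sum_range_succ, Finset.sum_range_succ']
      simp only [Nat.choose_succ_self, Nat.cast_zero, zero_mul, add_zero]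
      congr 1
      · refine Finset.sum_congr rfl fun j hj => ?_
        have hj' : j < m := Finset.mem_range.mp hj
        rw [show m - j = (m - (j+1)) + 1 by omega, poch_succ (c + ((j+1 : ℕ):ℝ)), Nat.cast_sub (by omega)]
        push_cast; ring
      · rw [poch_succ]; simp [poch]; ring
    have h3 : ∀ j, ((m+1).choose (j+1) : ℝ) *
        ((-1) ^ (j+1) * poch a (j+1) * poch (c + (j+1 : ℕ)) (m + 1 - (j+1))) =
        (m.choose j : ℝ) *
        ((-1) ^ (j+1) * poch a (j+1) * poch (c + (j+1 : ℕ)) (m - j)) + (m.choose (j+1) : ℝ) *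
        ((-1) ^ (j+1) * poch a (j+1) * poch (c + (j+1 : ℕ)) (m - j)) := by
      intro j
      rw [Nat.choose_succ_succ, Nat.add_sub_add_right]; push_cast; ring
    simp only [h3, Finset.sum_add_distrib, h1]
    have h4 : ((m+1).choose 0 : ℝ) * ((-1) ^ 0 * poch a 0 * poch (c + (0:ℕ)) (m + 1 - 0))
        = poch c (m+1) := by simp [poch]
    rw [h4, add_assoc, h2, poch_succ]; ring

lemma poch_reflect (b : ℝ) (m : ℕ) : poch (-b - m) m = (-1) ^ m * poch (b + 1) m := by
  induction m generalizing b with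
  | zero => simp [poch]
  | succ m ih =>
    rw [poch_succ, poch_succ', show -b - ((m+1 : ℕ):ℝ) = -(b+1) - m by push_cast; ring, ih]
    ring

lemma jacobiP_one (α β : ℝ) (m : ℕ) (hα : 0 ≤ α) : jacobiP α β m 1 ≠ 0 := by
  unfold jacobiP
  rw [Finset.sum_range_succ']
  have := poch_pos (show 0 < α + 1 by linarith) m
  have h2 : (0:ℝ) < m.factorial := by positivity
  simp [poch]
  simp only [poch] at this
  exact ⟨this.ne', by positivity⟩

lemma jacobiP_neg_one (α β : ℝ) (m : ℕ) (hβ : 0 ≤ β) : jacobiP α β m (-1) ≠ 0 := by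
  have h : jacobiP α β m (-1) * m.factorial = (-1) ^ m * poch (β + 1) m := by
    rw [← poch_reflect, show -β - (m:ℝ) = (α + 1) - (m + α + β + 1) by ring, ← chu_vandermonde]
    unfold jacobiP
    rw [Finset.sum_mul]
    refine Finset.sum_congr rfl fun j hj => ?_
    have hj' : j ≤ m := Nat.lt_succ_iff.mp (Finset.mem_range.mp hj)
    rw [Nat.cast_choose ℝ hj', show α + (j:ℝ) + 1 = α + 1 + j by ring]
    have : ((-1:ℝ)/2) ^ j * (1 - -1) ^ j = (-1) ^ j := by rw [← mul_pow]; norm_num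
    rw [← this]
    ring
  intro h0
  rw [h0, zero_mul] at h
  have := poch_pos (show 0 < β + 1 by linarith) m
  have h3 : (-1:ℝ) ^ m ≠ 0 := by positivity
  exact mul_ne_zero h3 this.ne' h.symm

lemma jacobiP_contDiff (α β : ℝ) (m : ℕ) : ContDiff ℝ 2 (jacobiP α β m) := by
  unfold jacobiP
  fun_prop

lemma bc_iff {l : Filter ℝ} {c : ℝ} (hl : l ≤ 𝓝 c) {p : ℝ → ℂ} {f g : ℝ → ℂ} {P : ℝ → ℝ}
    (hP : ContDiff ℝ 2 P) (hPc : P c ≠ 0) (hpf : Tendsto (fun x => p x * f x) l (𝓝 0)) :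
    Tendsto (fun x => p x * g x) l (𝓝 0) ↔
    Tendsto (fun x => p x * (g x * ((P x : ℝ) : ℂ) - f x * ((deriv P x : ℝ) : ℂ))) l (𝓝 0) := by
  have hPt : Tendsto (fun x => ((P x : ℝ) : ℂ)) l (𝓝 (P c : ℂ)) :=
    ((Complex.continuous_ofReal.comp hP.continuous).tendsto c).mono_left hl
  have hdt : Tendsto (fun x => ((deriv P x : ℝ) : ℂ)) l (𝓝 ((deriv P c : ℝ) : ℂ)) :=
    ((Complex.continuous_ofReal.comp (hP.continuous_deriv (by norm_num))).tendsto c).mono_left hl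
  have hne : (P c : ℂ) ≠ 0 := by exact_mod_cast hPc
  have h0 : Tendsto (fun x => p x * f x * ((deriv P x : ℝ) : ℂ)) l (𝓝 0) := by
    simpa using hpf.mul hdt
  constructor
  · intro h
    have := (h.mul hPt).sub h0
    simp only [zero_mul, sub_zero] at this
    refine this.congr fun x => by ring
  · intro h
    have := (h.add h0).mul (hPt.inv₀ hne)
    simp only [zero_mul, add_zero] at this
    refine this.congr' ?_
    filter_upwards [hPt.eventually_ne hne] with x hx
    field_simp
    ring

noncomputable def jp (α β : ℝ) (x : ℝ) : ℝ := (1 - x) ^ (α + 1) * (1 + x) ^ (β + 1)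
noncomputable def ju (α β : ℝ) (f : ℝ → ℂ) (x : ℝ) : ℂ := (jp α β x : ℂ) * deriv f x

lemma ju_contDiffOn {α β : ℝ} {f : ℝ → ℂ} (hf : ContDiffOn ℝ 2 f (Ioo (-1 : ℝ) 1)) :
    ContDiffOn ℝ 1 (ju α β f) (Ioo (-1 : ℝ) 1) := by
  have h1 : ContDiffOn ℝ 1 (deriv f) (Ioo (-1 : ℝ) 1) :=
    hf.deriv_of_isOpen isOpen_Ioo (by norm_num)
  have h2 : ContDiffOn ℝ 1 (jp α β) (Ioo (-1 : ℝ) 1) := by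
    unfold jp
    refine ContDiffOn.mul ?_ ?_
    · exact ContDiffOn.rpow_const_of_ne (by fun_prop) fun x hx => by linarith [hx.2]
    · exact ContDiffOn.rpow_const_of_ne (by fun_prop) fun x hx => by linarith [hx.1]
  exact (Complex.ofRealCLM.contDiff.comp_contDiffOn h2).mul h1

lemma rpow_le_two {x a : ℝ} (hx : 0 ≤ x) (hx2 : x ≤ 2) (ha0 : 0 ≤ a) (ha : a ≤ 1) :
    x ^ a ≤ 2 := by
  calc x ^ a ≤ 2 ^ a := Real.rpow_le_rpow hx hx2 ha0
    _ ≤ 2 ^ (1:ℝ) := Real.rpow_le_rpow_of_exponent_le (by norm_num) ha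
    _ = 2 := by simp

lemma deriv_ju_bound {α β : ℝ} (hα0 : 0 ≤ α) (hα1 : α < 1)
    (hβ0 : 0 ≤ β) (hβ1 : β < 1) {f : ℝ → ℂ} {x : ℝ} (hx : x ∈ Ioo (-1 : ℝ) 1) :
    ‖deriv (ju α β f) x‖ ≤ ‖jacobiL α β f x‖ ^ 2 * (1 - x) ^ α * (1 + x) ^ β + 4 := by
  have h1 : 0 < 1 - x := by linarith [hx.2]
  have h2 : 0 < 1 + x := by linarith [hx.1]
  have ha := Real.rpow_pos_of_pos h1 α
  have hb := Real.rpow_pos_of_pos h2 β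
  set A := (1 - x) ^ α
  set B := (1 + x) ^ β
  have hA2 : A ≤ 2 := rpow_le_two h1.le (by linarith [hx.1]) hα0 hα1.le
  have hB2 : B ≤ 2 := rpow_le_two h2.le (by linarith [hx.2]) hβ0 hβ1.le
  have e : ‖jacobiL α β f x‖ = A⁻¹ * B⁻¹ * ‖deriv (ju α β f) x‖ := by
    have : jacobiL α β f x = -((((1 - x) ^ (-α) * (1 + x) ^ (-β) : ℝ) : ℂ) *
      deriv (ju α β f) x) := rfl
    rw [this, norm_neg, norm_mul, Complex.norm_real, Real.rpow_neg h1.le, Real.rpow_neg h2.le,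
      Real.norm_of_nonneg (by positivity)]
  have e2 : ‖deriv (ju α β f) x‖ = A * B * ‖jacobiL α β f x‖ := by
    rw [e]; field_simp
  rw [e2]
  set L := ‖jacobiL α β f x‖
  have hW : A * B ≤ 4 := by nlinarith
  have hW0 : 0 < A * B := by positivity
  nlinarith [mul_nonneg hW0.le (sq_nonneg (L - 1)), mul_nonneg hW0.le (sq_nonneg (L))]

lemma ju_bound {α β : ℝ} (hα0 : 0 ≤ α) (hα1 : α < 1)
    (hβ0 : 0 ≤ β) (hβ1 : β < 1) {f : ℝ → ℂ} (hf : JacobiMaxDom1 α β f) :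
    ∃ M : ℝ, 0 ≤ M ∧ ∀ x ∈ Ico (0:ℝ) 1, ‖ju α β f x‖ ≤ M := by
  obtain ⟨hf, -, hL⟩ := hf
  have hu := ju_contDiffOn (α := α) (β := β) hf
  have hd : ContinuousOn (deriv (ju α β f)) (Ioo (-1 : ℝ) 1) :=
    hu.continuousOn_deriv_of_isOpen isOpen_Ioo le_rfl
  set G : ℝ → ℝ := fun x => ‖jacobiL α β f x‖ ^ 2 * (1 - x) ^ α * (1 + x) ^ β + 4 with hG
  have hGi : IntegrableOn G (Ioo (-1 : ℝ) 1) := by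
    refine Integrable.add hL ?_
    exact integrableOn_const (by simp)
  have hG0 : ∀ x ∈ Ioo (-1 : ℝ) 1, 0 ≤ G x := fun x hx =>
    (norm_nonneg _).trans (deriv_ju_bound hα0 hα1 hβ0 hβ1 (f := f) hx)
  refine ⟨‖ju α β f 0‖ + ∫ x in Ioo (-1 : ℝ) 1, G x, ?_, ?_⟩
  · have := setIntegral_nonneg (μ := volume) measurableSet_Ioo hG0
    positivity
  intro x hx
  have hsub : Icc 0 x ⊆ Ioo (-1 : ℝ) 1 := fun y hy => ⟨by linarith [hy.1], by linarith [hy.2, hx.2]⟩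
  have hsub' : Ioc 0 x ⊆ Ioo (-1 : ℝ) 1 := Ioc_subset_Icc_self.trans hsub
  have hint : IntervalIntegrable (deriv (ju α β f)) volume 0 x := by
    apply ContinuousOn.intervalIntegrable
    rw [uIcc_of_le hx.1]
    exact hd.mono hsub
  have hftc : ∫ y in (0:ℝ)..x, deriv (ju α β f) y = ju α β f x - ju α β f 0 := by
    apply intervalIntegral.integral_eq_sub_of_hasDerivAt _ hint
    intro y hy
    rw [uIcc_of_le hx.1] at hy
    exact ((hu.differentiableOn (by norm_num)).differentiableAt
      (isOpen_Ioo.mem_nhds (hsub hy))).hasDerivAt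
  have h1 : ‖ju α β f x - ju α β f 0‖ ≤ ∫ y in Ioo (-1 : ℝ) 1, G y := by
    rw [← hftc, intervalIntegral.integral_of_le hx.1]
    calc ‖∫ y in Ioc 0 x, deriv (ju α β f) y‖ ≤ ∫ y in Ioc 0 x, G y := by
          apply norm_integral_le_of_norm_le (hGi.mono_set hsub')
          filter_upwards [ae_restrict_mem measurableSet_Ioc] with y hy
          exact deriv_ju_bound hα0 hα1 hβ0 hβ1 (hsub' hy)
      _ ≤ _ := by
          apply setIntegral_mono_set hGi
          · filter_upwards [ae_restrict_mem measurableSet_Ioo] with y hy using hG0 y hy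
          · exact hsub'.eventuallyLE
  calc ‖ju α β f x‖ = ‖ju α β f 0 + (ju α β f x - ju α β f 0)‖ := by congr 1; ring
    _ ≤ _ := (norm_add_le _ _).trans (by gcongr)

lemma f_bound {α β : ℝ} (hα0 : 0 ≤ α) (hα1 : α < 1)
    (hβ0 : 0 ≤ β) (hβ1 : β < 1) {f : ℝ → ℂ} (hf : JacobiMaxDom1 α β f) :
    ∃ M : ℝ, 0 ≤ M ∧ ∀ x ∈ Ico (0:ℝ) 1, ‖f x‖ ≤ M * (1 - x) ^ (-(α + 1/2)) := by
  obtain ⟨M, hM0, hM⟩ := ju_bound hα0 hα1 hβ0 hβ1 hf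
  set γ := α + 1/2 with hγ
  have hγ0 : 0 < γ := by positivity
  refine ⟨‖f 0‖ + M / γ, by positivity, ?_⟩
  intro x hx
  have hsub : Icc 0 x ⊆ Ioo (-1 : ℝ) 1 := fun y hy => ⟨by linarith [hy.1], by linarith [hy.2, hx.2]⟩
  have hB : ∀ y ∈ Icc 0 x, HasDerivAt (fun y : ℝ => (‖f 0‖ + M / γ) * (1 - y) ^ (-γ))
      ((‖f 0‖ + M / γ) * (γ * (1 - y) ^ (-γ - 1))) y := by
    intro y hy
    have h1 : 1 - y ≠ 0 := by linarith [(hsub hy).2]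
    have := (((hasDerivAt_id y).const_sub 1).rpow_const (p := -γ) (Or.inl h1)).const_mul
      (‖f 0‖ + M / γ)
    refine this.congr_deriv ?_
    simp only [id]
    ring
  refine image_norm_le_of_norm_deriv_right_le_deriv_boundary' (f' := deriv f)
    (hf.1.continuousOn.mono hsub) ?_ ?_ (fun y hy => (hB y hy).continuousAt.continuousWithinAt)
    (fun y hy => (hB y (Ico_subset_Icc_self hy)).hasDerivWithinAt) ?_ (right_mem_Icc.mpr hx.1)
  · intro y hy
    exact ((hf.1.differentiableOn (by norm_num)).differentiableAt
      (isOpen_Ioo.mem_nhds (hsub (Ico_subset_Icc_self hy)))).hasDerivAt.hasDerivWithinAt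
  · simp; positivity
  · intro y hy
    have hy1 : 0 < 1 - y := by linarith [hy.2, hx.2]
    have hy2 : 1 ≤ 1 + y := by linarith [hy.1]
    have h := hM y ⟨hy.1, by linarith⟩
    have hp : (1 - y) ^ (γ + 1) ≤ jp α β y := by
      unfold jp
      have e1 : (1 - y) ^ (γ + 1) ≤ (1 - y) ^ (α + 1) :=
        Real.rpow_le_rpow_of_exponent_ge hy1 (by linarith [hy.1]) (by linarith)
      have e2 : 1 ≤ (1 + y) ^ (β + 1) := Real.one_le_rpow hy2 (by linarith)
      have e3 := Real.rpow_pos_of_pos hy1 (α + 1)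
      nlinarith
    have hq := Real.rpow_pos_of_pos hy1 (γ + 1)
    rw [ju, norm_mul, Complex.norm_real, Real.norm_of_nonneg (hq.le.trans hp)] at h
    have h2 : (1 - y) ^ (γ + 1) * ‖deriv f y‖ ≤ M :=
      (mul_le_mul_of_nonneg_right hp (norm_nonneg _)).trans h
    rw [show -γ - 1 = -(γ + 1) by ring, Real.rpow_neg hy1.le]
    calc ‖deriv f y‖ ≤ M * ((1 - y) ^ (γ + 1))⁻¹ := by
          rw [← div_eq_mul_inv, le_div_iff₀ hq, mul_comm]; exact h2
      _ = M / γ * (γ * ((1 - y) ^ (γ + 1))⁻¹) := by field_simp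
      _ ≤ _ := by
        gcongr
        linarith [norm_nonneg (f 0)]

lemma pf_right {α β : ℝ} (hα0 : 0 ≤ α) (hα1 : α < 1)
    (hβ0 : 0 ≤ β) (hβ1 : β < 1) {f : ℝ → ℂ} (hf : JacobiMaxDom1 α β f) :
    Tendsto (fun x : ℝ => (((1 - x) ^ (α + 1) * (1 + x) ^ (β + 1) : ℝ) : ℂ) * f x)
          (𝓝[<] (1 : ℝ)) (𝓝 0) := by
  obtain ⟨M, hM0, hM⟩ := f_bound hα0 hα1 hβ0 hβ1 hf
  have hlim : Tendsto (fun x : ℝ => M * (1 + x) ^ (β + 1) * (1 - x) ^ ((1:ℝ)/2))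
      (𝓝[<] (1 : ℝ)) (𝓝 0) := by
    have : Continuous (fun x : ℝ => M * (1 + x) ^ (β + 1) * (1 - x) ^ ((1:ℝ)/2)) := by
      refine (continuous_const.mul ?_).mul ?_
      · exact (continuous_const.add continuous_id).rpow_const fun x => Or.inr (by linarith)
      · exact (continuous_const.sub continuous_id).rpow_const fun x => Or.inr (by norm_num)
    have h := (this.tendsto 1).mono_left (nhdsWithin_le_nhds (s := Iio 1))
    simpa using h
  refine squeeze_zero_norm' ?_ hlim
  filter_upwards [Ioo_mem_nhdsLT (show (0:ℝ) < 1 by norm_num)] with x hx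
  have h1 : 0 < 1 - x := by linarith [hx.2]
  have h2 : 0 < 1 + x := by linarith [hx.1]
  have h := hM x ⟨hx.1.le, hx.2⟩
  rw [norm_mul, Complex.norm_real, Real.norm_of_nonneg (by positivity)]
  calc _ ≤ (1 - x) ^ (α + 1) * (1 + x) ^ (β + 1) * (M * (1 - x) ^ (-(α + 1/2))) := by gcongr
    _ = M * (1 + x) ^ (β + 1) * ((1 - x) ^ (α + 1) * (1 - x) ^ (-(α + 1/2))) := by ring
    _ = _ := by
      rw [← Real.rpow_add h1]
      congr 2
      ring

lemma maxDom_reflect {α β : ℝ} {f : ℝ → ℂ} (hf : JacobiMaxDom1 α β f) :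
    JacobiMaxDom1 β α (fun x => f (-x)) := by
  have hmaps : MapsTo (fun x : ℝ => -x) (Ioo (-1) 1) (Ioo (-1) 1) :=
    fun x hx => ⟨by linarith [hx.2], by linarith [hx.1]⟩
  have hmem : ∀ g : ℝ → ℂ, MemL2ab α β g → MemL2ab β α (fun x => g (-x)) := by
    intro g hg
    unfold MemL2ab at *
    have h := (Measure.measurePreserving_neg (volume : Measure ℝ)).integrableOn_comp_preimage
      (MeasurableEquiv.neg ℝ).measurableEmbedding
      (f := fun x : ℝ => ‖g x‖ ^ 2 * (1 - x) ^ α * (1 + x) ^ β) (s := Ioo (-1) 1)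
    have h' := h.mpr hg
    have hs : (Neg.neg ⁻¹' Ioo (-1:ℝ) 1) = Ioo (-1) 1 := by simp
    rw [hs] at h'
    refine h'.congr_fun (fun x _ => ?_) measurableSet_Ioo
    simp only [Function.comp]
    rw [show 1 - -x = 1 + x by ring, show 1 + -x = 1 - x by ring]
    ring
  have hL : jacobiL β α (fun x => f (-x)) = fun x => jacobiL α β f (-x) := by
    funext x
    unfold jacobiL
    have e : (fun y : ℝ => (((1 - y) ^ (β + 1) * (1 + y) ^ (α + 1) : ℝ) : ℂ) *
        deriv (fun x => f (-x)) y) = fun y => - (fun y : ℝ =>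
          (((1 - y) ^ (α + 1) * (1 + y) ^ (β + 1) : ℝ) : ℂ) * deriv f y) (-y) := by
      funext y
      rw [deriv_comp_neg]
      simp only [sub_neg_eq_add, ← sub_eq_add_neg]
      push_cast
      ring
    rw [e, deriv.fun_neg, deriv_comp_neg (f := fun y : ℝ =>
          (((1 - y) ^ (α + 1) * (1 + y) ^ (β + 1) : ℝ) : ℂ) * deriv f y)]
    simp only [sub_neg_eq_add, ← sub_eq_add_neg, neg_neg]
    push_cast
    ring
  refine ⟨hf.1.comp (by fun_prop) hmaps, hmem f hf.2.1, ?_⟩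
  rw [hL]
  exact hmem _ hf.2.2

lemma pf_left {α β : ℝ} (hα0 : 0 ≤ α) (hα1 : α < 1)
    (hβ0 : 0 ≤ β) (hβ1 : β < 1) {f : ℝ → ℂ} (hf : JacobiMaxDom1 α β f) :
    Tendsto (fun x : ℝ => (((1 - x) ^ (α + 1) * (1 + x) ^ (β + 1) : ℝ) : ℂ) * f x)
          (𝓝[>] (-1 : ℝ)) (𝓝 0) := by
  have h := pf_right hβ0 hβ1 hα0 hα1 (maxDom_reflect hf)
  have hn : Tendsto (fun x : ℝ => -x) (𝓝[>] (-1 : ℝ)) (𝓝[<] (1:ℝ)) := by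
    simpa using tendsto_neg_nhdsGT (a := (-1:ℝ))
  refine (h.comp hn).congr fun x => ?_
  simp only [Function.comp, sub_neg_eq_add, ← sub_eq_add_neg, neg_neg]
  rw [mul_comm ((1 + x) ^ (β + 1))]

/-- The boundary conditions `[f,1]_1(±1) = 0` and `[f,P_m^{(α,β)}]_1(±1) = 0` cut out the
same subset of the Jacobi maximal domain. -/
theorem jacobi_boundary_condition_any_polynomial (α β : ℝ) (hα0 : 0 ≤ α) (hα1 : α < 1)
    (hβ0 : 0 ≤ β) (hβ1 : β < 1) (m : ℕ) :
    {f : ℝ → ℂ | JacobiMaxDom1 α β f ∧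
        Tendsto (fun x : ℝ => (((1 - x) ^ (α + 1) * (1 + x) ^ (β + 1) : ℝ) : ℂ) * deriv f x)
          (𝓝[<] (1 : ℝ)) (𝓝 0) ∧
        Tendsto (fun x : ℝ => (((1 - x) ^ (α + 1) * (1 + x) ^ (β + 1) : ℝ) : ℂ) * deriv f x)
          (𝓝[>] (-1 : ℝ)) (𝓝 0)} =
    {f : ℝ → ℂ | JacobiMaxDom1 α β f ∧
        Tendsto (fun x : ℝ => (((1 - x) ^ (α + 1) * (1 + x) ^ (β + 1) : ℝ) : ℂ) *
            (deriv f x * ((jacobiP α β m x : ℝ) : ℂ) -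
              f x * ((deriv (jacobiP α β m) x : ℝ) : ℂ)))
          (𝓝[<] (1 : ℝ)) (𝓝 0) ∧
        Tendsto (fun x : ℝ => (((1 - x) ^ (α + 1) * (1 + x) ^ (β + 1) : ℝ) : ℂ) *
            (deriv f x * ((jacobiP α β m x : ℝ) : ℂ) -
              f x * ((deriv (jacobiP α β m) x : ℝ) : ℂ)))
          (𝓝[>] (-1 : ℝ)) (𝓝 0)} := by
  ext f
  simp only [mem_setOf_eq]
  refine and_congr_right fun hf => and_congr ?_ ?_
  · exact bc_iff nhdsWithin_le_nhds (jacobiP_contDiff α β m) (jacobiP_one α β m hα0)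
      (pf_right hα0 hα1 hβ0 hβ1 hf)
  · exact bc_iff nhdsWithin_le_nhds (jacobiP_contDiff α β m) (jacobiP_neg_one α β m hβ0)
      (pf_left hα0 hα1 hβ0 hβ1 hf)
end

section
/- Fix 0 ≤ α, β < 1 and n ∈ ℕ, and let f : (-1,1) → ℂ belong to the maximal domain D_max^{J,n} of the n-th power of the Jacobi expression. Then for every k = 1, …, n and every integer j with 1 ≤ j < k, the one-sided limits lim_{x→1⁻} ( d^{k-j}/dx^{k-j} )[ (1-x)^{α+k}(1+x)^{β+k} f^{(k)}(x) ] and lim_{x→-1⁺} ( d^{k-j}/dx^{k-j} )[ (1-x)^{α+k}(1+x)^{β+k} f^{(k)}(x) ] exist (i.e. are finite complex numbers). -/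
open MeasureTheory Set Filter Topology

/-- The maximal domain `D_max^{J,n}` of the `n`-th power of the Jacobi expression:
`C^{2n}` functions on `(-1,1)` with `f ∈ L²_{α,β}` and `ℓ^n_{α,β}[f] ∈ L²_{α,β}`. -/
def JacobiMaxDom (α β : ℝ) (n : ℕ) (f : ℝ → ℂ) : Prop :=
  ContDiffOn ℝ (2 * n) f (Ioo (-1 : ℝ) 1) ∧ MemL2ab α β f ∧
    MemL2ab α β ((jacobiL α β)^[n] f)

/-- The coefficient function `a_k(x) = (1-x)^{α+k}(1+x)^{β+k}`. -/
noncomputable def ak (α β : ℝ) (k : ℕ) (x : ℝ) : ℝ :=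
  (1 - x) ^ (α + (k : ℝ)) * (1 + x) ^ (β + (k : ℝ))

/-- The `n`-th Jacobi sesquilinear form (for real-valued `g`; no conjugation):
`[f,g]_n(x) = Σ_{k=1}^{n} Σ_{j=1}^{k} (-1)^{k+j} { (a_k g^{(k)})^{(k-j)} f^{(j-1)}
 − (a_k f^{(k)})^{(k-j)} g^{(j-1)} }`. -/
noncomputable def sesq (α β : ℝ) (n : ℕ) (f g : ℝ → ℂ) (x : ℝ) : ℂ :=
  ∑ k ∈ Finset.Icc 1 n, ∑ j ∈ Finset.Icc 1 k, (-1 : ℂ) ^ (k + j) *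
    (iteratedDeriv (k - j) (fun y => ((ak α β k y : ℝ) : ℂ) * iteratedDeriv k g y) x *
        iteratedDeriv (j - 1) f x -
      iteratedDeriv (k - j) (fun y => ((ak α β k y : ℝ) : ℂ) * iteratedDeriv k f y) x *
        iteratedDeriv (j - 1) g x)

lemma jx_ak_pos (α β : ℝ) (k : ℕ) {x : ℝ} (hx : x ∈ Ioo (-1 : ℝ) 1) : 0 < ak α β k x := by
  unfold ak
  have h1 : 0 < 1 - x := by linarith [hx.2]
  have h2 : 0 < 1 + x := by linarith [hx.1]
  positivity

lemma jx_ak_succ (α β : ℝ) (k : ℕ) {x : ℝ} (hx : x ∈ Ioo (-1 : ℝ) 1) :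
    ak α β (k + 1) x = ak α β k x * ((1 - x) * (1 + x)) := by
  unfold ak
  have h1 : 0 < 1 - x := by linarith [hx.2]
  have h2 : 0 < 1 + x := by linarith [hx.1]
  push_cast
  rw [← add_assoc, ← add_assoc, Real.rpow_add_one h1.ne', Real.rpow_add_one h2.ne']
  ring

lemma jx_ak_hasDeriv (α β : ℝ) (k : ℕ) {x : ℝ} (hx : x ∈ Ioo (-1 : ℝ) 1) :
    HasDerivAt (ak α β (k + 1))
      (ak α β k x * ((β + k + 1) * (1 - x) - (α + k + 1) * (1 + x))) x := by
  have h1 : 0 < 1 - x := by linarith [hx.2]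
  have h2 : 0 < 1 + x := by linarith [hx.1]
  have e1 : HasDerivAt (fun y : ℝ => 1 - y) (-1) x := by
    simpa using (hasDerivAt_id x).const_sub 1
  have e2 : HasDerivAt (fun y : ℝ => 1 + y) 1 x := by
    simpa using (hasDerivAt_id x).const_add 1
  have d1 := e1.rpow_const (p := α + ((k + 1 : ℕ) : ℝ)) (Or.inl h1.ne')
  have d2 := e2.rpow_const (p := β + ((k + 1 : ℕ) : ℝ)) (Or.inl h2.ne')
  have d := d1.mul d2
  refine HasDerivAt.congr_deriv (f := ak α β (k + 1)) d ?_
  unfold ak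
  push_cast
  have r1 : (1 - x) ^ (α + ((k : ℝ) + 1)) = (1 - x) ^ (α + k) * (1 - x) := by
    rw [← add_assoc, Real.rpow_add_one h1.ne']
  have r2 : (1 + x) ^ (β + ((k : ℝ) + 1)) = (1 + x) ^ (β + k) * (1 + x) := by
    rw [← add_assoc, Real.rpow_add_one h2.ne']
  rw [r1, r2, show α + ((k : ℝ) + 1) - 1 = α + k by ring,
    show β + ((k : ℝ) + 1) - 1 = β + k by ring]
  ring

lemma jx_iter_contDiff (i : ℕ) : ∀ (N : ℕ) (h : ℝ → ℂ),
    ContDiffOn ℝ ((N + i : ℕ) : WithTop ℕ∞) h (Ioo (-1 : ℝ) 1) →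
    ContDiffOn ℝ (N : WithTop ℕ∞) (iteratedDeriv i h) (Ioo (-1 : ℝ) 1) := by
  induction i with
  | zero => intro N h hh; simpa using hh
  | succ i ih =>
    intro N h hh
    rw [iteratedDeriv_succ]
    refine ContDiffOn.deriv_of_isOpen (ih (N + 1) h ?_) isOpen_Ioo (by norm_cast)
    convert hh using 2
    omega

lemma jx_iter_hasDeriv {i N : ℕ} {h : ℝ → ℂ} (hi : i < N)
    (hh : ContDiffOn ℝ (N : WithTop ℕ∞) h (Ioo (-1 : ℝ) 1)) {x : ℝ}
    (hx : x ∈ Ioo (-1 : ℝ) 1) :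
    HasDerivAt (iteratedDeriv i h) (iteratedDeriv (i + 1) h x) x := by
  rw [iteratedDeriv_succ]
  have h1 : ContDiffOn ℝ ((1 : ℕ) : WithTop ℕ∞) (iteratedDeriv i h) (Ioo (-1 : ℝ) 1) :=
    jx_iter_contDiff i 1 h (hh.of_le (by exact_mod_cast (by omega : 1 + i ≤ N)))
  have h2 : DifferentiableOn ℝ (iteratedDeriv i h) (Ioo (-1 : ℝ) 1) :=
    h1.differentiableOn (by norm_num)
  exact (h2.differentiableAt (isOpen_Ioo.mem_nhds hx)).hasDerivAt

/-- iterated derivatives agree on the open interval -/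
lemma jx_iter_congr {f g : ℝ → ℂ} (i : ℕ) (h : EqOn f g (Ioo (-1 : ℝ) 1)) :
    EqOn (iteratedDeriv i f) (iteratedDeriv i g) (Ioo (-1 : ℝ) 1) := by
  intro x hx
  exact Filter.EventuallyEq.iteratedDeriv_eq i
    (Filter.eventuallyEq_of_mem (isOpen_Ioo.mem_nhds hx) h)

noncomputable def jxq (α β : ℝ) (k : ℕ) (h : ℝ → ℂ) : ℝ → ℂ :=
  fun y => ((ak α β k y : ℝ) : ℂ) * iteratedDeriv k h y

lemma jx_q_hasDeriv (α β : ℝ) (k : ℕ) {N : ℕ} {h : ℝ → ℂ} (hk : k + 1 < N)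
    (hh : ContDiffOn ℝ (N : WithTop ℕ∞) h (Ioo (-1 : ℝ) 1)) {x : ℝ}
    (hx : x ∈ Ioo (-1 : ℝ) 1) :
    HasDerivAt (jxq α β (k + 1) h)
      ((ak α β k x : ℂ) * ((1 - x ^ 2) * iteratedDeriv (k + 2) h x
        - (α - β + (α + β + 2 + 2 * k) * x) * iteratedDeriv (k + 1) h x)) x := by
  have d := (jx_ak_hasDeriv α β k hx).ofReal_comp.mul (jx_iter_hasDeriv hk hh hx)
  refine HasDerivAt.congr_deriv (f := jxq α β (k + 1) h) d ?_
  rw [jx_ak_succ α β k hx]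
  push_cast
  ring

lemma jx_L_eq (α β : ℝ) {N : ℕ} {h : ℝ → ℂ} (hN : 2 ≤ N)
    (hh : ContDiffOn ℝ (N : WithTop ℕ∞) h (Ioo (-1 : ℝ) 1)) {x : ℝ}
    (hx : x ∈ Ioo (-1 : ℝ) 1) :
    jacobiL α β h x = -((1 - x ^ 2) * iteratedDeriv 2 h x)
        + (α - β + (α + β + 2) * x) * iteratedDeriv 1 h x := by
  have d := (jx_q_hasDeriv α β 0 (by omega) hh hx).deriv
  have h1 : 0 < 1 - x := by linarith [hx.2]
  have h2 : 0 < 1 + x := by linarith [hx.1]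
  have e : (fun y : ℝ => (((1 - y) ^ (α + 1) * (1 + y) ^ (β + 1) : ℝ) : ℂ) * deriv h y)
      = jxq α β (0 + 1) h := by
    funext y
    simp [jxq, ak, iteratedDeriv_one]
  unfold jacobiL
  rw [e, d]
  have e0 : (1 - x) ^ (-α) * (1 + x) ^ (-β) * ak α β 0 x = 1 := by
    unfold ak
    rw [Real.rpow_neg h1.le, Real.rpow_neg h2.le]
    have := (Real.rpow_pos_of_pos h1 α).ne'
    have := (Real.rpow_pos_of_pos h2 β).ne'
    simp only [Nat.cast_zero, add_zero]
    field_simp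
  rw [← mul_assoc, ← Complex.ofReal_mul, e0]
  push_cast
  ring

lemma jx_L_contDiff (α β : ℝ) {N : ℕ} {h : ℝ → ℂ}
    (hh : ContDiffOn ℝ ((N + 2 : ℕ) : WithTop ℕ∞) h (Ioo (-1 : ℝ) 1)) :
    ContDiffOn ℝ (N : WithTop ℕ∞) (jacobiL α β h) (Ioo (-1 : ℝ) 1) := by
  have c2 := jx_iter_contDiff 2 N h hh
  have c1 := jx_iter_contDiff 1 N h (hh.of_le (by exact_mod_cast (by omega : N + 1 ≤ N + 2)))
  have cx : ContDiff ℝ (N : WithTop ℕ∞) (fun x : ℝ => (x : ℂ)) := Complex.ofRealCLM.contDiff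
  have : ContDiffOn ℝ (N : WithTop ℕ∞) (fun x : ℝ => -((1 - (x : ℂ) ^ 2) * iteratedDeriv 2 h x)
        + ((α : ℂ) - β + (α + β + 2) * (x : ℂ)) * iteratedDeriv 1 h x) (Ioo (-1 : ℝ) 1) := by
    refine ContDiffOn.add (ContDiffOn.neg (ContDiffOn.mul ?_ c2)) (ContDiffOn.mul ?_ c1)
    · exact (contDiff_const.sub (cx.pow 2)).contDiffOn
    · exact (contDiff_const.add (contDiff_const.mul cx)).contDiffOn
  exact this.congr fun x hx => jx_L_eq α β (by omega) hh hx

lemma jx_L_iter (α β : ℝ) (k : ℕ) : ∀ {N : ℕ} {h : ℝ → ℂ} (_ : k + 2 ≤ N)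
    (_ : ContDiffOn ℝ (N : WithTop ℕ∞) h (Ioo (-1 : ℝ) 1)) {x : ℝ}
    (_ : x ∈ Ioo (-1 : ℝ) 1),
    iteratedDeriv k (jacobiL α β h) x = -((1 - x ^ 2) * iteratedDeriv (k + 2) h x)
        + (α - β + (α + β + 2 + 2 * k) * x) * iteratedDeriv (k + 1) h x
        + (k * (k + 1 + α + β)) * iteratedDeriv k h x := by
  induction k with
  | zero =>
    intro N h hN hh x hx
    simp [jx_L_eq α β hN hh hx]
  | succ k ih =>
    intro N h hN hh x hx
    have e : deriv (iteratedDeriv k (jacobiL α β h)) x = deriv (fun x : ℝ =>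
        -((1 - (x : ℂ) ^ 2) * iteratedDeriv (k + 2) h x)
        + (α - β + (α + β + 2 + 2 * k) * x) * iteratedDeriv (k + 1) h x
        + (k * (k + 1 + α + β)) * iteratedDeriv k h x) x := by
      apply Filter.EventuallyEq.deriv_eq
      refine Filter.eventuallyEq_of_mem (isOpen_Ioo.mem_nhds hx) ?_
      intro y hy
      exact ih (by omega) hh hy
    rw [iteratedDeriv_succ, e]
    have dx : HasDerivAt (fun y : ℝ => (y : ℂ)) 1 x := Complex.ofRealCLM.hasDerivAt
    have d0 := jx_iter_hasDeriv (i := k) (by omega) hh hx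
    have d1 := jx_iter_hasDeriv (i := k + 1) (by omega) hh hx
    have d2 := jx_iter_hasDeriv (i := k + 2) (by omega) hh hx
    have dA : HasDerivAt (fun y : ℝ => (1 : ℂ) - (y : ℂ) ^ 2) (-(2 * (x : ℂ))) x := by
      have := (dx.pow 2).const_sub (1 : ℂ)
      simpa using this
    have dB : HasDerivAt (fun y : ℝ => (α : ℂ) - β + (α + β + 2 + 2 * k) * (y : ℂ))
        (α + β + 2 + 2 * k) x := by
      have := (dx.const_mul ((α : ℂ) + β + 2 + 2 * k)).const_add ((α : ℂ) - β)
      simpa using this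
    have d := ((dA.mul d2).neg.add (dB.mul d1)).add
      (d0.const_mul ((k : ℂ) * (k + 1 + α + β)))
    refine (HasDerivAt.deriv d).trans ?_
    push_cast
    ring

/-- The derivative of the weighted derivative, expressed through a lower one. -/
lemma jx_q_deriv (α β : ℝ) (k : ℕ) {N : ℕ} {h : ℝ → ℂ} (hk : k + 2 ≤ N)
    (hh : ContDiffOn ℝ (N : WithTop ℕ∞) h (Ioo (-1 : ℝ) 1)) {x : ℝ}
    (hx : x ∈ Ioo (-1 : ℝ) 1) :
    HasDerivAt (jxq α β (k + 1) h)
      (-(jxq α β k (fun y => jacobiL α β h y + (-(k * (k + 1 + α + β)) : ℂ) * h y) x)) x := by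
  refine (jx_q_hasDeriv α β k (by omega) hh hx).congr_deriv ?_
  unfold jxq
  obtain ⟨M, rfl⟩ : ∃ M, N = M + 2 := ⟨N - 2, by omega⟩
  have c1 : ContDiffAt ℝ (k : WithTop ℕ∞) (jacobiL α β h) x :=
    ((jx_L_contDiff α β hh).of_le (by exact_mod_cast (by omega : k ≤ M))).contDiffAt
      (isOpen_Ioo.mem_nhds hx)
  have c2 : ContDiffAt ℝ (k : WithTop ℕ∞) h x :=
    (hh.of_le (by exact_mod_cast (by omega : k ≤ M + 2))).contDiffAt (isOpen_Ioo.mem_nhds hx)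
  rw [iteratedDeriv_fun_add c1 (contDiffAt_const.mul c2), iteratedDeriv_const_mul_field,
    jx_L_iter α β k hk hh hx]
  ring

lemma jx_primitive {q q' : ℝ → ℂ} (hd : ∀ x ∈ Ioo (-1 : ℝ) 1, HasDerivAt q (q' x) x)
    (hi : IntegrableOn q' (Ioo (-1 : ℝ) 1)) :
    (∃ L : ℂ, Tendsto q (𝓝[<] (1 : ℝ)) (𝓝 L)) ∧ (∃ L : ℂ, Tendsto q (𝓝[>] (-1 : ℝ)) (𝓝 L)) ∧
      ∃ C : ℝ, ∀ x ∈ Ioo (-1 : ℝ) 1, ‖q x‖ ≤ C := by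
  have hI : IntegrableOn q' (Icc (-1 : ℝ) 1) := by
    rwa [integrableOn_Icc_iff_integrableOn_Ioo]
  have hc : ContinuousOn (fun x => q 0 + ∫ t in (0 : ℝ)..x, q' t) (Icc (-1 : ℝ) 1) := by
    have := intervalIntegral.continuousOn_primitive_interval' (f := q') (μ := volume)
      (b₁ := -1) (b₂ := 1) (a := 0)
      ((intervalIntegrable_iff_integrableOn_Icc_of_le (by norm_num)).2 hI)
      (by rw [uIcc_of_le] <;> norm_num)
    rw [uIcc_of_le (by norm_num)] at this
    exact continuousOn_const.add this
  have he : ∀ x ∈ Ioo (-1 : ℝ) 1, q 0 + ∫ t in (0 : ℝ)..x, q' t = q x := by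
    intro x hx
    have hs : uIcc 0 x ⊆ Ioo (-1 : ℝ) 1 :=
      (ordConnected_Ioo (a := (-1 : ℝ)) (b := 1)).uIcc_subset (by norm_num) hx
    rw [intervalIntegral.integral_eq_sub_of_hasDerivAt (fun y hy => hd y (hs hy))]
    · ring
    · rw [intervalIntegrable_iff]
      exact hi.mono_set (uIoc_subset_uIcc.trans hs)
  refine ⟨⟨q 0 + ∫ t in (0 : ℝ)..1, q' t, ?_⟩, ⟨q 0 + ∫ t in (0 : ℝ)..(-1), q' t, ?_⟩, ?_⟩
  · have := (hc 1 (by norm_num)).mono_left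
      (nhdsWithin_mono (1 : ℝ) (Ioo_subset_Icc_self (a := (-1 : ℝ)) (b := 1)))
    rw [nhdsWithin_Ioo_eq_nhdsLT (by norm_num)] at this
    refine this.congr' ?_
    filter_upwards [Ioo_mem_nhdsLT (show (-1 : ℝ) < 1 by norm_num)] with x hx using he x hx
  · have := (hc (-1) (by norm_num)).mono_left
      (nhdsWithin_mono (-1 : ℝ) (Ioo_subset_Icc_self (a := (-1 : ℝ)) (b := 1)))
    rw [nhdsWithin_Ioo_eq_nhdsGT (by norm_num)] at this
    refine this.congr' ?_
    filter_upwards [Ioo_mem_nhdsGT (show (-1 : ℝ) < 1 by norm_num)] with x hx using he x hx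
  · obtain ⟨C, hC⟩ := isCompact_Icc.exists_bound_of_continuousOn hc
    exact ⟨C, fun x hx => by rw [← he x hx]; exact hC x (Ioo_subset_Icc_self hx)⟩

/-- Growth bound on a half interval. -/
lemma jx_half {α C : ℝ} (hα : 0 ≤ α) (hC : 0 ≤ C) {h h' : ℝ → ℂ}
    (hd : ∀ x ∈ Ico (0 : ℝ) 1, HasDerivAt h (h' x) x)
    (hb : ∀ x ∈ Ico (0 : ℝ) 1, ‖h' x‖ ≤ C * (1 - x) ^ (-α - 3 / 2)) :
    ∃ K : ℝ, 0 ≤ K ∧ ∀ x ∈ Ico (0 : ℝ) 1, ‖h x‖ ≤ K * (1 - x) ^ (-α - 1 / 2) := by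
  have hp : 0 < α + 1 / 2 := by linarith
  set D := C / (α + 1 / 2) with hD
  have hD0 : 0 ≤ D := by positivity
  refine ⟨‖h 0‖ + D, by positivity, fun x hx => ?_⟩
  have hsub : ∀ y ∈ Icc (0 : ℝ) x, y ∈ Ico (0 : ℝ) 1 := fun y hy => ⟨hy.1, hy.2.trans_lt hx.2⟩
  have hB : ∀ y ∈ Ico (0 : ℝ) 1, HasDerivAt (fun y : ℝ => ‖h 0‖ + D * (1 - y) ^ (-α - 1 / 2))
      (C * (1 - y) ^ (-α - 3 / 2)) y := by
    intro y hy
    have h1 : 0 < 1 - y := by linarith [hy.2]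
    have e1 : HasDerivAt (fun y : ℝ => 1 - y) (-1) y := by
      simpa using (hasDerivAt_id y).const_sub 1
    have d := ((e1.rpow_const (p := -α - 1 / 2) (Or.inl h1.ne')).const_mul D).const_add ‖h 0‖
    refine d.congr_deriv ?_
    rw [show -α - 1 / 2 - 1 = -α - 3 / 2 by ring, hD]
    field_simp
    ring
  have key := image_norm_le_of_norm_deriv_right_le_deriv_boundary' (f := h) (f' := h')
    (a := 0) (b := x) (B := fun y : ℝ => ‖h 0‖ + D * (1 - y) ^ (-α - 1 / 2))
    (B' := fun y => C * (1 - y) ^ (-α - 3 / 2))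
    (fun y hy => (hd y (hsub y hy)).continuousAt.continuousWithinAt)
    (fun y hy => (hd y (hsub y (Ico_subset_Icc_self hy))).hasDerivWithinAt)
    (by simp [hD0])
    (fun y hy => (hB y (hsub y hy)).continuousAt.continuousWithinAt)
    (fun y hy => (hB y (hsub y (Ico_subset_Icc_self hy))).hasDerivWithinAt)
    (fun y hy => hb y (hsub y (Ico_subset_Icc_self hy)))
    (right_mem_Icc.2 hx.1)
  have h1 : 1 ≤ (1 - x) ^ (-α - 1 / 2) :=
    Real.one_le_rpow_of_pos_of_le_one_of_nonpos (by linarith [hx.2]) (by linarith [hx.1])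
      (by linarith)
  refine key.trans ?_
  nlinarith [norm_nonneg (h 0)]

lemma jx_ak_cont (α β : ℝ) (k : ℕ) : ContinuousOn (ak α β k) (Ioo (-1 : ℝ) 1) := by
  unfold ak
  refine ContinuousOn.mul ?_ ?_
  · exact ContinuousOn.rpow_const (by fun_prop) fun x hx => Or.inl (by linarith [hx.2])
  · exact ContinuousOn.rpow_const (by fun_prop) fun x hx => Or.inl (by linarith [hx.1])

lemma jx_q_cont (α β : ℝ) (k : ℕ) {h : ℝ → ℂ}
    (hh : ContDiffOn ℝ (k : WithTop ℕ∞) h (Ioo (-1 : ℝ) 1)) :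
    ContinuousOn (jxq α β k h) (Ioo (-1 : ℝ) 1) := by
  have := (jx_iter_contDiff k 0 h (by simpa using hh)).continuousOn
  exact (Complex.continuous_ofReal.comp_continuousOn (jx_ak_cont α β k)).mul this

lemma jx_ak_le (α β : ℝ) (hα : 0 ≤ α) (hβ : 0 ≤ β) {x : ℝ} (hx : x ∈ Ioo (-1 : ℝ) 1) :
    ak α β 0 x ≤ 2 ^ α * 2 ^ β := by
  unfold ak
  have h1 : 0 < 1 - x := by linarith [hx.2]
  have h2 : 0 < 1 + x := by linarith [hx.1]
  simp only [Nat.cast_zero, add_zero]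
  have := Real.rpow_le_rpow h1.le (by linarith [hx.1] : 1 - x ≤ 2) hα
  have := Real.rpow_le_rpow h2.le (by linarith [hx.2] : 1 + x ≤ 2) hβ
  gcongr

lemma jx_L1 (α β : ℝ) (hα : 0 ≤ α) (hβ : 0 ≤ β) {h : ℝ → ℂ}
    (hc : ContDiffOn ℝ ((0 : ℕ) : WithTop ℕ∞) h (Ioo (-1 : ℝ) 1)) (hm : MemL2ab α β h) :
    IntegrableOn (jxq α β 0 h) (Ioo (-1 : ℝ) 1) := by
  have hk : IntegrableOn (fun _ : ℝ => (2 : ℝ) ^ α * 2 ^ β) (Ioo (-1 : ℝ) 1) :=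
    integrableOn_const (by simp) enorm_ne_top
  have hm' := hm.add hk
  refine Integrable.mono' hm' ((jx_q_cont α β 0 hc).aestronglyMeasurable measurableSet_Ioo) ?_
  refine (ae_restrict_iff' measurableSet_Ioo).2 (Eventually.of_forall fun x hx => ?_)
  have hp := jx_ak_pos α β 0 hx
  have hl := jx_ak_le α β hα hβ hx
  simp only [Pi.add_apply]
  have e : ‖h x‖ ^ 2 * (1 - x) ^ α * (1 + x) ^ β = ‖h x‖ ^ 2 * ak α β 0 x := by
    simp [ak]; ring
  rw [e]
  have : ‖jxq α β 0 h x‖ = ak α β 0 x * ‖h x‖ := by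
    simp [jxq, abs_of_pos hp]
  rw [this]
  nlinarith [mul_nonneg hp.le (sq_nonneg (‖h x‖ - 1)), mul_nonneg hp.le (norm_nonneg (h x)),
    mul_nonneg hp.le (sq_nonneg (‖h x‖))]

/-- Pointwise bound on the right half. -/
lemma jx_bound {α β C : ℝ} (hα : 0 ≤ α) (hβ : 0 ≤ β) {x : ℝ} {z : ℂ} (hx : x ∈ Ico (0 : ℝ) 1)
    (hz : ((1 - x) ^ (α + 1) * (1 + x) ^ (β + 1)) * ‖z‖ ≤ C) :
    ‖z‖ ≤ C * (1 - x) ^ (-α - 3 / 2) := by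
  have h1 : 0 < 1 - x := by linarith [hx.2]
  have h2 : 1 ≤ (1 + x) ^ (β + 1) := Real.one_le_rpow (by linarith [hx.1]) (by linarith)
  have hp := Real.rpow_pos_of_pos h1 (α + 1)
  have h3 : (1 - x) ^ (α + 3 / 2) ≤ (1 - x) ^ (α + 1) :=
    Real.rpow_le_rpow_of_exponent_ge h1 (by linarith [hx.1]) (by linarith)
  have h4 : (1 - x) ^ (α + 3 / 2) * ‖z‖ ≤ C := by
    refine le_trans ?_ hz
    gcongr
    nlinarith
  rw [show -α - 3 / 2 = -(α + 3 / 2) by ring, Real.rpow_neg h1.le, ← div_eq_mul_inv,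
    le_div_iff₀ (Real.rpow_pos_of_pos h1 _)]
  linarith

lemma jx_down (α β : ℝ) (hα : 0 ≤ α) (hα1 : α < 1) (hβ : 0 ≤ β) (hβ1 : β < 1) {N : ℕ} (hN : 2 ≤ N)
    {h : ℝ → ℂ} (hc : ContDiffOn ℝ (N : WithTop ℕ∞) h (Ioo (-1 : ℝ) 1))
    (hi : IntegrableOn (jxq α β 0 (jacobiL α β h)) (Ioo (-1 : ℝ) 1)) :
    IntegrableOn (jxq α β 0 h) (Ioo (-1 : ℝ) 1) := by
  have hd : ∀ x ∈ Ioo (-1 : ℝ) 1, HasDerivAt (jxq α β 1 h) (-(jxq α β 0 (jacobiL α β h) x)) x := by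
    intro x hx
    have := jx_q_deriv α β 0 hN hc hx
    simpa using this
  obtain ⟨-, -, C, hC⟩ := jx_primitive hd hi.neg
  have hC0 : 0 ≤ C := (norm_nonneg _).trans (hC 0 (by norm_num))
  have hC' : ∀ x ∈ Ioo (-1 : ℝ) 1,
      ((1 - x) ^ (α + 1) * (1 + x) ^ (β + 1)) * ‖iteratedDeriv 1 h x‖ ≤ C := by
    intro x hx
    have hp := jx_ak_pos α β 1 hx
    have := hC x hx
    unfold jxq at this
    rw [norm_mul, Complex.norm_real, Real.norm_eq_abs, abs_of_pos hp] at this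
    simpa [ak] using this
  have hD : ∀ x ∈ Ioo (-1 : ℝ) 1, HasDerivAt h (iteratedDeriv 1 h x) x := by
    intro x hx
    have := jx_iter_hasDeriv (i := 0) (by omega) hc hx
    simpa using this
  have s1 : ∀ x ∈ Ico (0 : ℝ) 1, x ∈ Ioo (-1 : ℝ) 1 := fun x hx => ⟨by linarith [hx.1], hx.2⟩
  have s2 : ∀ x ∈ Ico (0 : ℝ) 1, -x ∈ Ioo (-1 : ℝ) 1 :=
    fun x hx => ⟨by linarith [hx.2], by linarith [hx.1]⟩
  obtain ⟨K₁, hK₁, b₁⟩ := jx_half hα hC0 (fun x hx => hD x (s1 x hx))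
    (fun x hx => jx_bound hα hβ hx (hC' x (s1 x hx)))
  obtain ⟨K₂, hK₂, b₂⟩ := jx_half (h := fun x => h (-x)) (h' := fun x => -iteratedDeriv 1 h (-x))
    hβ hC0 (fun x hx => by
      have := (hD (-x) (s2 x hx)).scomp x (hasDerivAt_neg x)
      simpa [Function.comp_def] using this)
    (fun x hx => jx_bound hβ hα hx (by
      have := hC' (-x) (s2 x hx)
      rw [norm_neg, mul_comm ((1 - x) ^ (β + 1))]
      simpa [sub_eq_add_neg] using this))
  have i1 : IntegrableOn (fun x : ℝ => (1 - x) ^ (-(1 / 2) : ℝ)) (Ioo (-1 : ℝ) 1) := by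
    have := (intervalIntegral.intervalIntegrable_rpow' (a := 2) (b := 0) (r := -(1 / 2))
      (by norm_num)).comp_sub_left 1
    norm_num at this
    rw [intervalIntegrable_iff_integrableOn_Ioo_of_le (by norm_num)] at this
    simpa using this
  have i2 : IntegrableOn (fun x : ℝ => (1 + x) ^ (-(1 / 2) : ℝ)) (Ioo (-1 : ℝ) 1) := by
    have := (intervalIntegral.intervalIntegrable_rpow' (a := 0) (b := 2) (r := -(1 / 2))
      (by norm_num)).comp_add_left 1
    norm_num at this
    rw [intervalIntegrable_iff_integrableOn_Ioo_of_le (by norm_num)] at this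
    simpa using this
  have hdom := (i1.const_mul (K₁ * 2 ^ β)).add (i2.const_mul (K₂ * 2 ^ α))
  refine Integrable.mono' hdom ((jx_q_cont α β 0 (hc.of_le (by simp))).aestronglyMeasurable
    measurableSet_Ioo) ?_
  refine (ae_restrict_iff' measurableSet_Ioo).2 (Eventually.of_forall fun x hx => ?_)
  have hp := jx_ak_pos α β 0 hx
  have h1 : 0 < 1 - x := by linarith [hx.2]
  have h2 : 0 < 1 + x := by linarith [hx.1]
  have e : ‖jxq α β 0 h x‖ = (1 - x) ^ α * (1 + x) ^ β * ‖h x‖ := by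
    simp [jxq, abs_of_pos hp]
    left
    simp [ak]
  rw [e]
  simp only [Pi.add_apply]
  have p1 : (1 + x) ^ β ≤ 2 ^ β := Real.rpow_le_rpow h2.le (by linarith [hx.2]) hβ
  have p2 : (1 - x) ^ α ≤ 2 ^ α := Real.rpow_le_rpow h1.le (by linarith [hx.1]) hα
  have q1 : 0 ≤ K₁ * 2 ^ β * (1 - x) ^ (-(1 / 2) : ℝ) := by positivity
  have q2 : 0 ≤ K₂ * 2 ^ α * (1 + x) ^ (-(1 / 2) : ℝ) := by positivity
  rcases le_total 0 x with hx0 | hx0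
  · have b := b₁ x ⟨hx0, hx.2⟩
    have r : (1 - x) ^ α * (1 - x) ^ (-α - 1 / 2) = (1 - x) ^ (-(1 / 2) : ℝ) := by
      rw [← Real.rpow_add h1]; congr 1; ring
    calc (1 - x) ^ α * (1 + x) ^ β * ‖h x‖
        ≤ (1 - x) ^ α * 2 ^ β * (K₁ * (1 - x) ^ (-α - 1 / 2)) := by gcongr
      _ = K₁ * 2 ^ β * ((1 - x) ^ α * (1 - x) ^ (-α - 1 / 2)) := by ring
      _ ≤ _ := by rw [r]; linarith
  · have b := b₂ (-x) ⟨by linarith, by linarith [hx.1]⟩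
    simp only [neg_neg, sub_neg_eq_add] at b
    have r : (1 + x) ^ β * (1 + x) ^ (-β - 1 / 2) = (1 + x) ^ (-(1 / 2) : ℝ) := by
      rw [← Real.rpow_add h2]; congr 1; ring
    calc (1 - x) ^ α * (1 + x) ^ β * ‖h x‖
        ≤ 2 ^ α * (1 + x) ^ β * (K₂ * (1 + x) ^ (-β - 1 / 2)) := by gcongr
      _ = K₂ * 2 ^ α * ((1 + x) ^ β * (1 + x) ^ (-β - 1 / 2)) := by ring
      _ ≤ _ := by rw [r]; linarith

def jxGood (α β : ℝ) : ℕ → (ℝ → ℂ) → Prop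
  | 0, h => ContDiffOn ℝ ((0 : ℕ) : WithTop ℕ∞) h (Ioo (-1 : ℝ) 1) ∧
      IntegrableOn (jxq α β 0 h) (Ioo (-1 : ℝ) 1)
  | (m + 1), h => ContDiffOn ℝ ((2 * m + 2 : ℕ) : WithTop ℕ∞) h (Ioo (-1 : ℝ) 1) ∧
      IntegrableOn (jxq α β 0 h) (Ioo (-1 : ℝ) 1) ∧ jxGood α β m (jacobiL α β h)

lemma jxGood_int {α β : ℝ} {m : ℕ} {h : ℝ → ℂ} (hg : jxGood α β m h) :
    IntegrableOn (jxq α β 0 h) (Ioo (-1 : ℝ) 1) := by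
  cases m with
  | zero => exact hg.2
  | succ m => exact hg.2.1

lemma jxGood_cont {α β : ℝ} {m : ℕ} {h : ℝ → ℂ} (hg : jxGood α β m h) :
    ContDiffOn ℝ ((2 * m : ℕ) : WithTop ℕ∞) h (Ioo (-1 : ℝ) 1) := by
  cases m with
  | zero => exact hg.1
  | succ m => exact hg.1

lemma jxGood_pred {α β : ℝ} (m : ℕ) : ∀ {h : ℝ → ℂ}, jxGood α β (m + 1) h → jxGood α β m h := by
  induction m with
  | zero => intro h hg; exact ⟨hg.1.of_le (by simp), hg.2.1⟩
  | succ m ih =>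
    intro h hg
    exact ⟨hg.1.of_le (by exact_mod_cast (by omega)), hg.2.1, ih hg.2.2⟩

lemma jxGood_le {α β : ℝ} {m k : ℕ} (hk : k ≤ m) {h : ℝ → ℂ} (hg : jxGood α β m h) :
    jxGood α β k h := by
  induction m, hk using Nat.le_induction with
  | base => exact hg
  | succ m _ ih => exact ih (jxGood_pred m hg)

lemma jxq_congr {α β : ℝ} {g h : ℝ → ℂ} (k : ℕ) (e : EqOn g h (Ioo (-1 : ℝ) 1)) :
    EqOn (jxq α β k g) (jxq α β k h) (Ioo (-1 : ℝ) 1) := by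
  intro x hx
  simp only [jxq, jx_iter_congr k e hx]

lemma jxL_congr {α β : ℝ} {g h : ℝ → ℂ} (e : EqOn g h (Ioo (-1 : ℝ) 1)) :
    EqOn (jacobiL α β g) (jacobiL α β h) (Ioo (-1 : ℝ) 1) := by
  intro x hx
  unfold jacobiL
  congr 2
  apply Filter.EventuallyEq.deriv_eq
  refine Filter.eventuallyEq_of_mem (isOpen_Ioo.mem_nhds hx) ?_
  intro y hy
  have := jx_iter_congr 1 e hy
  simp only [iteratedDeriv_one] at this
  simp only [this]

lemma jxGood_congr {α β : ℝ} (m : ℕ) : ∀ {g h : ℝ → ℂ}, EqOn g h (Ioo (-1 : ℝ) 1) →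
    jxGood α β m h → jxGood α β m g := by
  induction m with
  | zero =>
    intro g h e hg
    exact ⟨hg.1.congr e, hg.2.congr_fun (jxq_congr 0 e.symm) measurableSet_Ioo⟩
  | succ m ih =>
    intro g h e hg
    exact ⟨hg.1.congr e, hg.2.1.congr_fun (jxq_congr 0 e.symm) measurableSet_Ioo,
      ih (jxL_congr e) hg.2.2⟩

lemma jxq0_lin {α β : ℝ} {g h : ℝ → ℂ} (c : ℂ)
    (hg : IntegrableOn (jxq α β 0 g) (Ioo (-1 : ℝ) 1))
    (hh : IntegrableOn (jxq α β 0 h) (Ioo (-1 : ℝ) 1)) :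
    IntegrableOn (jxq α β 0 (fun y => g y + c * h y)) (Ioo (-1 : ℝ) 1) := by
  refine (hg.add (hh.const_mul c)).congr (Eventually.of_forall fun x => ?_)
  simp [jxq]
  ring

lemma jxGood_lin {α β : ℝ} (c : ℂ) (m : ℕ) : ∀ {g h : ℝ → ℂ}, jxGood α β m g → jxGood α β m h →
    jxGood α β m (fun y => g y + c * h y) := by
  induction m with
  | zero =>
    intro g h hg hh
    exact ⟨hg.1.add (contDiffOn_const.mul hh.1), jxq0_lin c hg.2 hh.2⟩
  | succ m ih =>
    intro g h hg hh
    have hc := hg.1.add (contDiffOn_const (c := c).mul hh.1)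
    refine ⟨hc, jxq0_lin c hg.2.1 hh.2.1, jxGood_congr m ?_ (ih hg.2.2 hh.2.2)⟩
    intro x hx
    simp only
    have c1 : ∀ i ≤ 2, ContDiffAt ℝ (i : ℕ) g x := fun i hi =>
      (hg.1.of_le (by exact_mod_cast (by omega))).contDiffAt (isOpen_Ioo.mem_nhds hx)
    have c2 : ∀ i ≤ 2, ContDiffAt ℝ (i : ℕ) h x := fun i hi =>
      (hh.1.of_le (by exact_mod_cast (by omega))).contDiffAt (isOpen_Ioo.mem_nhds hx)
    rw [jx_L_eq α β (by omega) hg.1 hx, jx_L_eq α β (by omega) hh.1 hx]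
    refine (jx_L_eq α β (by omega) hc hx).trans ?_
    have e : ∀ i ≤ 2, iteratedDeriv i (fun y => g y + c * h y) x
        = iteratedDeriv i g x + c * iteratedDeriv i h x := fun i hi => by
      rw [iteratedDeriv_fun_add (c1 i hi) (contDiffAt_const.mul (c2 i hi)),
        iteratedDeriv_const_mul_field]
    rw [e 1 (by omega), e 2 (by omega)]
    ring

lemma jxGood_of_max (α β : ℝ) (hα : 0 ≤ α) (hα1 : α < 1) (hβ : 0 ≤ β) (hβ1 : β < 1) (n : ℕ) :
    ∀ h : ℝ → ℂ, ContDiffOn ℝ ((2 * n : ℕ) : WithTop ℕ∞) h (Ioo (-1 : ℝ) 1) →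
      MemL2ab α β ((jacobiL α β)^[n] h) → jxGood α β n h := by
  induction n with
  | zero => intro h hc hm; exact ⟨hc, jx_L1 α β hα hβ hc hm⟩
  | succ n ih =>
    intro h hc hm
    have hg := ih (jacobiL α β h) (jx_L_contDiff α β hc) hm
    exact ⟨hc, jx_down α β hα hα1 hβ hβ1 (by omega) hc (jxGood_int hg), hg⟩

lemma jx_main (α β : ℝ) (k : ℕ) : ∀ h : ℝ → ℂ, jxGood α β k h →
    IntegrableOn (jxq α β k h) (Ioo (-1 : ℝ) 1) ∧ ∀ d < k,
      (∃ L : ℂ, Tendsto (iteratedDeriv d (jxq α β k h)) (𝓝[<] (1 : ℝ)) (𝓝 L)) ∧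
      (∃ L : ℂ, Tendsto (iteratedDeriv d (jxq α β k h)) (𝓝[>] (-1 : ℝ)) (𝓝 L)) := by
  induction k with
  | zero => intro h hg; exact ⟨hg.2, by simp⟩
  | succ k ih =>
    intro h hg
    set g : ℝ → ℂ := fun y => jacobiL α β h y + (-(k * (k + 1 + α + β)) : ℂ) * h y with hgdef
    have hgg : jxGood α β k g := jxGood_lin _ k hg.2.2 (jxGood_pred k hg)
    obtain ⟨i1, i2⟩ := ih g hgg
    have hd : ∀ x ∈ Ioo (-1 : ℝ) 1, HasDerivAt (jxq α β (k + 1) h) (-(jxq α β k g x)) x :=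
      fun x hx => jx_q_deriv α β k (by omega) hg.1 hx
    obtain ⟨l1, l2, C, hC⟩ := jx_primitive hd i1.neg
    refine ⟨?_, ?_⟩
    · have hk : IntegrableOn (fun _ : ℝ => C) (Ioo (-1 : ℝ) 1) :=
        integrableOn_const (by simp) enorm_ne_top
      refine Integrable.mono' hk ?_ ?_
      · exact ContinuousOn.aestronglyMeasurable
          (fun x hx => (hd x hx).continuousAt.continuousWithinAt) measurableSet_Ioo
      · exact (ae_restrict_iff' measurableSet_Ioo).2 (Eventually.of_forall hC)
    · intro d hdk
      cases d with
      | zero => simpa using ⟨l1, l2⟩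
      | succ d =>
        rw [iteratedDeriv_succ']
        have e : EqOn (iteratedDeriv d (deriv (jxq α β (k + 1) h)))
            (fun x => -iteratedDeriv d (jxq α β k g) x) (Ioo (-1 : ℝ) 1) := by
          intro x hx
          rw [jx_iter_congr d (fun y hy => (hd y hy).deriv) hx, iteratedDeriv_fun_neg]
        obtain ⟨⟨L1, h1⟩, ⟨L2, h2⟩⟩ := i2 d (by omega)
        refine ⟨⟨-L1, h1.neg.congr' ?_⟩, ⟨-L2, h2.neg.congr' ?_⟩⟩
        · filter_upwards [Ioo_mem_nhdsLT (show (-1 : ℝ) < 1 by norm_num)] with x hx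
            using (e hx).symm
        · filter_upwards [Ioo_mem_nhdsGT (show (-1 : ℝ) < 1 by norm_num)] with x hx
            using (e hx).symm

/-- If `f` lies in the maximal domain of the `n`-th power of the Jacobi expression, then
for every `k = 1,…,n` and every `j` with `1 ≤ j < k`, the one-sided limits at both
endpoints of the `(k-j)`-th derivative of `(1-x)^{α+k}(1+x)^{β+k} f^{(k)}(x)` exist. -/
theorem jacobi_power_maxdomain_higher_derivative_limits (α β : ℝ)
    (hα0 : 0 ≤ α) (hα1 : α < 1) (hβ0 : 0 ≤ β) (hβ1 : β < 1) (n : ℕ) (hn : 1 ≤ n)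
    (f : ℝ → ℂ) (hf : JacobiMaxDom α β n f) :
    ∀ k : ℕ, k ≤ n → ∀ j : ℕ, 1 ≤ j → j < k →
      (∃ L : ℂ, Tendsto
        (fun x : ℝ =>
          iteratedDeriv (k - j) (fun y => ((ak α β k y : ℝ) : ℂ) * iteratedDeriv k f y) x)
        (𝓝[<] (1 : ℝ)) (𝓝 L)) ∧
      (∃ L : ℂ, Tendsto
        (fun x : ℝ =>
          iteratedDeriv (k - j) (fun y => ((ak α β k y : ℝ) : ℂ) * iteratedDeriv k f y) x)
        (𝓝[>] (-1 : ℝ)) (𝓝 L)) := by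
  intro k hk j hj hjk
  have hg := jxGood_of_max α β hα0 hα1 hβ0 hβ1 n f (by simpa using hf.1) hf.2.2
  exact (jx_main α β k f (jxGood_le hk hg)).2 (k - j) (by omega)
end

section
/- Fix 0 ≤ α, β < 1 and n ∈ ℕ, let s be an integer with s ≥ n, and let f : (-1,1) → ℂ belong to the maximal domain D_max^{J,n}. Then lim_{x→1⁻} [f, (1-x)^s]_n(x) = 0 and lim_{x→-1⁺} [f, (1+x)^s]_n(x) = 0, where [·,·]_n is the n-th Jacobi sesquilinear form. (Hence the functions behaving like (1-x)^s near 1 and (1+x)^s near -1, for s ≥ n, lie in the minimal domain of the n-th power of the Jacobi expression.) -/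
open MeasureTheory Set Filter Topology

/-- Symbol class at the endpoint `1`. -/
def SymCl : ℕ → ℝ → (ℝ → ℂ) → Prop
  | 0, _, _ => True
  | N + 1, γ, u => (∀ x ∈ Ioo (-1 : ℝ) 1, DifferentiableAt ℝ u x) ∧
      (u =O[𝓝[<] (1 : ℝ)] fun x : ℝ => (1 - x) ^ γ) ∧ SymCl N (γ - 1) (deriv u)

theorem ev_Ioo : ∀ᶠ x in 𝓝[<] (1 : ℝ), x ∈ Ioo (-1 : ℝ) 1 :=
  Ioo_mem_nhdsLT (by norm_num)

theorem ev_Ioo0 : ∀ᶠ x in 𝓝[<] (1 : ℝ), x ∈ Ioo (0 : ℝ) 1 :=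
  Ioo_mem_nhdsLT (by norm_num)

theorem rpow_bigO {γ δ : ℝ} (h : δ ≤ γ) :
    (fun x : ℝ => (1 - x) ^ γ) =O[𝓝[<] (1 : ℝ)] fun x : ℝ => (1 - x) ^ δ := by
  refine Asymptotics.IsBigO.of_bound 1 ?_
  filter_upwards [ev_Ioo0] with x hx
  have h1 : 0 < 1 - x := by linarith [hx.2]
  rw [Real.norm_of_nonneg (by positivity), Real.norm_of_nonneg (by positivity), one_mul]
  exact Real.rpow_le_rpow_of_exponent_ge h1 (by linarith [hx.1]) h

theorem rpow_mul_ev (γ δ : ℝ) :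
    (fun x : ℝ => (1 - x) ^ γ * (1 - x) ^ δ) =ᶠ[𝓝[<] (1 : ℝ)] fun x : ℝ => (1 - x) ^ (γ + δ) := by
  filter_upwards [ev_Ioo0] with x hx
  rw [← Real.rpow_add (by linarith [hx.2])]

theorem SymCl.congr {N : ℕ} : ∀ {γ : ℝ} {u v : ℝ → ℂ}, EqOn u v (Ioo (-1 : ℝ) 1) →
    SymCl N γ u → SymCl N γ v := by
  induction N with
  | zero => intros; trivial
  | succ N ih =>
    rintro γ u v h ⟨h1, h2, h3⟩
    have hev : ∀ x ∈ Ioo (-1 : ℝ) 1, u =ᶠ[𝓝 x] v := fun x hx =>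
      h.eventuallyEq_of_mem (isOpen_Ioo.mem_nhds hx)
    refine ⟨fun x hx => (hev x hx).differentiableAt_iff.1 (h1 x hx), ?_, ?_⟩
    · refine h2.congr' ?_ EventuallyEq.rfl
      filter_upwards [ev_Ioo] with x hx using h hx
    · exact ih (fun x hx => (hev x hx).deriv_eq) h3

theorem SymCl.pred {N : ℕ} : ∀ {γ : ℝ} {u : ℝ → ℂ}, SymCl (N + 1) γ u → SymCl N γ u := by
  induction N with
  | zero => intros; trivial
  | succ N ih =>
    rintro γ u ⟨h1, h2, h3⟩
    exact ⟨h1, h2, ih h3⟩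

theorem SymCl.weaken {N : ℕ} : ∀ {γ δ : ℝ} {u : ℝ → ℂ}, δ ≤ γ → SymCl N γ u → SymCl N δ u := by
  induction N with
  | zero => intros; trivial
  | succ N ih =>
    rintro γ δ u h ⟨h1, h2, h3⟩
    exact ⟨h1, h2.trans (rpow_bigO h), ih (by linarith) h3⟩

theorem SymCl.le {N M : ℕ} (h : N ≤ M) {γ : ℝ} {u : ℝ → ℂ} (hu : SymCl M γ u) : SymCl N γ u := by
  induction M, h using Nat.le_induction with
  | base => exact hu
  | succ M _ ih => exact ih hu.pred

theorem SymCl.add {N : ℕ} : ∀ {γ : ℝ} {u v : ℝ → ℂ}, SymCl N γ u → SymCl N γ v →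
    SymCl N γ (fun x => u x + v x) := by
  induction N with
  | zero => intros; trivial
  | succ N ih =>
    rintro γ u v ⟨h1, h2, h3⟩ ⟨k1, k2, k3⟩
    refine ⟨fun x hx => (h1 x hx).add (k1 x hx), h2.add k2, ?_⟩
    refine (ih h3 k3).congr fun x hx => ?_
    exact (deriv_fun_add (h1 x hx) (k1 x hx)).symm

theorem SymCl.mul {N : ℕ} : ∀ {γ δ : ℝ} {u v : ℝ → ℂ}, SymCl N γ u → SymCl N δ v →
    SymCl N (γ + δ) (fun x => u x * v x) := by
  induction N with
  | zero => intros; trivial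
  | succ N ih =>
    intro γ δ u v hu hv
    have hu' := hu.pred
    have hv' := hv.pred
    obtain ⟨h1, h2, h3⟩ := hu
    obtain ⟨k1, k2, k3⟩ := hv
    refine ⟨fun x hx => (h1 x hx).mul (k1 x hx), ?_, ?_⟩
    · exact (h2.mul k2).congr' EventuallyEq.rfl (rpow_mul_ev γ δ)
    · have a1 := ih h3 hv'
      have a2 := ih hu' k3
      rw [show γ - 1 + δ = γ + δ - 1 by ring] at a1
      rw [show γ + (δ - 1) = γ + δ - 1 by ring] at a2
      refine (a1.add a2).congr fun x hx => ?_
      exact (deriv_fun_mul (h1 x hx) (k1 x hx)).symm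

theorem SymCl.rpow_sub (N : ℕ) : ∀ (c γ : ℝ),
    SymCl N γ (fun x : ℝ => ((c * (1 - x) ^ γ : ℝ) : ℂ)) := by
  induction N with
  | zero => intros; trivial
  | succ N ih =>
    intro c γ
    have hd : ∀ x ∈ Ioo (-1 : ℝ) 1, HasDerivAt (fun x : ℝ => ((c * (1 - x) ^ γ : ℝ) : ℂ))
        ((c * (-γ) * (1 - x) ^ (γ - 1) : ℝ) : ℂ) x := by
      intro x hx
      apply HasDerivAt.ofReal_comp
      have h := (((hasDerivAt_id x).const_sub 1).rpow_const (p := γ)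
        (Or.inl (by simp only [id]; linarith [hx.2]))).const_mul c
      refine HasDerivAt.congr_deriv h ?_
      simp only [id]; ring
    refine ⟨fun x hx => (hd x hx).differentiableAt, ?_, ?_⟩
    · refine Asymptotics.IsBigO.of_bound |c| ?_
      filter_upwards with x
      simp
    · exact (ih (c * (-γ)) (γ - 1)).congr fun x hx => ((hd x hx).deriv).symm

theorem SymCl.rpow_add (N : ℕ) : ∀ (c γ : ℝ),
    SymCl N 0 (fun x : ℝ => ((c * (1 + x) ^ γ : ℝ) : ℂ)) := by
  induction N with
  | zero => intros; trivial
  | succ N ih =>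
    intro c γ
    have hd : ∀ x, -1 < x → HasDerivAt (fun x : ℝ => ((c * (1 + x) ^ γ : ℝ) : ℂ))
        ((c * γ * (1 + x) ^ (γ - 1) : ℝ) : ℂ) x := by
      intro x hx
      apply HasDerivAt.ofReal_comp
      have h := (((hasDerivAt_id x).const_add 1).rpow_const (p := γ)
        (Or.inl (by simp only [id]; linarith))).const_mul c
      refine HasDerivAt.congr_deriv h ?_
      simp only [id]; ring
    refine ⟨fun x hx => (hd x hx.1).differentiableAt, ?_, ?_⟩
    · simp only [Real.rpow_zero]
      exact ((hd 1 (by norm_num)).continuousAt.mono_left nhdsWithin_le_nhds).isBigO_one ℝ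
    · exact ((ih (c * γ) (γ - 1)).weaken (by norm_num)).congr
        fun x hx => ((hd x hx.1).deriv).symm

theorem SymCl.weight (N : ℕ) (a b : ℝ) :
    SymCl N a (fun x : ℝ => (((1 - x) ^ a * (1 + x) ^ b : ℝ) : ℂ)) := by
  have := (SymCl.rpow_sub N 1 a).mul (SymCl.rpow_add N 1 b)
  rw [add_zero] at this
  exact this.congr fun x _ => by simp

theorem SymCl.iter {N : ℕ} (m : ℕ) : ∀ {γ : ℝ} {u : ℝ → ℂ}, SymCl (N + m) γ u →
    SymCl N (γ - m) (iteratedDeriv m u) := by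
  induction m with
  | zero => intro γ u h; simpa using h
  | succ m ih =>
    intro γ u h
    have := ih h.2.2
    rw [iteratedDeriv_succ']
    convert this using 1
    push_cast; ring

/-- Integrability against the Jacobi weight near `1`. -/
def LwOne (α β : ℝ) (u : ℝ → ℂ) : Prop :=
  IntegrableAtFilter (fun x : ℝ => (((1 - x) ^ α * (1 + x) ^ β : ℝ) : ℂ) * u x) (𝓝[<] (1 : ℝ))

theorem bigO_const_of_deriv {p : ℝ → ℂ} (hd : ∀ x ∈ Ioo (-1 : ℝ) 1, DifferentiableAt ℝ p x)
    (hi : IntegrableAtFilter (deriv p) (𝓝[<] (1 : ℝ))) :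
    p =O[𝓝[<] (1 : ℝ)] fun _ => (1 : ℝ) := by
  obtain ⟨s, hs, hsi⟩ := hi
  obtain ⟨a, ha, has⟩ := (mem_nhdsLT_iff_exists_Ioo_subset' (show (0 : ℝ) < 1 by norm_num)).1
    (inter_mem hs ev_Ioo0)
  have ha1 : a < 1 := ha
  obtain ⟨b, hab, hb1⟩ := exists_between ha1
  have hbm := has ⟨hab, hb1⟩
  refine Asymptotics.IsBigO.of_bound (‖p b‖ + ∫ x in s, ‖deriv p x‖) ?_
  filter_upwards [Ioo_mem_nhdsLT hb1] with x hx
  have hsub : uIcc b x ⊆ s ∩ Ioo (0 : ℝ) 1 := by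
    rw [uIcc_of_le hx.1.le]
    exact fun y hy => has ⟨hab.trans_le hy.1, hy.2.trans_lt hx.2⟩
  have hsub' : Set.uIoc b x ⊆ s := fun y hy => (hsub (uIoc_subset_uIcc hy)).1
  have hii : IntervalIntegrable (deriv p) volume b x := by
    rw [intervalIntegrable_iff]
    exact hsi.mono_set hsub'
  have hftc := intervalIntegral.integral_eq_sub_of_hasDerivAt
    (fun y hy => (hd y ⟨by linarith [(hsub hy).2.1], (hsub hy).2.2⟩).hasDerivAt) hii
  have h1 : ‖∫ y in b..x, deriv p y‖ ≤ ∫ y in s, ‖deriv p y‖ := by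
    refine intervalIntegral.norm_integral_le_integral_norm_uIoc.trans ?_
    exact setIntegral_mono_set hsi.norm (Eventually.of_forall fun y => norm_nonneg _)
      (LE.le.eventuallyLE hsub')
  rw [hftc] at h1
  have h2 : ‖p x‖ ≤ ‖p b‖ + ‖p x - p b‖ := by
    have := norm_add_le (p b) (p x - p b)
    simpa using this
  simp only [norm_one, mul_one]
  linarith

theorem bigO_of_deriv {u : ℝ → ℂ} {γ : ℝ} (hγ : γ < 0)
    (hd : ∀ x ∈ Ioo (-1 : ℝ) 1, DifferentiableAt ℝ u x)
    (hO : deriv u =O[𝓝[<] (1 : ℝ)] fun x : ℝ => (1 - x) ^ (γ - 1)) :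
    u =O[𝓝[<] (1 : ℝ)] fun x : ℝ => (1 - x) ^ γ := by
  obtain ⟨C, hC0, hC⟩ := hO.exists_pos
  obtain ⟨a, ha, has⟩ := (mem_nhdsLT_iff_exists_Ioo_subset' (show (0 : ℝ) < 1 by norm_num)).1
    (inter_mem hC.bound ev_Ioo0)
  have ha1 : a < 1 := ha
  obtain ⟨b, hab, hb1⟩ := exists_between ha1
  have hbm := has ⟨hab, hb1⟩
  refine Asymptotics.IsBigO.of_bound (‖u b‖ + C / (-γ)) ?_
  filter_upwards [Ioo_mem_nhdsLT hb1] with x hx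
  have hpos : ∀ y ∈ Icc b x, 0 < 1 - y := fun y hy => by linarith [hy.2, hx.2]
  have hin : ∀ y ∈ Icc b x, y ∈ Ioo a 1 := fun y hy => ⟨hab.trans_le hy.1, hy.2.trans_lt hx.2⟩
  have hBd : ∀ y ∈ Icc b x, HasDerivAt (fun y : ℝ => ‖u b‖ + C / (-γ) * (1 - y) ^ γ)
      (C * (1 - y) ^ (γ - 1)) y := by
    intro y hy
    have h := ((((hasDerivAt_id y).const_sub 1).rpow_const (p := γ)
        (Or.inl (by simpa using (hpos y hy).ne'))).const_mul (C / (-γ))).const_add ‖u b‖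
    refine HasDerivAt.congr_deriv h ?_
    have : γ ≠ 0 := hγ.ne
    simp only [id]
    field_simp
  have hud : ∀ y ∈ Icc b x, DifferentiableAt ℝ u y := fun y hy =>
    hd y ⟨by linarith [(has (hin y hy)).2.1], (has (hin y hy)).2.2⟩
  have key := image_norm_le_of_norm_deriv_right_le_deriv_boundary' (f := u) (f' := deriv u)
    (a := b) (b := x) (B := fun y : ℝ => ‖u b‖ + C / (-γ) * (1 - y) ^ γ)
    (B' := fun y => C * (1 - y) ^ (γ - 1))
    (fun y hy => (hud y hy).continuousAt.continuousWithinAt)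
    (fun y hy => (hud y ⟨hy.1, hy.2.le⟩).hasDerivAt.hasDerivWithinAt)
    (by
      have : 0 ≤ C / (-γ) * (1 - b) ^ γ :=
        mul_nonneg (div_nonneg hC0.le (by linarith)) (Real.rpow_nonneg (by linarith) _)
      simpa using this)
    (fun y hy => (hBd y hy).continuousAt.continuousWithinAt)
    (fun y hy => (hBd y ⟨hy.1, hy.2.le⟩).hasDerivWithinAt)
    (fun y hy => by
      have := (has (hin y ⟨hy.1, hy.2.le⟩)).1
      simp only [mem_ofPred_eq] at this
      rwa [Real.norm_of_nonneg (Real.rpow_nonneg (hpos y ⟨hy.1, hy.2.le⟩).le _)] at this)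
    (right_mem_Icc.2 hx.1.le)
  have hx0 : 0 < 1 - x := by linarith [hx.2]
  have h1 : 1 ≤ (1 - x) ^ γ :=
    Real.one_le_rpow_of_pos_of_le_one_of_nonpos hx0 (by linarith [hx.1, hbm.2.1]) hγ.le
  rw [Real.norm_of_nonneg (Real.rpow_nonneg hx0.le _)]
  nlinarith [norm_nonneg (u b)]

theorem contDiffOn_weight (a b : ℝ) (N : ℕ) :
    ContDiffOn ℝ N (fun x : ℝ => (((1 - x) ^ a * (1 + x) ^ b : ℝ) : ℂ)) (Ioo (-1 : ℝ) 1) := by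
  intro x hx
  apply ContDiffAt.contDiffWithinAt
  apply Complex.ofRealCLM.contDiff.contDiffAt.comp
  apply ContDiffAt.mul
  · exact (contDiffAt_const.sub contDiffAt_id).rpow_const_of_ne (by simp only [id]; linarith [hx.2])
  · exact (contDiffAt_const.add contDiffAt_id).rpow_const_of_ne (by simp only [id]; linarith [hx.1])

theorem contDiffOn_deriv' {N : ℕ} {u : ℝ → ℂ} (h : ContDiffOn ℝ (N + 1 : ℕ) u (Ioo (-1 : ℝ) 1)) :
    ContDiffOn ℝ N (deriv u) (Ioo (-1 : ℝ) 1) := by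
  push_cast at h
  exact ((contDiffOn_succ_iff_deriv_of_isOpen isOpen_Ioo).1 h).2.2

theorem integrable_tm : IntegrableAtFilter (fun x : ℝ => (1 - x) ^ (-1/2 : ℝ)) (𝓝[<] (1 : ℝ)) := by
  refine ⟨Ioo 0 1, ev_Ioo0, ?_⟩
  have h := (intervalIntegral.intervalIntegrable_rpow' (a := 1) (b := 0)
    (show (-1 : ℝ) < -1/2 by norm_num)).comp_sub_left 1
  simp only [sub_self, sub_zero] at h
  rw [intervalIntegrable_iff_integrableOn_Ioo_of_le (by norm_num)] at h
  exact h

/-- Main regularity estimate. -/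
theorem main_est (α β : ℝ) (hα0 : 0 ≤ α) (n : ℕ) : ∀ f : ℝ → ℂ,
    ContDiffOn ℝ (2 * n : ℕ) f (Ioo (-1 : ℝ) 1) → LwOne α β ((jacobiL α β)^[n] f) →
    LwOne α β f ∧ SymCl (2 * n) (-α - 1/2) f := by
  induction n with
  | zero => intro f _ h; exact ⟨h, trivial⟩
  | succ n ih =>
    intro f hf hL
    rw [show 2 * (n + 1) = (2 * n + 1) + 1 by ring] at hf
    set p : ℝ → ℂ := fun y : ℝ => (((1 - y) ^ (α + 1) * (1 + y) ^ (β + 1) : ℝ) : ℂ) * deriv f y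
      with hp
    have hfd : ∀ x ∈ Ioo (-1 : ℝ) 1, DifferentiableAt ℝ f x := fun x hx =>
      (hf.differentiableOn (by simp)).differentiableAt (isOpen_Ioo.mem_nhds hx)
    have hpC : ContDiffOn ℝ (2 * n + 1 : ℕ) p (Ioo (-1 : ℝ) 1) :=
      (contDiffOn_weight _ _ _).mul (contDiffOn_deriv' hf)
    have hpd : ∀ x ∈ Ioo (-1 : ℝ) 1, DifferentiableAt ℝ p x := fun x hx =>
      (hpC.differentiableOn (by simp)).differentiableAt (isOpen_Ioo.mem_nhds hx)
    have hLf : jacobiL α β f = fun x =>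
      -((((1 - x) ^ (-α) * (1 + x) ^ (-β) : ℝ) : ℂ) * deriv p x) := rfl
    have hvC : ContDiffOn ℝ (2 * n : ℕ) (jacobiL α β f) (Ioo (-1 : ℝ) 1) := by
      rw [hLf]
      exact ((contDiffOn_weight _ _ _).mul (contDiffOn_deriv' hpC)).neg
    obtain ⟨hvL, hvS⟩ := ih (jacobiL α β f) hvC (by rwa [Function.iterate_succ_apply] at hL)
    have hpv : ∀ x ∈ Ioo (-1 : ℝ) 1,
        -((((1 - x) ^ α * (1 + x) ^ β : ℝ) : ℂ) * jacobiL α β f x) = deriv p x := by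
      intro x hx
      have h1 : 0 < 1 - x := by linarith [hx.2]
      have h2 : 0 < 1 + x := by linarith [hx.1]
      rw [hLf]
      simp only [mul_neg, neg_neg]
      rw [← mul_assoc, ← Complex.ofReal_mul]
      have : (1 - x) ^ α * (1 + x) ^ β * ((1 - x) ^ (-α) * (1 + x) ^ (-β)) = 1 := by
        rw [mul_mul_mul_comm, ← Real.rpow_add h1, ← Real.rpow_add h2]
        simp
      rw [this]; simp
    have hpI : IntegrableAtFilter (deriv p) (𝓝[<] (1 : ℝ)) := by
      obtain ⟨s, hs, hsi⟩ := hvL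
      have hsi' := hsi.neg
      obtain ⟨a, ha, has⟩ := (mem_nhdsLT_iff_exists_Ioo_subset' (show (0 : ℝ) < 1 by norm_num)).1
        (inter_mem hs ev_Ioo)
      refine ⟨Ioo a 1, Ioo_mem_nhdsLT ha, ?_⟩
      refine IntegrableOn.congr_fun (hsi'.mono_set fun x hx => (has hx).1) ?_ measurableSet_Ioo
      intro x hx
      exact hpv x (has hx).2
    have hpO : p =O[𝓝[<] (1 : ℝ)] fun x : ℝ => (1 - x) ^ (-1/2 : ℝ) := by
      have h := bigO_const_of_deriv hpd hpI
      have h2 := rpow_bigO (γ := 0) (δ := -1/2) (by norm_num)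
      simp only [Real.rpow_zero] at h2
      exact h.trans h2
    have hp'S : SymCl (2 * n) (-1/2 - 1) (deriv p) := by
      have h := (((SymCl.weight (2 * n) α β).mul hvS).mul
        ((SymCl.rpow_sub (2 * n) (-1) 0))).weaken (δ := -1/2 - 1) (by linarith)
      refine h.congr fun x hx => ?_
      rw [← hpv x hx]
      simp
    have hpS : SymCl (2 * n + 1) (-1/2) p := ⟨hpd, hpO, hp'S⟩
    have hf'S : SymCl (2 * n + 1) (-α - 1/2 - 1) (deriv f) := by
      have h := ((SymCl.weight (2 * n + 1) (-(α + 1)) (-(β + 1))).mul hpS).weaken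
        (δ := -α - 1/2 - 1) (by linarith)
      refine h.congr fun x hx => ?_
      have h1 : 0 < 1 - x := by linarith [hx.2]
      have h2 : 0 < 1 + x := by linarith [hx.1]
      simp only [hp]
      rw [← mul_assoc, ← Complex.ofReal_mul]
      have : (1 - x) ^ (-(α + 1)) * (1 + x) ^ (-(β + 1)) *
          ((1 - x) ^ (α + 1) * (1 + x) ^ (β + 1)) = 1 := by
        rw [mul_mul_mul_comm, ← Real.rpow_add h1, ← Real.rpow_add h2]
        simp
      rw [this]; simp
    have hfO := bigO_of_deriv (γ := -α - 1/2) (by linarith) hfd hf'S.2.1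
    refine ⟨?_, hfd, hfO, hf'S⟩
    have hw := (SymCl.weight 1 α β)
    have hO := (hw.mul (show SymCl 1 (-α - 1/2) f from ⟨hfd, hfO, trivial⟩))
    refine hO.2.1.integrableAtFilter ?_ ?_
    · refine ⟨Ioo (-1) 1, ev_Ioo, ContinuousOn.aestronglyMeasurable ?_ measurableSet_Ioo⟩
      exact fun x hx => (hO.1 x hx).continuousAt.continuousWithinAt
    · rw [show α + (-α - 1 / 2) = -1 / 2 by ring]
      exact integrable_tm

theorem tendsto_term {u v : ℝ → ℂ} {γ δ : ℝ} (hu : SymCl 1 γ u) (hv : SymCl 1 δ v)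
    (h : 0 < γ + δ) : Tendsto (fun x => u x * v x) (𝓝[<] (1 : ℝ)) (𝓝 0) := by
  refine (hu.mul hv).2.1.trans_tendsto ?_
  have h1 : Tendsto (fun x : ℝ => 1 - x) (𝓝 1) (𝓝 0) := by
    have : ContinuousAt (fun x : ℝ => 1 - x) 1 := by fun_prop
    simpa [ContinuousAt] using this
  have h2 := h1.rpow_const (p := γ + δ) (Or.inr h.le)
  rw [Real.zero_rpow h.ne'] at h2
  exact h2.mono_left nhdsWithin_le_nhds

theorem sesq_tendsto (α β : ℝ) (n s : ℕ) (hs : n ≤ s) (f : ℝ → ℂ)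
    (hf : SymCl (2 * n) (-α - 1/2) f) :
    Tendsto (sesq α β n f (fun x : ℝ => (((1 - x) ^ s : ℝ) : ℂ))) (𝓝[<] (1 : ℝ)) (𝓝 0) := by
  have hg : ∀ N, SymCl N s (fun x : ℝ => (((1 - x) ^ s : ℝ) : ℂ)) := fun N =>
    (SymCl.rpow_sub N 1 s).congr fun x _ => by simp
  unfold sesq
  rw [show (0 : ℂ) = ∑ k ∈ Finset.Icc 1 n, ∑ j ∈ Finset.Icc 1 k, (-1 : ℂ) ^ (k + j) * (0 - 0) by
    simp]
  refine tendsto_finsetSum _ fun k hk => tendsto_finsetSum _ fun j hj => ?_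
  rw [Finset.mem_Icc] at hk hj
  have hks : (k : ℝ) ≤ s := by exact_mod_cast hk.2.trans hs
  have hkj : ((k - j : ℕ) : ℝ) = k - j := by rw [Nat.cast_sub hj.2]
  have hj1 : ((j - 1 : ℕ) : ℝ) = j - 1 := by rw [Nat.cast_sub hj.1]; simp
  refine Tendsto.const_mul _ (Tendsto.sub ?_ ?_)
  · have a1 := (SymCl.weight (1 + (k - j)) (α + k) (β + k)).mul
      (SymCl.iter k (hg (1 + (k - j) + k)))
    have a2 := SymCl.iter (N := 1) (k - j) a1
    have a3 := SymCl.iter (N := 1) (j - 1) (hf.le (by omega))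
    refine tendsto_term a2 a3 ?_
    rw [hkj, hj1]; linarith
  · have a1 := (SymCl.weight (1 + (k - j)) (α + k) (β + k)).mul
      (SymCl.iter k (hf.le (N := 1 + (k - j) + k) (by omega)))
    have a2 := SymCl.iter (N := 1) (k - j) a1
    have a3 := SymCl.iter (N := 1) (j - 1) (hg (1 + (j - 1)))
    refine tendsto_term a2 a3 ?_
    rw [hkj, hj1]; linarith

theorem lwOne_of_memL2 (α β : ℝ) (hα0 : 0 ≤ α) (hβ0 : 0 ≤ β) (h : ℝ → ℂ) (hm : Measurable h)
    (hL : MemL2ab α β h) : LwOne α β h := by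
  refine ⟨Ioo (-1) 1, ev_Ioo, ?_⟩
  have hw : Measurable fun x : ℝ => (1 - x) ^ α * (1 + x) ^ β := by fun_prop
  have hwi : IntegrableOn (fun x : ℝ => (2 : ℝ) ^ β * (2 : ℝ) ^ α) (Ioo (-1 : ℝ) 1) := by
    exact integrableOn_const (by simp)
  refine Integrable.mono' (hwi.add hL) ?_ ?_
  · exact ((Complex.measurable_ofReal.comp hw).mul hm).aestronglyMeasurable
  · refine (ae_restrict_iff' measurableSet_Ioo).2 (Eventually.of_forall fun x hx => ?_)
    have h1 : 0 < 1 - x := by linarith [hx.2]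
    have h2 : 0 < 1 + x := by linarith [hx.1]
    have e1 : (1 - x) ^ α ≤ 2 ^ α := Real.rpow_le_rpow h1.le (by linarith [hx.1]) hα0
    have e2 : (1 + x) ^ β ≤ 2 ^ β := Real.rpow_le_rpow h2.le (by linarith [hx.2]) hβ0
    have p1 : 0 < (1 - x) ^ α := Real.rpow_pos_of_pos h1 _
    have p2 : 0 < (1 + x) ^ β := Real.rpow_pos_of_pos h2 _
    have e3 : (1 - x) ^ α * (1 + x) ^ β ≤ 2 ^ β * 2 ^ α := by
      rw [mul_comm]; gcongr
    rw [norm_mul, Complex.norm_real, Real.norm_of_nonneg (by positivity)]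
    simp only [Pi.add_apply]
    have p3 : 0 < (1 - x) ^ α * (1 + x) ^ β := by positivity
    nlinarith [mul_nonneg p3.le (sq_nonneg (‖h x‖ - 1)), norm_nonneg (h x),
      mul_nonneg p3.le (sq_nonneg (‖h x‖))]

theorem measurable_jacobiL (α β : ℝ) (f : ℝ → ℂ) : Measurable (jacobiL α β f) := by
  unfold jacobiL
  refine Measurable.neg (Measurable.mul ?_ (measurable_deriv _))
  exact Complex.measurable_ofReal.comp (by fun_prop)

theorem side_one (α β : ℝ) (hα0 : 0 ≤ α) (hβ0 : 0 ≤ β) (n : ℕ) (hn : 1 ≤ n)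
    (s : ℕ) (hs : n ≤ s) (f : ℝ → ℂ) (hf : JacobiMaxDom α β n f) :
    Tendsto (sesq α β n f (fun x : ℝ => (((1 - x) ^ s : ℝ) : ℂ))) (𝓝[<] (1 : ℝ)) (𝓝 0) := by
  obtain ⟨h1, -, h3⟩ := hf
  refine sesq_tendsto α β n s hs f (main_est α β hα0 n f (by exact_mod_cast h1) ?_).2
  refine lwOne_of_memL2 α β hα0 hβ0 _ ?_ h3
  obtain ⟨m, rfl⟩ : ∃ m, n = m + 1 := ⟨n - 1, by omega⟩
  rw [Function.iterate_succ_apply']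
  exact measurable_jacobiL _ _ _

theorem jacobiL_neg (α β : ℝ) (f : ℝ → ℂ) :
    jacobiL β α (fun x => f (-x)) = fun x => jacobiL α β f (-x) := by
  funext x
  unfold jacobiL
  have h1 : (fun y : ℝ => (((1 - y) ^ (β + 1) * (1 + y) ^ (α + 1) : ℝ) : ℂ) *
      deriv (fun x => f (-x)) y) = fun y : ℝ => -(fun z : ℝ =>
        (((1 - z) ^ (α + 1) * (1 + z) ^ (β + 1) : ℝ) : ℂ) * deriv f z) (-y) := by
    funext y
    rw [deriv_comp_neg]
    simp only [sub_neg_eq_add, ← sub_eq_add_neg]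
    rw [mul_comm ((1 - y) ^ (β + 1))]
    ring
  rw [h1, deriv.fun_neg, deriv_comp_neg (fun z : ℝ =>
        (((1 - z) ^ (α + 1) * (1 + z) ^ (β + 1) : ℝ) : ℂ) * deriv f z)]
  simp only [sub_neg_eq_add, ← sub_eq_add_neg, neg_neg]
  rw [mul_comm ((1 - x) ^ (-β))]

theorem jacobiL_iter_neg (α β : ℝ) (n : ℕ) (f : ℝ → ℂ) :
    (jacobiL β α)^[n] (fun x => f (-x)) = fun x => (jacobiL α β)^[n] f (-x) := by
  induction n generalizing f with
  | zero => rfl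
  | succ n ih => rw [Function.iterate_succ_apply, jacobiL_neg, ih, Function.iterate_succ_apply]

theorem memL2_neg (α β : ℝ) (f : ℝ → ℂ) (h : MemL2ab α β f) : MemL2ab β α (fun x => f (-x)) := by
  unfold MemL2ab at *
  have h2 := h.comp_neg
  have e : -(Ioo (-1 : ℝ) 1) = Ioo (-1 : ℝ) 1 := by simp
  rw [e] at h2
  refine h2.congr_fun (fun x _ => ?_) measurableSet_Ioo
  simp only [sub_neg_eq_add, ← sub_eq_add_neg]
  ring

theorem maxDom_neg (α β : ℝ) (n : ℕ) (f : ℝ → ℂ) (h : JacobiMaxDom α β n f) :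
    JacobiMaxDom β α n (fun x => f (-x)) := by
  obtain ⟨h1, h2, h3⟩ := h
  refine ⟨?_, memL2_neg α β f h2, ?_⟩
  · exact h1.comp contDiff_neg.contDiffOn fun x hx => ⟨by linarith [hx.2], by linarith [hx.1]⟩
  · rw [jacobiL_iter_neg]
    exact memL2_neg α β _ h3

theorem iter_ak_neg (α β : ℝ) (k m : ℕ) (u : ℝ → ℂ) (x : ℝ) :
    iteratedDeriv m (fun y => ((ak β α k y : ℝ) : ℂ) * iteratedDeriv k (fun z => u (-z)) y) x =
      (-1) ^ (m + k) *
        iteratedDeriv m (fun y => ((ak α β k y : ℝ) : ℂ) * iteratedDeriv k u y) (-x) := by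
  have : (fun y => ((ak β α k y : ℝ) : ℂ) * iteratedDeriv k (fun z => u (-z)) y) =
      fun y => (-1 : ℂ) ^ k *
        (fun z => ((ak α β k z : ℝ) : ℂ) * iteratedDeriv k u z) (-y) := by
    funext y
    rw [iteratedDeriv_comp_neg]
    simp only [ak, sub_neg_eq_add, ← sub_eq_add_neg, Complex.real_smul]
    push_cast
    ring
  rw [this, iteratedDeriv_const_mul_field, iteratedDeriv_comp_neg m
    (fun z => ((ak α β k z : ℝ) : ℂ) * iteratedDeriv k u z)]
  simp only [Complex.real_smul]
  push_cast
  ring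

theorem sesq_neg (α β : ℝ) (n : ℕ) (f g : ℝ → ℂ) (x : ℝ) :
    sesq α β n f g (-x) = -sesq β α n (fun y => f (-y)) (fun y => g (-y)) x := by
  unfold sesq
  rw [← Finset.sum_neg_distrib]
  refine Finset.sum_congr rfl fun k hk => ?_
  rw [← Finset.sum_neg_distrib]
  refine Finset.sum_congr rfl fun j hj => ?_
  rw [Finset.mem_Icc] at hj
  rw [iter_ak_neg, iter_ak_neg, iteratedDeriv_comp_neg, iteratedDeriv_comp_neg]
  simp only [Complex.real_smul]
  push_cast
  have hsgn : (-1 : ℂ) ^ (k - j + k) * (-1) ^ (j - 1) = -1 := by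
    rw [← pow_add, Odd.neg_one_pow]
    exact ⟨k - 1, by omega⟩
  linear_combination (-1 : ℂ) ^ (k + j) *
    (iteratedDeriv (k - j) (fun y => ((ak α β k y : ℝ) : ℂ) * iteratedDeriv k g y) (-x) *
        iteratedDeriv (j - 1) f (-x) -
      iteratedDeriv (k - j) (fun y => ((ak α β k y : ℝ) : ℂ) * iteratedDeriv k f y) (-x) *
        iteratedDeriv (j - 1) g (-x)) * hsgn

/-- For `s ≥ n` and `f` in the maximal domain of the `n`-th power of the Jacobi
expression, the sesquilinear form `[f,(1-x)^s]_n` vanishes in the limit at `1` and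
`[f,(1+x)^s]_n` vanishes in the limit at `-1`; hence these power functions lie in the
minimal domain. -/
theorem jacobi_power_functions_in_minimal_domain (α β : ℝ)
    (hα0 : 0 ≤ α) (hα1 : α < 1) (hβ0 : 0 ≤ β) (hβ1 : β < 1) (n : ℕ) (hn : 1 ≤ n)
    (s : ℕ) (hs : n ≤ s) (f : ℝ → ℂ) (hf : JacobiMaxDom α β n f) :
    Tendsto (sesq α β n f (fun x : ℝ => (((1 - x) ^ s : ℝ) : ℂ))) (𝓝[<] (1 : ℝ)) (𝓝 0) ∧
    Tendsto (sesq α β n f (fun x : ℝ => (((1 + x) ^ s : ℝ) : ℂ))) (𝓝[>] (-1 : ℝ)) (𝓝 0) := by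
  refine ⟨side_one α β hα0 hβ0 n hn s hs f hf, ?_⟩
  have h := side_one β α hβ0 hα0 n hn s hs _ (maxDom_neg α β n f hf)
  have hneg : Tendsto (fun x : ℝ => -x) (𝓝[>] (-1 : ℝ)) (𝓝[<] (1 : ℝ)) := by
    simpa using tendsto_neg_nhdsGT (a := (-1 : ℝ))
  have h2 := (h.comp hneg).neg
  rw [neg_zero] at h2
  refine h2.congr fun x => ?_
  have h3 := sesq_neg α β n f (fun x : ℝ => (((1 + x) ^ s : ℝ) : ℂ)) (-x)
  rw [neg_neg] at h3
  rw [h3]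
  simp only [Function.comp_apply, ← sub_eq_add_neg]
end

section
/- Fix 0 ≤ α, β < 1 and n ∈ ℕ, and let j ∈ ℕ₀. Then the functions g_j(x) = (1-x)^{-α+j} and h_j(x) = (1+x)^{-β+j} belong to the maximal domain D_max^{J,n} of the n-th power of the Jacobi expression; in particular g_j, h_j ∈ L²_{α,β}(-1,1) and ℓ^n_{α,β}[g_j], ℓ^n_{α,β}[h_j] ∈ L²_{α,β}(-1,1). -/
open MeasureTheory Set Filter Topology

/-- On `(-1,1)`, `f` is `(1-x)^{-α}` times a polynomial. -/
def FormG (α : ℝ) (f : ℝ → ℂ) : Prop :=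
  ∃ p : Polynomial ℝ, ∀ x ∈ Ioo (-1 : ℝ) 1, f x = (((1 - x) ^ (-α) * p.eval x : ℝ) : ℂ)

/-- On `(-1,1)`, `f` is `(1+x)^{-β}` times a polynomial. -/
def FormH (β : ℝ) (f : ℝ → ℂ) : Prop :=
  ∃ p : Polynomial ℝ, ∀ x ∈ Ioo (-1 : ℝ) 1, f x = (((1 + x) ^ (-β) * p.eval x : ℝ) : ℂ)

lemma hasDerivAt_one_sub_rpow (s x : ℝ) (hx : 0 < 1 - x) :
    HasDerivAt (fun y : ℝ => (1 - y) ^ s) (-(s * (1 - x) ^ (s - 1))) x := by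
  have h := ((hasDerivAt_id x).const_sub 1).rpow_const (p := s) (Or.inl hx.ne')
  have h2 : HasDerivAt (fun y : ℝ => (1 - y) ^ s) (-1 * s * (1 - x) ^ (s - 1)) x := h
  convert h2 using 1
  ring

lemma hasDerivAt_one_add_rpow (s x : ℝ) (hx : 0 < 1 + x) :
    HasDerivAt (fun y : ℝ => (1 + y) ^ s) (s * (1 + x) ^ (s - 1)) x := by
  have h := ((hasDerivAt_id x).const_add 1).rpow_const (p := s) (Or.inl hx.ne')
  have h2 : HasDerivAt (fun y : ℝ => (1 + y) ^ s) (1 * s * (1 + x) ^ (s - 1)) x := h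
  convert h2 using 1
  ring

lemma FormG.jacobiL {α β : ℝ} {f : ℝ → ℂ} (hf : FormG α f) : FormG α (jacobiL α β f) := by
  obtain ⟨p, hp⟩ := hf
  set r : Polynomial ℝ := Polynomial.C α * p + (1 - Polynomial.X) * Polynomial.derivative p with hr
  have h1 : ∀ x ∈ Ioo (-1 : ℝ) 1,
      (((1 - x) ^ (α + 1) * (1 + x) ^ (β + 1) : ℝ) : ℂ) * deriv f x =
        (((1 + x) ^ (β + 1) * r.eval x : ℝ) : ℂ) := by
    intro x hx
    have hx1 : 0 < 1 - x := by linarith [hx.2]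
    have e : f =ᶠ[𝓝 x] fun y => (((1 - y) ^ (-α) * p.eval y : ℝ) : ℂ) :=
      Filter.eventuallyEq_of_mem (isOpen_Ioo.mem_nhds hx) hp
    have hd := ((hasDerivAt_one_sub_rpow (-α) x hx1).mul (p.hasDerivAt x)).ofReal_comp
    simp only [Pi.mul_apply] at hd
    rw [e.deriv_eq, HasDerivAt.deriv hd, ← Complex.ofReal_mul]
    congr 1
    have a1 : (1 - x) ^ (α + 1) * (1 - x) ^ (-α - 1) = 1 := by
      rw [← Real.rpow_add hx1]; ring_nf; simp
    have a2 : (1 - x) ^ (α + 1) * (1 - x) ^ (-α) = 1 - x := by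
      rw [← Real.rpow_add hx1]; ring_nf; simp
    simp only [hr, Polynomial.eval_add, Polynomial.eval_mul, Polynomial.eval_C,
      Polynomial.eval_sub, Polynomial.eval_one, Polynomial.eval_X]
    linear_combination (1 + x) ^ (β + 1) * (α * p.eval x * a1 + p.derivative.eval x * a2)
  refine ⟨-(Polynomial.C (β + 1) * r + (1 + Polynomial.X) * Polynomial.derivative r), ?_⟩
  intro x hx
  have hx2 : 0 < 1 + x := by linarith [hx.1]
  have e : (fun y : ℝ => (((1 - y) ^ (α + 1) * (1 + y) ^ (β + 1) : ℝ) : ℂ) * deriv f y)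
      =ᶠ[𝓝 x] fun y => (((1 + y) ^ (β + 1) * r.eval y : ℝ) : ℂ) :=
    Filter.eventuallyEq_of_mem (isOpen_Ioo.mem_nhds hx) h1
  have hd := ((hasDerivAt_one_add_rpow (β + 1) x hx2).mul (r.hasDerivAt x)).ofReal_comp
  simp only [Pi.mul_apply] at hd
  unfold _root_.jacobiL
  rw [e.deriv_eq, HasDerivAt.deriv hd, ← Complex.ofReal_mul, ← Complex.ofReal_neg]
  congr 1
  have a1 : (1 + x) ^ (-β) * (1 + x) ^ (β + 1 - 1) = 1 := by
    rw [← Real.rpow_add hx2]; ring_nf; simp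
  have a2 : (1 + x) ^ (-β) * (1 + x) ^ (β + 1) = 1 + x := by
    rw [← Real.rpow_add hx2]; ring_nf; simp
  simp only [Polynomial.eval_add, Polynomial.eval_mul, Polynomial.eval_C, Polynomial.eval_neg,
    Polynomial.eval_one, Polynomial.eval_X]
  linear_combination -(1 - x) ^ (-α) * ((β + 1) * r.eval x * a1 + r.derivative.eval x * a2)

lemma FormH.jacobiL {α β : ℝ} {f : ℝ → ℂ} (hf : FormH β f) : FormH β (jacobiL α β f) := by
  obtain ⟨p, hp⟩ := hf
  set r : Polynomial ℝ := -Polynomial.C β * p + (1 + Polynomial.X) * Polynomial.derivative p with hr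
  have h1 : ∀ x ∈ Ioo (-1 : ℝ) 1,
      (((1 - x) ^ (α + 1) * (1 + x) ^ (β + 1) : ℝ) : ℂ) * deriv f x =
        (((1 - x) ^ (α + 1) * r.eval x : ℝ) : ℂ) := by
    intro x hx
    have hx1 : 0 < 1 + x := by linarith [hx.1]
    have e : f =ᶠ[𝓝 x] fun y => (((1 + y) ^ (-β) * p.eval y : ℝ) : ℂ) :=
      Filter.eventuallyEq_of_mem (isOpen_Ioo.mem_nhds hx) hp
    have hd := ((hasDerivAt_one_add_rpow (-β) x hx1).mul (p.hasDerivAt x)).ofReal_comp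
    simp only [Pi.mul_apply] at hd
    rw [e.deriv_eq, HasDerivAt.deriv hd, ← Complex.ofReal_mul]
    congr 1
    have a1 : (1 + x) ^ (β + 1) * (1 + x) ^ (-β - 1) = 1 := by
      rw [← Real.rpow_add hx1]; ring_nf; simp
    have a2 : (1 + x) ^ (β + 1) * (1 + x) ^ (-β) = 1 + x := by
      rw [← Real.rpow_add hx1]; ring_nf; simp
    simp only [hr, Polynomial.eval_add, Polynomial.eval_mul, Polynomial.eval_C,
      Polynomial.eval_neg, Polynomial.eval_one, Polynomial.eval_X]
    linear_combination (1 - x) ^ (α + 1) * (-β * p.eval x * a1 + p.derivative.eval x * a2)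
  refine ⟨-(-Polynomial.C (α + 1) * r + (1 - Polynomial.X) * Polynomial.derivative r), ?_⟩
  intro x hx
  have hx2 : 0 < 1 - x := by linarith [hx.2]
  have e : (fun y : ℝ => (((1 - y) ^ (α + 1) * (1 + y) ^ (β + 1) : ℝ) : ℂ) * deriv f y)
      =ᶠ[𝓝 x] fun y => (((1 - y) ^ (α + 1) * r.eval y : ℝ) : ℂ) :=
    Filter.eventuallyEq_of_mem (isOpen_Ioo.mem_nhds hx) h1
  have hd := ((hasDerivAt_one_sub_rpow (α + 1) x hx2).mul (r.hasDerivAt x)).ofReal_comp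
  simp only [Pi.mul_apply] at hd
  unfold _root_.jacobiL
  rw [e.deriv_eq, HasDerivAt.deriv hd, ← Complex.ofReal_mul, ← Complex.ofReal_neg]
  congr 1
  have a1 : (1 - x) ^ (-α) * (1 - x) ^ (α + 1 - 1) = 1 := by
    rw [← Real.rpow_add hx2]; ring_nf; simp
  have a2 : (1 - x) ^ (-α) * (1 - x) ^ (α + 1) = 1 - x := by
    rw [← Real.rpow_add hx2]; ring_nf; simp
  simp only [Polynomial.eval_add, Polynomial.eval_mul, Polynomial.eval_C, Polynomial.eval_neg,
    Polynomial.eval_sub, Polynomial.eval_one, Polynomial.eval_X]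
  linear_combination -(1 + x) ^ (-β) * (-(α + 1) * r.eval x * a1 + r.derivative.eval x * a2)

lemma FormG.memL2 {α β : ℝ} (hα1 : α < 1) (hβ0 : 0 ≤ β) {f : ℝ → ℂ} (hf : FormG α f) :
    MemL2ab α β f := by
  obtain ⟨p, hp⟩ := hf
  have h0 : IntervalIntegrable (fun x : ℝ => x ^ (-α)) volume 0 2 :=
    intervalIntegral.intervalIntegrable_rpow' (by linarith)
  have h1 := (h0.comp_sub_left 1).symm
  norm_num at h1
  rw [intervalIntegrable_iff_integrableOn_Icc_of_le (by norm_num)] at h1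
  have hc : ContinuousOn (fun x : ℝ => (p.eval x) ^ 2 * (1 + x) ^ β) (Icc (-1) 1) := by
    have := (p.continuous.pow 2).mul
      ((continuous_const.add continuous_id).rpow_const (p := β) (f := fun x : ℝ => 1 + x)
        fun x => Or.inr hβ0)
    exact this.continuousOn
  have h2 := (h1.mul_continuousOn hc isCompact_Icc).mono_set (Ioo_subset_Icc_self)
  refine h2.congr_fun (fun x hx => ?_) measurableSet_Ioo
  have hx1 : 0 < 1 - x := by linarith [hx.2]
  have a1 : (1 - x) ^ (-α) * (1 - x) ^ α = 1 := by
    rw [← Real.rpow_add hx1]; simp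
  simp only [hp x hx, Complex.norm_real, Real.norm_eq_abs, sq_abs]
  linear_combination -(1 - x) ^ (-α) * (p.eval x) ^ 2 * (1 + x) ^ β * a1

lemma FormH.memL2 {α β : ℝ} (hβ1 : β < 1) (hα0 : 0 ≤ α) {f : ℝ → ℂ} (hf : FormH β f) :
    MemL2ab α β f := by
  obtain ⟨p, hp⟩ := hf
  have h0 : IntervalIntegrable (fun x : ℝ => x ^ (-β)) volume 0 2 :=
    intervalIntegral.intervalIntegrable_rpow' (by linarith)
  have h1 := h0.comp_add_left 1
  norm_num at h1
  rw [intervalIntegrable_iff_integrableOn_Icc_of_le (by norm_num)] at h1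
  have hc : ContinuousOn (fun x : ℝ => (p.eval x) ^ 2 * (1 - x) ^ α) (Icc (-1) 1) := by
    have := (p.continuous.pow 2).mul
      ((continuous_const.sub continuous_id).rpow_const (p := α) (f := fun x : ℝ => 1 - x)
        fun x => Or.inr hα0)
    exact this.continuousOn
  have h2 := (h1.mul_continuousOn hc isCompact_Icc).mono_set (Ioo_subset_Icc_self)
  refine h2.congr_fun (fun x hx => ?_) measurableSet_Ioo
  have hx1 : 0 < 1 + x := by linarith [hx.1]
  have a1 : (1 + x) ^ (-β) * (1 + x) ^ β = 1 := by
    rw [← Real.rpow_add hx1]; simp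
  simp only [hp x hx, Complex.norm_real, Real.norm_eq_abs, sq_abs]
  linear_combination -(1 + x) ^ (-β) * (p.eval x) ^ 2 * (1 - x) ^ α * a1

lemma FormG.iterate {α β : ℝ} {f : ℝ → ℂ} (hf : FormG α f) (n : ℕ) :
    FormG α ((_root_.jacobiL α β)^[n] f) := by
  induction n with
  | zero => exact hf
  | succ k ih => rw [Function.iterate_succ_apply']; exact ih.jacobiL

lemma FormH.iterate {α β : ℝ} {f : ℝ → ℂ} (hf : FormH β f) (n : ℕ) :
    FormH β ((_root_.jacobiL α β)^[n] f) := by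
  induction n with
  | zero => exact hf
  | succ k ih => rw [Function.iterate_succ_apply']; exact ih.jacobiL

/-- For every `j ∈ ℕ₀`, the functions `g_j(x) = (1-x)^{-α+j}` and `h_j(x) = (1+x)^{-β+j}`
belong to the maximal domain `D_max^{J,n}` of the `n`-th power of the Jacobi expression. -/
theorem jacobi_second_kind_powers_in_maximal_domain (α β : ℝ)
    (hα0 : 0 ≤ α) (hα1 : α < 1) (hβ0 : 0 ≤ β) (hβ1 : β < 1) (n : ℕ) (hn : 1 ≤ n)
    (j : ℕ) :
    JacobiMaxDom α β n (fun x : ℝ => (((1 - x) ^ (-α + (j : ℝ)) : ℝ) : ℂ)) ∧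
    JacobiMaxDom α β n (fun x : ℝ => (((1 + x) ^ (-β + (j : ℝ)) : ℝ) : ℂ)) := by
  have hG : FormG α (fun x : ℝ => (((1 - x) ^ (-α + (j : ℝ)) : ℝ) : ℂ)) := by
    refine ⟨(1 - Polynomial.X) ^ j, fun x hx => ?_⟩
    have hx1 : 0 < 1 - x := by linarith [hx.2]
    simp [Real.rpow_add hx1]
  have hH : FormH β (fun x : ℝ => (((1 + x) ^ (-β + (j : ℝ)) : ℝ) : ℂ)) := by
    refine ⟨(1 + Polynomial.X) ^ j, fun x hx => ?_⟩
    have hx1 : 0 < 1 + x := by linarith [hx.1]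
    simp [Real.rpow_add hx1]
  refine ⟨⟨?_, hG.memL2 hα1 hβ0, (hG.iterate n).memL2 hα1 hβ0⟩,
    ⟨?_, hH.memL2 hβ1 hα0, (hH.iterate n).memL2 hβ1 hα0⟩⟩
  · refine Complex.ofRealCLM.contDiff.comp_contDiffOn ?_
    refine ContDiffOn.rpow_const_of_ne (contDiff_const.sub contDiff_id).contDiffOn ?_
    intro x hx
    exact (show (0 : ℝ) < 1 - x by linarith [hx.2]).ne'
  · refine Complex.ofRealCLM.contDiff.comp_contDiffOn ?_
    refine ContDiffOn.rpow_const_of_ne (contDiff_const.add contDiff_id).contDiffOn ?_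
    intro x hx
    exact (show (0 : ℝ) < 1 + x by linarith [hx.1]).ne'
end
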